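/- Let q ≥ 121 be an odd prime power and let E be an elliptic curve defined over F_q with j-invariant j(E) ≠ 0. Then the 4-elliptic code associated to E is not 2-extendable: there is no [n+2, 4, d+2]_q code whose truncation on the first n coordinates equals the 4-elliptic code of length n and minimum distance d. -/

import Mathlib

set_option linter.unusedSectionVars false

namespace NMDS

open WeierstrassCurve

variable {F : Type} [Field F] [Fintype F] [DecidableEq F]

/-- `ψ_i(X,Y)`: `Y^s` if `i = 3s` (`s ≥ 1`), `X·Y^s` if `i = 3s+2` (`s ≥ 0`),
`X²·Y^s` if `i = 3s+4` (`s ≥ 0`). -/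
def psi (i : ℕ) (X Y : F) : F :=
  if i % 3 = 0 then Y ^ (i / 3)
  else if i % 3 = 2 then X * Y ^ (i / 3)
  else X ^ 2 * Y ^ ((i - 4) / 3)

/-- The coordinate vector of `φ_k(P)`: `(1, ψ₂(P), …, ψ_k(P))` for an affine point `P`,
and `(0, …, 0, 1)` for the point at infinity. -/
def phiVec (W : WeierstrassCurve F) (k : ℕ) : W.toAffine.Point → (Fin k → F)
  | .zero => fun j => if (j : ℕ) = k - 1 then 1 else 0
  | .some (x := x) (y := y) _ => fun j => if (j : ℕ) = 0 then 1 else psi ((j : ℕ) + 1) x y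

lemma phiVec_ne_zero (W : WeierstrassCurve F) {k : ℕ} (hk : 0 < k)
    (P : W.toAffine.Point) : phiVec W k P ≠ 0 := by
  cases P with
  | zero =>
    intro h
    have := congrFun h ⟨k - 1, by omega⟩
    simp [phiVec] at this
  | some h' =>
    intro h
    have := congrFun h ⟨0, hk⟩
    simp [phiVec] at this

/-- The image of a rational point of `E` in `P^{k-1}(F_q)` under `φ_k`. -/
noncomputable def phiProj (W : WeierstrassCurve F) {k : ℕ} (hk : 0 < k)
    (P : W.toAffine.Point) : Projectivization F (Fin k → F) :=
  Projectivization.mk F (phiVec W k P) (phiVec_ne_zero W hk P)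

/-- The `k`-elliptic code associated to `E`, relative to an enumeration `e` of the `n`
rational points of `E`: the span of the rows of the `k × n` matrix whose `j`-th column
is `φ_k(P_j)`. -/
def ellipticCode (W : WeierstrassCurve F) (k : ℕ) {n : ℕ}
    (e : Fin n ≃ W.toAffine.Point) : Submodule F (Fin n → F) :=
  Submodule.span F (Set.range fun i : Fin k => fun j : Fin n => phiVec W k (e j) i)

/-- The minimum distance (= minimum weight) of a linear code. -/
noncomputable def minDist {n : ℕ} (C : Submodule F (Fin n → F)) : ℕ :=
  sInf {d | ∃ x ∈ C, x ≠ 0 ∧ hammingNorm x = d}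

/-- The standard inner product with `y` as a linear map. -/
def dotLin {n : ℕ} (y : Fin n → F) : (Fin n → F) →ₗ[F] F where
  toFun x := ∑ i, x i * y i
  map_add' a b := by simp [add_mul, Finset.sum_add_distrib]
  map_smul' c a := by simp [Finset.mul_sum, mul_assoc]

/-- The dual code: all vectors orthogonal to every codeword. -/
def dualCode {n : ℕ} (C : Submodule F (Fin n → F)) : Submodule F (Fin n → F) :=
  ⨅ y ∈ C, LinearMap.ker (dotLin y)

/-- The Singleton defect `s(C) = n - k + 1 - d` of a code of length `n`. -/
noncomputable def singletonDefect {n : ℕ} (C : Submodule F (Fin n → F)) : ℤ :=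
  (n : ℤ) + 1 - Module.finrank F C - minDist C

/-- A code is MDS if its Singleton defect is zero. -/
noncomputable def IsMDS {n : ℕ} (C : Submodule F (Fin n → F)) : Prop :=
  singletonDefect C = 0

/-- A code is near-MDS if both it and its dual have Singleton defect one. -/
noncomputable def IsNMDS {n : ℕ} (C : Submodule F (Fin n → F)) : Prop :=
  singletonDefect C = 1 ∧ singletonDefect (dualCode C) = 1

/-- An `[n,k,d]_q` code `C` is `h`-extendable if there is an `[n+h,k,d+h]_q` code `C'`
whose projection on the first `n` coordinates is `C`. -/
noncomputable def IsHExtendable {n : ℕ} (h : ℕ) (C : Submodule F (Fin n → F)) : Prop :=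
  ∃ C' : Submodule F (Fin (n + h) → F),
    Module.finrank F C' = Module.finrank F C ∧
    minDist C' = minDist C + h ∧
    Submodule.map (LinearMap.funLeft F F (Fin.castAdd h)) C' = C

/-- The point `p` of `P^{k-1}(F_q)` lies on the hyperplane with coefficient vector `a`. -/
def OnHyp {k : ℕ} (a : Fin k → F) (p : Projectivization F (Fin k → F)) : Prop :=
  ∑ i, a i * p.rep i = 0

/-- An `(·; k, k-2)`-set in `P^{k-1}(F_q)`: no `k+1` of its points lie on a common hyperplane,
i.e. every hyperplane contains at most `k` of its points. -/
def IsArcSet (k : ℕ) (S : Set (Projectivization F (Fin k → F))) : Prop :=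
  ∀ a : Fin k → F, a ≠ 0 → Set.ncard {p ∈ S | OnHyp a p} ≤ k

/-- A complete `(·; k, k-2)`-set: maximal with respect to set-theoretical inclusion. -/
def IsCompleteArcSet (k : ℕ) (S : Set (Projectivization F (Fin k → F))) : Prop :=
  IsArcSet k S ∧ ∀ T, IsArcSet k T → S ⊆ T → T = S

/-- Evaluation of the homogeneous cubic of a Weierstrass curve:
`Y²Z + a₁XYZ + a₃YZ² - X³ - a₂X²Z - a₄XZ² - a₆Z³`. -/
def cubicEval {R : Type*} [CommRing R] (W : WeierstrassCurve R) (x y z : R) : R :=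
  y ^ 2 * z + W.a₁ * x * y * z + W.a₃ * y * z ^ 2
    - (x ^ 3 + W.a₂ * x ^ 2 * z + W.a₄ * x * z ^ 2 + W.a₆ * z ^ 3)

/-- The gradient of the homogeneous cubic of a Weierstrass curve. -/
def gradEval {R : Type*} [CommRing R] (W : WeierstrassCurve R) (x y z : R) : Fin 3 → R :=
  ![W.a₁ * y * z - (3 * x ^ 2 + 2 * W.a₂ * x * z + W.a₄ * z ^ 2),
    2 * y * z + W.a₁ * x * z + W.a₃ * z ^ 2,
    y ^ 2 + W.a₁ * x * y + 2 * W.a₃ * y * z - (W.a₂ * x ^ 2 + 2 * W.a₄ * x * z + 3 * W.a₆ * z ^ 2)]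

/-- The point `p` of `P²(F_q)` lies on the plane cubic `E`. -/
def OnCurve (W : WeierstrassCurve F) (p : Projectivization F (Fin 3 → F)) : Prop :=
  cubicEval W (p.rep 0) (p.rep 1) (p.rep 2) = 0

/-- A line of `P²(F_q)`, given by its coefficient vector `l`, is a tangent of `E`:
it touches the curve at some point (over the algebraic closure) with multiplicity at
least two, i.e. it is the tangent line of the cubic at a contact point. -/
def IsTangentLine (W : WeierstrassCurve F) (l : Fin 3 → F) : Prop :=
  ∃ v : Fin 3 → AlgebraicClosure F, v ≠ 0 ∧
    cubicEval (W.baseChange (AlgebraicClosure F)) (v 0) (v 1) (v 2) = 0 ∧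
    (∑ i, algebraMap F (AlgebraicClosure F) (l i) * v i) = 0 ∧
    ∃ t : AlgebraicClosure F, t ≠ 0 ∧
      gradEval (W.baseChange (AlgebraicClosure F)) (v 0) (v 1) (v 2) =
        t • fun i => algebraMap F (AlgebraicClosure F) (l i)

/-- A line of `P²(F_q)` intersects `E` in three distinct `F_q`-rational points. -/
def IsThreeSecant (W : WeierstrassCurve F) (l : Fin 3 → F) : Prop :=
  ∃ u v w : Projectivization F (Fin 3 → F), u ≠ v ∧ u ≠ w ∧ v ≠ w ∧
    OnCurve W u ∧ OnCurve W v ∧ OnCurve W w ∧ OnHyp l u ∧ OnHyp l v ∧ OnHyp l w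

open Polynomial
section Stepanov
variable {K : Type*} [Field K]

lemma hasseDeriv_X_pow_prime_pow_mul (p r : ℕ) [Fact p.Prime] [CharP K p] {i : ℕ}
    (hi : i ≠ 0) (hiQ : i < p ^ r) (j : ℕ) :
    hasseDeriv i ((X : K[X]) ^ (p ^ r * j)) = 0 := by
  induction j generalizing i with
  | zero => simpa using hasseDeriv_apply_one i (Nat.pos_of_ne_zero hi)
  | succ j ih =>
    rw [Nat.mul_succ, pow_add, hasseDeriv_mul]
    refine Finset.sum_eq_zero fun x hx => ?_
    have hx' := Finset.HasAntidiagonal.mem_antidiagonal.1 hx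
    by_cases h : x.1 = 0
    · have h2 : x.2 = i := by omega
      have hdvd : p ∣ (p ^ r).choose i :=
        (Fact.out : p.Prime).dvd_choose_pow hi hiQ.ne
      have : hasseDeriv i ((X : K[X]) ^ (p ^ r)) = 0 := by
        rw [X_pow_eq_monomial, hasseDeriv_monomial, (CharP.cast_eq_zero_iff K p _).2 hdvd]
        simp
      rw [h2, this, mul_zero]
    · rw [ih h (by omega), zero_mul]

lemma hasseDeriv_mul_X_pow_prime_pow_mul (p r : ℕ) [Fact p.Prime] [CharP K p] {l : ℕ}
    (hl : l < p ^ r) (g : K[X]) (j : ℕ) :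
    hasseDeriv l (g * X ^ (p ^ r * j)) = hasseDeriv l g * X ^ (p ^ r * j) := by
  rw [hasseDeriv_mul, Finset.sum_eq_single (l, 0)]
  · simp
  · intro x hx hne
    have hx' := Finset.HasAntidiagonal.mem_antidiagonal.1 hx
    have : x.2 ≠ 0 := fun h => hne (Prod.ext (by simp; omega) h)
    rw [hasseDeriv_X_pow_prime_pow_mul p r this (by omega), mul_zero]
  · simp

lemma exists_hasseDeriv_pow_mul_pow (D : K[X]) (m l : ℕ) :
    ∃ R : K[X], hasseDeriv l (D ^ m) * D ^ l = D ^ m * R ∧ R.natDegree ≤ D.natDegree * l := by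
  induction m generalizing l with
  | zero =>
    rcases Nat.eq_zero_or_pos l with rfl | hl
    · exact ⟨1, by simp, by simp⟩
    · exact ⟨0, by simp [hasseDeriv_apply_one l hl], by simp⟩
  | succ m ih =>
    choose R hR hdeg using ih
    refine ⟨∑ x ∈ Finset.HasAntidiagonal.antidiagonal l,
      (if x.1 = 0 then R x.2 else hasseDeriv x.1 D * D ^ (x.1 - 1) * R x.2), ?_, ?_⟩
    · rw [pow_succ', hasseDeriv_mul, Finset.sum_mul, Finset.mul_sum]
      refine Finset.sum_congr rfl fun x hx => ?_
      have hx' := Finset.HasAntidiagonal.mem_antidiagonal.1 hx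
      split_ifs with h
      · have h2 : x.2 = l := by omega
        rw [h, h2, hasseDeriv_zero', mul_assoc, hR]
        ring
      · obtain ⟨i, hi⟩ := Nat.exists_eq_succ_of_ne_zero h
        have hl : l = (i + 1) + x.2 := by omega
        rw [hi, hl, pow_add, Nat.succ_eq_add_one, Nat.add_sub_cancel]
        linear_combination (hasseDeriv (i + 1) D) * D ^ (i + 1) * hR x.2
    · refine natDegree_sum_le_of_forall_le _ _ fun x hx => ?_
      have hx' := Finset.HasAntidiagonal.mem_antidiagonal.1 hx
      split_ifs with h
      · exact (hdeg _).trans (Nat.mul_le_mul_left _ (by omega))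
      · obtain ⟨i, hi⟩ := Nat.exists_eq_succ_of_ne_zero h
        have hl : l = (i + 1) + x.2 := by omega
        rw [hi, hl, Nat.succ_eq_add_one, Nat.add_sub_cancel]
        refine natDegree_mul_le.trans ?_
        have h1 : (hasseDeriv (i + 1) D * D ^ i).natDegree ≤ D.natDegree + i * D.natDegree :=
          natDegree_mul_le.trans (add_le_add
            ((natDegree_hasseDeriv_le _ _).trans (Nat.sub_le _ _)) natDegree_pow_le)
        have h2 := hdeg x.2
        nlinarith

lemma eq_zero_of_eval_X_pow_eq_zero {Q : ℕ} {U : K[X][X]}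
    (hdeg : ∀ n, (U.coeff n).natDegree < Q) (h : U.eval (X ^ Q) = 0) : U = 0 := by
  ext N i
  rw [coeff_zero, coeff_zero]
  by_cases hi : Q ≤ i
  · exact coeff_eq_zero_of_natDegree_lt ((hdeg N).trans_le hi)
  push Not at hi
  have h2 := congrArg (fun f => f.coeff (Q * N + i)) h
  simp only [eval_eq_sum_range' (Nat.lt_succ_of_le (le_max_left U.natDegree N)),
    finsetSum_coeff, coeff_zero] at h2
  rw [Finset.sum_eq_single N] at h2
  · rwa [← pow_mul, add_comm, coeff_mul_X_pow] at h2
  · intro n _ hn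
    rw [← pow_mul, coeff_mul_X_pow']
    split_ifs with hle
    · rcases lt_or_gt_of_ne hn with hlt | hlt
      · refine coeff_eq_zero_of_natDegree_lt ((hdeg n).trans_le ?_)
        have : Q * (n + 1) ≤ Q * N := Nat.mul_le_mul_left _ hlt
        rw [Nat.mul_succ] at this
        omega
      · have : Q * (N + 1) ≤ Q * n := Nat.mul_le_mul_left _ hlt
        rw [Nat.mul_succ] at this
        omega
    · rfl
  · intro hN
    simp at hN

lemma eq_zero_of_mul_sq_eq_C_mul_sq {D u v : K[X]} {β c : K} (hβ : Odd (D.rootMultiplicity β))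
    (hc : c ≠ 0) (h : D * u ^ 2 = C c * v ^ 2) : u = 0 ∧ v = 0 := by
  have hD : D ≠ 0 := by
    rintro rfl
    simp at hβ
  by_cases hu : u = 0
  · subst hu
    simp [hc] at h
    exact ⟨rfl, h⟩
  exfalso
  have hv : v ≠ 0 := by
    rintro rfl
    simp [hD, hu] at h
  have h2 := congrArg (rootMultiplicity β) h
  rw [rootMultiplicity_mul (mul_ne_zero hD (pow_ne_zero _ hu)),
    rootMultiplicity_mul (mul_ne_zero (C_ne_zero.2 hc) (pow_ne_zero _ hv)),
    rootMultiplicity_C, pow_two, pow_two, rootMultiplicity_mul (mul_ne_zero hu hu),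
    rootMultiplicity_mul (mul_ne_zero hv hv)] at h2
  rw [Nat.odd_iff] at hβ
  omega

/-- Linear independence of `1` and `√D` over polynomials of small degree in `X` with coefficients
in `K[X ^ Q]`. -/
lemma eq_zero_of_eval_add_pow_mul_eval_eq_zero [Infinite K] {Q A : ℕ} (hQ : Odd Q) {D : K[X]}
    (hD : D ^ Q = expand K Q D) {β : K} (hβ : Odd (D.rootMultiplicity β))
    (hA : D.natDegree + 2 * A ≤ Q) {H G : K[X][X]}
    (hH : ∀ n, (H.coeff n).degree < A) (hG : ∀ n, (G.coeff n).degree < A)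
    (h : H.eval (X ^ Q) + D ^ ((Q - 1) / 2) * G.eval (X ^ Q) = 0) : H = 0 ∧ G = 0 := by
  have hD0 : D ≠ 0 := by
    rintro rfl
    simp at hβ
  obtain ⟨m, hm⟩ := hQ
  have hm' : (Q - 1) / 2 = m := by omega
  rw [hm'] at h
  have key : C D * H ^ 2 - D.map C * G ^ 2 = 0 := by
    refine eq_zero_of_eval_X_pow_eq_zero (Q := Q) ?_ ?_
    · intro n
      rcases Nat.eq_zero_or_pos A with rfl | hApos
      · have h1 : H = 0 := by
          ext1 n
          simpa using hH n
        have h2 : G = 0 := by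
          ext1 n
          simpa using hG n
        simp [h1, h2]
        omega
      have hnat : ∀ W : K[X][X], (∀ n, (W.coeff n).degree < A) →
          ∀ n, ((W ^ 2).coeff n).natDegree ≤ (A - 1) + (A - 1) := by
        intro W hW n
        rw [pow_two, coeff_mul]
        refine natDegree_sum_le_of_forall_le _ _ fun x _ => natDegree_mul_le.trans ?_
        have : ∀ k, (W.coeff k).natDegree ≤ A - 1 := fun k =>
          Nat.le_sub_one_of_lt (by
            by_cases h0 : W.coeff k = 0
            · simpa [h0] using hApos
            · exact (natDegree_lt_iff_degree_lt h0).2 (hW k))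
        exact add_le_add (this _) (this _)
      have h1 : ((C D * H ^ 2).coeff n).natDegree ≤ D.natDegree + ((A - 1) + (A - 1)) := by
        rw [coeff_C_mul]
        exact natDegree_mul_le.trans (add_le_add le_rfl (hnat H hH n))
      have h2 : ((D.map C * G ^ 2).coeff n).natDegree ≤ (A - 1) + (A - 1) := by
        rw [coeff_mul]
        refine natDegree_sum_le_of_forall_le _ _ fun x _ => natDegree_mul_le.trans ?_
        rw [coeff_map, natDegree_C, zero_add]
        exact hnat G hG _
      rw [coeff_sub]
      refine (natDegree_sub_le _ _).trans_lt (max_lt ?_ ?_) <;> omega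
    · have e : (D.map C).eval (X ^ Q) = D ^ Q := by
        rw [hD, expand_eq_comp_X_pow, comp, eval_map]
      simp only [eval_sub, eval_mul, eval_pow, eval_C, e]
      rw [hm]
      rw [hm] at h
      linear_combination (D * eval (X ^ (2 * m + 1)) H - D ^ (m + 1) * eval (X ^ (2 * m + 1)) G) * h
  have hroot : ∀ c : K, D.eval c ≠ 0 → H.eval (C c) = 0 ∧ G.eval (C c) = 0 := by
    intro c hc
    have h3 := congrArg (eval (C c)) key
    simp only [eval_sub, eval_mul, eval_pow, eval_C, eval_zero] at h3
    rw [eval_map, eval₂_at_apply] at h3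
    exact eq_zero_of_mul_sq_eq_C_mul_sq hβ hc (sub_eq_zero.1 h3)
  have hinf : (C '' {c : K | D.eval c ≠ 0}).Infinite := by
    refine Set.Infinite.image C_injective.injOn ?_
    have : {c : K | D.eval c ≠ 0} = {c : K | D.eval c = 0}ᶜ := rfl
    rw [this]
    refine Set.Finite.infinite_compl ?_
    exact (finite_setOfPred_isRoot hD0)
  constructor
  · refine eq_zero_of_infinite_isRoot _ (hinf.mono ?_)
    rintro _ ⟨c, hc, rfl⟩
    exact (hroot c hc).1
  · refine eq_zero_of_infinite_isRoot _ (hinf.mono ?_)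
    rintro _ ⟨c, hc, rfl⟩
    exact (hroot c hc).2
end Stepanov

open Polynomial
section Stepanov
variable {K : Type*} [Field K]

/-- Stepanov's method: a nonzero polynomial vanishing to order `M` at all points of `Z`. -/
theorem mul_card_le_of_eval_pow_eq [Infinite K] (p r : ℕ) [Fact p.Prime] [CharP K p]
    (hQ : Odd (p ^ r)) {D : K[X]} (hD : D ^ (p ^ r) = expand K (p ^ r) D) {β : K}
    (hβ : Odd (D.rootMultiplicity β)) {ε : K} (hε : ε ≠ 0) {Z : Finset K}
    (hZ : ∀ a ∈ Z, a ^ (p ^ r) = a ∧ D.eval a ^ ((p ^ r - 1) / 2) = ε) {M A J : ℕ}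
    (hA : D.natDegree + 2 * A ≤ p ^ r) (hM : M ≤ p ^ r) (hr : 1 < p ^ r)
    (hcount : M * (A + D.natDegree * M + J) < 2 * (A * J)) :
    M * Z.card ≤ A + D.natDegree * ((p ^ r - 1) / 2) + p ^ r * J := by
  set Q := p ^ r with hQdef
  set m := (Q - 1) / 2 with hm
  set B := A + D.natDegree * M + J with hB
  choose R hR hRdeg using exists_hasseDeriv_pow_mul_pow D m
  have hApos : 0 < A := by
    rcases Nat.eq_zero_or_pos A with h | h
    · simp [h] at hcount
    · exact h
  have hJpos : 0 < J := by
    rcases Nat.eq_zero_or_pos J with h | h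
    · simp [h] at hcount
    · exact h
  -- the linear conditions
  let S : ℕ → K[X] →ₗ[K] K[X] := fun l =>
    ∑ x ∈ Finset.HasAntidiagonal.antidiagonal l,
      (LinearMap.mulRight K (D ^ x.1 * R x.2)).comp (hasseDeriv x.1)
  have hS : ∀ l k, hasseDeriv l (k * D ^ m) * D ^ l = D ^ m * S l k := by
    intro l k
    simp only [S, LinearMap.sum_apply, LinearMap.comp_apply, LinearMap.mulRight_apply,
      hasseDeriv_mul, Finset.sum_mul, Finset.mul_sum]
    refine Finset.sum_congr rfl fun x hx => ?_
    have hx' := Finset.HasAntidiagonal.mem_antidiagonal.1 hx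
    rw [← hx', pow_add]
    linear_combination (hasseDeriv x.1 k) * D ^ x.1 * hR x.2
  have hSdeg : ∀ l k, k.natDegree ≤ A - 1 → (S l k).natDegree ≤ (A - 1) + D.natDegree * l := by
    intro l k hk
    simp only [S, LinearMap.sum_apply, LinearMap.comp_apply, LinearMap.mulRight_apply]
    refine natDegree_sum_le_of_forall_le _ _ fun x hx => natDegree_mul_le.trans ?_
    have hx' := Finset.HasAntidiagonal.mem_antidiagonal.1 hx
    have h1 := ((natDegree_hasseDeriv_le k x.1).trans (Nat.sub_le _ _)).trans hk
    have h2 : (D ^ x.1 * R x.2).natDegree ≤ x.1 * D.natDegree + D.natDegree * x.2 :=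
      natDegree_mul_le.trans (add_le_add natDegree_pow_le (hRdeg _))
    rw [← hx']
    nlinarith
  let T1 : ℕ → (Fin J → degreeLT K A) × (Fin J → degreeLT K A) →ₗ[K] K[X] := fun l =>
    ∑ j : Fin J, ((LinearMap.mulLeft K (D ^ l * X ^ (j : ℕ))).comp
        ((hasseDeriv l).comp ((degreeLT K A).subtype.comp
          ((LinearMap.proj j).comp (LinearMap.fst K _ _)))) +
      (LinearMap.mulLeft K (C ε * X ^ (j : ℕ))).comp
        ((S l).comp ((degreeLT K A).subtype.comp
          ((LinearMap.proj j).comp (LinearMap.snd K _ _)))))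
  have hT1 : ∀ l v, T1 l v = ∑ j : Fin J, (D ^ l * X ^ (j : ℕ) * hasseDeriv l (v.1 j : K[X]) +
      C ε * X ^ (j : ℕ) * S l (v.2 j : K[X])) := by
    intro l v
    simp [T1, LinearMap.sum_apply, mul_assoc]
  have hdegA : ∀ u : degreeLT K A, (u : K[X]).natDegree ≤ A - 1 := by
    intro u
    have := mem_degreeLT.1 u.2
    refine Nat.le_sub_one_of_lt ?_
    by_cases h0 : (u : K[X]) = 0
    · simpa [h0] using hApos
    · exact (natDegree_lt_iff_degree_lt h0).2 this
  have hT1deg : ∀ l < M, ∀ v, (T1 l v).natDegree < B := by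
    intro l hl v
    have hlM : D.natDegree * l ≤ D.natDegree * M := Nat.mul_le_mul_left _ hl.le
    have : (T1 l v).natDegree ≤ (A - 1) + D.natDegree * l + (J - 1) := by
      rw [hT1]
      refine natDegree_sum_le_of_forall_le _ _ fun j _ =>
        (natDegree_add_le _ _).trans (max_le ?_ ?_)
      · refine natDegree_mul_le.trans ?_
        have h1 : (D ^ l * X ^ (j : ℕ)).natDegree ≤ l * D.natDegree + j :=
          natDegree_mul_le.trans (add_le_add natDegree_pow_le (natDegree_X_pow_le _))
        have h2 := ((natDegree_hasseDeriv_le (v.1 j : K[X]) l).trans (Nat.sub_le _ _)).trans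
          (hdegA _)
        have := j.2
        have : (j : ℕ) ≤ J - 1 := by omega
        nlinarith
      · refine natDegree_mul_le.trans ?_
        have h1 : (C ε * X ^ (j : ℕ)).natDegree ≤ 0 + (j : ℕ) :=
          natDegree_mul_le.trans (add_le_add (natDegree_C _).le (natDegree_X_pow_le _))
        have h2 := hSdeg l _ (hdegA (v.2 j))
        have := j.2
        omega
    omega
  let T : (Fin J → degreeLT K A) × (Fin J → degreeLT K A) →ₗ[K] (Fin M → Fin B → K) :=
    LinearMap.pi fun l => LinearMap.pi fun i => (lcoeff K (i : ℕ)).comp (T1 (l : ℕ))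
  have hfin : Module.finrank K (degreeLT K A) = A := by
    rw [(degreeLTEquiv K A).finrank_eq]
    simp
  have : Module.Finite K (degreeLT K A) := Module.Finite.equiv (degreeLTEquiv K A).symm
  have hker : LinearMap.ker T ≠ ⊥ := by
    apply LinearMap.ker_ne_bot_of_finrank_lt
    simp only [Module.finrank_prod, Module.finrank_pi_fintype, hfin, Module.finrank_self,
      Finset.sum_const, Finset.card_univ, Fintype.card_fin, smul_eq_mul, mul_one]
    linarith
  obtain ⟨v, hv, hv0⟩ := Submodule.exists_mem_ne_zero_of_ne_bot hker
  have hv1 : ∀ l < M, T1 l v = 0 := by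
    intro l hl
    ext i
    rw [coeff_zero]
    by_cases hi : i < B
    · have := congrFun (congrFun (LinearMap.mem_ker.1 hv) ⟨l, hl⟩) ⟨i, hi⟩
      simpa [T] using this
    · exact coeff_eq_zero_of_natDegree_lt ((hT1deg l hl v).trans_le (not_lt.1 hi))
  -- the auxiliary polynomial
  let H : K[X][X] := ∑ j : Fin J, C (v.1 j : K[X]) * X ^ (j : ℕ)
  let G : K[X][X] := ∑ j : Fin J, C (v.2 j : K[X]) * X ^ (j : ℕ)
  have hcoeff : ∀ (w : Fin J → degreeLT K A) (n : ℕ),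
      (∑ j : Fin J, C (w j : K[X]) * X ^ (j : ℕ)).coeff n =
        if h : n < J then (w ⟨n, h⟩ : K[X]) else 0 := by
    intro w n
    simp only [finsetSum_coeff, coeff_C_mul_X_pow]
    split_ifs with h
    · rw [Finset.sum_eq_single ⟨n, h⟩]
      · simp
      · intro j _ hj
        rw [if_neg]
        rintro rfl
        exact hj rfl
      · simp
    · refine Finset.sum_eq_zero fun j _ => ?_
      rw [if_neg]
      rintro rfl
      exact h j.2
  have hcdeg : ∀ (w : Fin J → degreeLT K A) (n : ℕ),
      ((∑ j : Fin J, C (w j : K[X]) * X ^ (j : ℕ)).coeff n).degree < (A : WithBot ℕ) := by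
    intro w n
    rw [hcoeff]
    split_ifs with h
    · exact mem_degreeLT.1 (w ⟨n, h⟩).2
    · simp
  let Φ : K[X] := H.eval (X ^ Q) + D ^ m * G.eval (X ^ Q)
  have hΦ0 : Φ ≠ 0 := by
    intro h0
    obtain ⟨h1, h2⟩ := eq_zero_of_eval_add_pow_mul_eval_eq_zero hQ hD hβ hA (hcdeg v.1)
      (hcdeg v.2) h0
    apply hv0
    refine Prod.ext (funext fun j => Subtype.ext ?_) (funext fun j => Subtype.ext ?_)
    · have := hcoeff v.1 j
      rw [show (∑ j : Fin J, C (v.1 j : K[X]) * X ^ (j : ℕ)) = 0 from h1] at this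
      simpa using this.symm
    · have := hcoeff v.2 j
      rw [show (∑ j : Fin J, C (v.2 j : K[X]) * X ^ (j : ℕ)) = 0 from h2] at this
      simpa using this.symm
  have hΦ : Φ = ∑ j : Fin J, ((v.1 j : K[X]) + (v.2 j : K[X]) * D ^ m) * X ^ (Q * (j : ℕ)) := by
    simp only [Φ, H, G, eval_finsetSum, eval_mul, eval_C, eval_pow, eval_X, Finset.mul_sum,
      ← Finset.sum_add_distrib, pow_mul]
    refine Finset.sum_congr rfl fun j _ => ?_
    ring
  have hΦdeg : Φ.natDegree ≤ A + D.natDegree * m + Q * J := by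
    rw [hΦ]
    refine natDegree_sum_le_of_forall_le _ _ fun j _ => natDegree_mul_le.trans ?_
    refine add_le_add ((natDegree_add_le _ _).trans (max_le ?_ (natDegree_mul_le.trans ?_)))
      ((natDegree_X_pow_le _).trans (Nat.mul_le_mul_left _ j.2.le))
    · have := hdegA (v.1 j)
      omega
    · have h1 := hdegA (v.2 j)
      have h2 : (D ^ m).natDegree ≤ m * D.natDegree := natDegree_pow_le
      rw [mul_comm m] at h2
      omega
  have hvan : ∀ a ∈ Z, ∀ l < M, (hasseDeriv l Φ).eval a = 0 := by
    intro a ha l hl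
    obtain ⟨haQ, haD⟩ := hZ a ha
    have hDa : D.eval a ≠ 0 := by
      intro h0
      rw [h0] at haD
      have hm0 : m ≠ 0 := by
        obtain ⟨k, hk⟩ := hQ
        omega
      rw [zero_pow hm0] at haD
      exact hε haD.symm
    have e : hasseDeriv l Φ * D ^ l = ∑ j : Fin J,
        (D ^ l * hasseDeriv l (v.1 j : K[X]) + D ^ m * S l (v.2 j : K[X])) *
          X ^ (Q * (j : ℕ)) := by
      rw [hΦ, map_sum, Finset.sum_mul]
      refine Finset.sum_congr rfl fun j _ => ?_
      rw [hQdef, hasseDeriv_mul_X_pow_prime_pow_mul p r (hl.trans_le hM), map_add]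
      linear_combination X ^ (p ^ r * (j : ℕ)) * hS l (v.2 j : K[X])
    have e2 := congrArg (eval a) e
    have e3 := congrArg (eval a) (hv1 l hl)
    rw [hT1] at e3
    simp only [eval_mul, eval_pow, eval_finsetSum, eval_add, eval_X, eval_C, eval_zero,
      pow_mul, haQ, haD] at e2 e3
    have : eval a (hasseDeriv l Φ) * eval a D ^ l = 0 := by
      rw [e2, ← e3]
      refine Finset.sum_congr rfl fun j _ => ?_
      ring
    exact (mul_eq_zero.1 this).resolve_right (pow_ne_zero _ hDa)
  have hmult : ∀ a ∈ Z, M ≤ Φ.rootMultiplicity a := by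
    intro a ha
    rw [le_rootMultiplicity_iff hΦ0]
    have h1 : X ^ M ∣ taylor a Φ := by
      rw [X_pow_dvd_iff]
      intro l hl
      rw [taylor_coeff]
      exact hvan a ha l hl
    obtain ⟨g, hg⟩ := h1
    refine ⟨taylor (-a) g, ?_⟩
    have h2 := congrArg (taylor (-a)) hg
    rw [taylor_taylor, taylor_mul, taylor_X_pow] at h2
    simpa [sub_eq_add_neg] using h2
  classical
  calc M * Z.card = ∑ a ∈ Z, M := by simp [mul_comm]
    _ ≤ ∑ a ∈ Z, Φ.rootMultiplicity a := Finset.sum_le_sum hmult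
    _ = ∑ a ∈ Z, Φ.roots.count a := by simp [count_roots]
    _ ≤ Φ.roots.card := by
      rw [← Multiset.sum_count_eq_card (s := Z ∪ Φ.roots.toFinset) (m := Φ.roots)
        fun a ha => Finset.mem_union_right _ (Multiset.mem_toFinset.2 ha)]
      exact Finset.sum_le_sum_of_subset Finset.subset_union_left
    _ ≤ Φ.natDegree := card_roots' _
    _ ≤ _ := hΦdeg
end Stepanov

open Polynomial
section Stepanov
variable {K : Type*} [Field K]

theorem two_mul_card_le_of_eval_pow_eq [Infinite K] (p r : ℕ) [Fact p.Prime] [CharP K p]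
    (hQ : Odd (p ^ r)) {D : K[X]} (hD : D ^ (p ^ r) = expand K (p ^ r) D) {β : K}
    (hβ : Odd (D.rootMultiplicity β)) {ε : K} (hε : ε ≠ 0) {Z : Finset K}
    (hZ : ∀ a ∈ Z, a ^ (p ^ r) = a ∧ D.eval a ^ ((p ^ r - 1) / 2) = ε)
    (hlarge : 4 * D.natDegree + 10 ≤ Nat.sqrt (p ^ r)) :
    2 * Z.card ≤ p ^ r + 10 * (D.natDegree + 1) * Nat.sqrt (p ^ r) := by
  set d := D.natDegree with hd
  set M := Nat.sqrt (p ^ r) with hM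
  have h1 : M * M ≤ p ^ r := Nat.sqrt_le _
  have h2 : p ^ r ≤ M * M + 2 * M := by
    have := Nat.sqrt_le_add (p ^ r)
    rw [← hM] at this
    linarith
  have hdle : d ≤ M := by omega
  have hdQ : d ≤ p ^ r := hdle.trans ((Nat.le_mul_self M).trans h1)
  obtain ⟨A, hA1, hA2⟩ : ∃ A, d + 2 * A ≤ p ^ r ∧ p ^ r ≤ d + 2 * A + 1 :=
    ⟨(p ^ r - d) / 2, by omega, by omega⟩
  obtain ⟨J, hJ1, hJ2⟩ : ∃ J, 2 * J ≤ M + 4 * d + 4 ∧ M + 4 * d + 3 ≤ 2 * J :=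
    ⟨M / 2 + 2 * d + 2, by omega, by omega⟩
  have key := mul_card_le_of_eval_pow_eq p r hQ hD hβ hε hZ (M := M) (A := A) (J := J) hA1
    ((Nat.le_mul_self M).trans h1) (by nlinarith) (by
      have e1 : A * (M + 4 * d + 3) ≤ A * (2 * J) := Nat.mul_le_mul_left _ hJ2
      have e2 : M * (2 * J) ≤ M * (M + 4 * d + 4) := Nat.mul_le_mul_left _ hJ1
      have e3 : (4 * d + 3) * (p ^ r) ≤ (4 * d + 3) * (d + 2 * A + 1) :=
        Nat.mul_le_mul_left _ hA2
      have e4 : (4 * d + 10) * M ≤ M * M := Nat.mul_le_mul_right _ hlarge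
      have e5 : (2 * d + 2) * (M * M) ≤ (2 * d + 2) * (p ^ r) := Nat.mul_le_mul_left _ h1
      have e6 : d * (4 * d + 10) ≤ d * M := Nat.mul_le_mul_left _ hlarge
      nlinarith)
  have f1 : 2 * ((p ^ r - 1) / 2) ≤ p ^ r := by omega
  have f2 : d * (2 * ((p ^ r - 1) / 2)) ≤ d * p ^ r := Nat.mul_le_mul_left _ f1
  have f3 : p ^ r * (2 * J) ≤ p ^ r * (M + 4 * d + 4) := Nat.mul_le_mul_left _ hJ1
  have f4 : p ^ r ≤ 2 * (M * M) := by nlinarith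
  have f5 : 5 * (d + 1) * p ^ r ≤ 5 * (d + 1) * (2 * (M * M)) := Nat.mul_le_mul_left _ f4
  have hMpos : 0 < M := by omega
  refine Nat.le_of_mul_le_mul_left ?_ hMpos
  nlinarith
end Stepanov

section Symbol
open Polynomial

lemma finite_degree_lt (n : ℕ) : {g : F[X] | g.degree < n}.Finite := by
  have h : {g : F[X] | g.degree < n} = (degreeLT F n : Set F[X]) := by
    ext g
    simp [mem_degreeLT]
  rw [h]
  have : Finite (degreeLT F n) := Finite.of_equiv _ (degreeLTEquiv F n).symm.toEquiv
  exact Set.toFinite _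

lemma finite_monic_natDegree_eq (n : ℕ) : {g : F[X] | g.Monic ∧ g.natDegree = n}.Finite := by
  refine (finite_degree_lt (F := F) (n + 1)).subset fun g hg => ?_
  refine degree_le_natDegree.trans_lt ?_
  rw [hg.2]
  exact_mod_cast Nat.lt_succ_self n

/-- The polynomials of degree less than `n`. -/
noncomputable def lowDegree (F : Type) [Field F] [Fintype F] (n : ℕ) : Finset F[X] := by
  classical exact (finite_degree_lt (F := F) n).toFinset

/-- The monic polynomials of degree `n`. -/
noncomputable def monicDegree (F : Type) [Field F] [Fintype F] (n : ℕ) : Finset F[X] := by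
  classical exact (finite_monic_natDegree_eq (F := F) n).toFinset

@[simp] lemma mem_lowDegree {n : ℕ} {g : F[X]} : g ∈ lowDegree F n ↔ g.degree < n := by
  simp [lowDegree]

@[simp] lemma mem_monicDegree {n : ℕ} {g : F[X]} :
    g ∈ monicDegree F n ↔ g.Monic ∧ g.natDegree = n := by
  simp [monicDegree]

/-- The quadratic symbol `(D / g)` of polynomials over a finite field. -/
noncomputable def symb (D g : F[X]) : ℤ := quadraticChar F (resultant g D)

/-- The quadratic symbol `(g / D)` of polynomials over a finite field. -/
noncomputable def rsymb (D g : F[X]) : ℤ := quadraticChar F (resultant D g)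

lemma symb_mul {D g h : F[X]} (hg : g ≠ 0) (hh : h ≠ 0) :
    symb D (g * h) = symb D g * symb D h := by
  rw [symb, natDegree_mul hg hh, resultant_mul_left _ _ _ _ le_rfl, map_mul]
  rfl

lemma symb_one (D : F[X]) : symb D 1 = 1 := by
  rw [symb, natDegree_one, resultant_zero_left_deg]
  simp

lemma symb_pow {D g : F[X]} (hg : g ≠ 0) (n : ℕ) : symb D (g ^ n) = symb D g ^ n := by
  induction n with
  | zero => simp [symb_one]
  | succ n ih => rw [pow_succ, symb_mul (pow_ne_zero _ hg) hg, ih, pow_succ]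

lemma symb_X_sub_C (D : F[X]) (a : F) : symb D (X - C a) = quadraticChar F (D.eval a) := by
  rw [symb, natDegree_X_sub_C, resultant_X_sub_C_left _ _ _ le_rfl]

lemma symb_eq_rsymb (D g : F[X]) :
    symb D g = quadraticChar F ((-1) ^ (g.natDegree * D.natDegree)) * rsymb D g := by
  rw [symb, resultant_comm, map_mul]
  rfl

lemma rsymb_eq_of_natDegree_le {D g : F[X]} (hD : D.Monic) {n : ℕ} (hg : g.natDegree ≤ n) :
    rsymb D g = quadraticChar F (resultant D g D.natDegree n) := by
  obtain ⟨k, rfl⟩ := Nat.exists_eq_add_of_le hg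
  rw [resultant_add_right_deg _ _ _ _ k le_rfl, hD.coeff_natDegree, one_pow, one_mul]
  rfl

lemma rsymb_add_mul {D : F[X]} (hD : D.Monic) (r h : F[X]) :
    rsymb D (r + D * h) = rsymb D r := by
  set n := max r.natDegree (h.natDegree + D.natDegree) with hn
  have h1 : r.natDegree ≤ n := le_max_left _ _
  have h2 : h.natDegree + D.natDegree ≤ n := le_max_right _ _
  have h3 : (D * h).natDegree ≤ n := natDegree_mul_le.trans (by omega)
  rw [rsymb_eq_of_natDegree_le hD h1,
    rsymb_eq_of_natDegree_le hD ((natDegree_add_le _ _).trans (max_le h1 h3)),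
    resultant_add_mul_right _ _ _ _ _ h2 le_rfl]

lemma rsymb_mul {D : F[X]} (hD : D.Monic) (r s : F[X]) :
    rsymb D (r * s) = rsymb D r * rsymb D s := by
  rw [rsymb_eq_of_natDegree_le hD natDegree_mul_le, resultant_mul_right _ _ _ _ le_rfl, map_mul]
  rfl

lemma rsymb_zero {D : F[X]} (hD : D.natDegree ≠ 0) : rsymb D 0 = 0 := by
  simp [rsymb, hD]

lemma rsymb_C_mul {D : F[X]} (hD : D.Monic) (hev : Even D.natDegree) {c : F} (hc : c ≠ 0)
    (g : F[X]) : rsymb D (C c * g) = rsymb D g := by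
  rw [rsymb_mul hD]
  have : rsymb D (C c) = 1 := by
    rw [rsymb, natDegree_C, resultant_C_zero_right]
    obtain ⟨m, hm⟩ := hev
    rw [hm, ← two_mul, mul_comm, pow_mul, quadraticChar_sq_one' (pow_ne_zero _ hc)]
  rw [this, one_mul]

lemma sum_lowDegree_rsymb {D P : F[X]} (hD : D.Monic) (hcop : IsCoprime D P)
    (hP : rsymb D P = -1) : ∑ r ∈ lowDegree F D.natDegree, rsymb D r = 0 := by
  have hmaps : ∀ r ∈ lowDegree F D.natDegree, (P * r) %ₘ D ∈ lowDegree F D.natDegree := by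
    intro r _
    rw [mem_lowDegree, ← degree_eq_natDegree hD.ne_zero]
    exact degree_modByMonic_lt _ hD
  have hinj : Set.InjOn (fun r => (P * r) %ₘ D) (lowDegree F D.natDegree : Set F[X]) := by
    intro r hr s hs hrs
    have hdvd : D ∣ P * (r - s) := by
      rw [← modByMonic_eq_zero_iff_dvd hD, mul_sub, sub_modByMonic]
      exact sub_eq_zero.2 hrs
    have h2 := hcop.dvd_of_dvd_mul_left hdvd
    refine sub_eq_zero.1 (eq_zero_of_dvd_of_degree_lt h2 ?_)
    rw [Finset.mem_coe, mem_lowDegree, ← degree_eq_natDegree hD.ne_zero] at hr hs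
    exact (degree_sub_le _ _).trans_lt (max_lt hr hs)
  have h := Finset.sum_nbij (s := lowDegree F D.natDegree) (t := lowDegree F D.natDegree)
    (f := fun r => rsymb D ((P * r) %ₘ D)) (g := fun r => rsymb D r) _ hmaps hinj
    (Finset.surjOn_of_injOn_of_card_le _ hmaps hinj le_rfl) (fun _ _ => rfl)
  have h2 : ∀ r, rsymb D ((P * r) %ₘ D) = - rsymb D r := by
    intro r
    have h3 := rsymb_add_mul hD ((P * r) %ₘ D) ((P * r) /ₘ D)
    rw [modByMonic_add_div, rsymb_mul hD, hP] at h3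
    linarith
  simp only [h2, Finset.sum_neg_distrib] at h
  linarith

lemma sum_monicDegree_rsymb {D : F[X]} (hD : D.Monic)
    (h0 : ∑ r ∈ lowDegree F D.natDegree, rsymb D r = 0) {n : ℕ} (hn : D.natDegree ≤ n) :
    ∑ g ∈ monicDegree F n, rsymb D g = 0 := by
  have h : ∑ g ∈ monicDegree F n, rsymb D g =
      ∑ x ∈ monicDegree F (n - D.natDegree) ×ˢ lowDegree F D.natDegree, rsymb D x.2 := by
    refine Finset.sum_nbij' (fun g => (g /ₘ D, g %ₘ D)) (fun x => x.2 + D * x.1) ?_ ?_ ?_ ?_ ?_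
    · intro g hg
      obtain ⟨hg, hgn⟩ := mem_monicDegree.1 hg
      have hle : D.degree ≤ g.degree := by
        rw [degree_eq_natDegree hD.ne_zero, degree_eq_natDegree hg.ne_zero, hgn]
        exact_mod_cast hn
      rw [Finset.mem_product, mem_monicDegree, mem_lowDegree, ← degree_eq_natDegree hD.ne_zero]
      refine ⟨⟨?_, ?_⟩, degree_modByMonic_lt _ hD⟩
      · rw [Monic, leadingCoeff_divByMonic_of_monic hD hle]
        exact hg
      · rw [natDegree_divByMonic _ hD, hgn]
    · rintro ⟨h, r⟩ hx
      rw [Finset.mem_product, mem_monicDegree, mem_lowDegree, ← degree_eq_natDegree hD.ne_zero]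
        at hx
      obtain ⟨⟨hh, hhn⟩, hr⟩ := hx
      dsimp only at hh hhn hr ⊢
      have hlt : r.degree < (D * h).degree := by
        refine hr.trans_le ?_
        rw [degree_mul]
        have : 0 ≤ h.degree := zero_le_degree_iff.2 hh.ne_zero
        exact le_add_of_nonneg_right this
      rw [mem_monicDegree, add_comm]
      refine ⟨(hD.mul hh).add_of_left hlt, ?_⟩
      rw [natDegree_add_eq_left_of_degree_lt hlt, hD.natDegree_mul hh, hhn]
      omega
    · intro g _
      exact modByMonic_add_div _ _
    · rintro ⟨h, r⟩ hx
      rw [Finset.mem_product, mem_monicDegree, mem_lowDegree, ← degree_eq_natDegree hD.ne_zero]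
        at hx
      obtain ⟨h1, h2⟩ := div_modByMonic_unique (f := r + D * h) h r hD ⟨rfl, hx.2⟩
      exact Prod.ext h1 h2
    · intro g _
      conv_lhs => rw [← modByMonic_add_div g D]
      exact rsymb_add_mul hD _ _
  rw [h, Finset.sum_product]
  simp [h0]

lemma sum_range_sum_monicDegree_rsymb {D : F[X]} (hD : D.Monic) (hev : Even D.natDegree)
    (hpos : D.natDegree ≠ 0) (h0 : ∑ r ∈ lowDegree F D.natDegree, rsymb D r = 0) :
    ∑ n ∈ Finset.range D.natDegree, ∑ g ∈ monicDegree F n, rsymb D g = 0 := by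
  classical
  have h : ∑ x ∈ (Finset.univ : Finset Fˣ) ×ˢ
      ((Finset.range D.natDegree).sigma fun n => monicDegree F n), rsymb D x.2.2 =
      ∑ r ∈ (lowDegree F D.natDegree).erase 0, rsymb D r := by
    refine Finset.sum_bij (fun x _ => C (x.1 : F) * x.2.2) ?_ ?_ ?_ ?_
    · rintro ⟨c, n, g⟩ hx
      simp only [Finset.mem_product, Finset.mem_univ, true_and, Finset.mem_sigma, Finset.mem_range,
        mem_monicDegree] at hx
      obtain ⟨hn, hg, rfl⟩ := hx
      have hne : C (c : F) * g ≠ 0 := mul_ne_zero (C_ne_zero.2 c.ne_zero) hg.ne_zero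
      rw [Finset.mem_erase, mem_lowDegree]
      refine ⟨hne, ?_⟩
      rw [degree_eq_natDegree hne, natDegree_C_mul c.ne_zero]
      exact_mod_cast hn
    · rintro ⟨c, n, g⟩ hx ⟨c', n', g'⟩ hx' heq
      simp only [Finset.mem_product, Finset.mem_univ, true_and, Finset.mem_sigma, Finset.mem_range,
        mem_monicDegree] at hx hx' heq
      obtain ⟨hn, hg, rfl⟩ := hx
      obtain ⟨hn', hg', rfl⟩ := hx'
      have hc := congrArg leadingCoeff heq
      rw [leadingCoeff_mul, leadingCoeff_mul, leadingCoeff_C, leadingCoeff_C, hg.leadingCoeff,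
        hg'.leadingCoeff, mul_one, mul_one] at hc
      have hc' : c = c' := Units.ext hc
      subst hc'
      have hgg : g = g' := mul_left_cancel₀ (C_ne_zero.2 c.ne_zero) heq
      subst hgg
      rfl
    · intro r hr
      rw [Finset.mem_erase, mem_lowDegree] at hr
      have hlc : r.leadingCoeff ≠ 0 := leadingCoeff_ne_zero.2 hr.1
      refine ⟨⟨Units.mk0 r.leadingCoeff hlc, r.natDegree, C r.leadingCoeff⁻¹ * r⟩, ?_, ?_⟩
      · simp only [Finset.mem_product, Finset.mem_univ, true_and, Finset.mem_sigma,
          Finset.mem_range, mem_monicDegree]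
        refine ⟨?_, monic_C_mul_of_mul_leadingCoeff_eq_one (inv_mul_cancel₀ hlc),
          natDegree_C_mul (inv_ne_zero hlc)⟩
        rw [degree_eq_natDegree hr.1] at hr
        exact_mod_cast hr.2
      · rw [← mul_assoc, Units.val_mk0, ← C_mul, mul_inv_cancel₀ hlc, C_1, one_mul]
    · rintro ⟨c, n, g⟩ _
      exact (rsymb_C_mul hD hev c.ne_zero g).symm
  rw [Finset.sum_erase _ (rsymb_zero hpos), h0, Finset.sum_product] at h
  simp only [Finset.sum_sigma, Finset.sum_const, nsmul_eq_mul] at h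
  have hcard : ((Finset.univ : Finset Fˣ).card : ℤ) ≠ 0 := by
    exact_mod_cast Finset.card_ne_zero_of_mem (Finset.mem_univ 1)
  exact (mul_eq_zero.1 h).resolve_left hcard
end Symbol

section Frobenius
open Polynomial
variable {K : Type} [Field K] [Algebra F K]

lemma aeval_pow_card_pow (g : F[X]) (γ : K) (i : ℕ) :
    aeval (γ ^ Fintype.card F ^ i) g = aeval γ g ^ Fintype.card F ^ i := by
  induction i with
  | zero => simp
  | succ i ih =>
    rw [pow_succ, pow_mul, pow_mul, ← ih]
    exact aeval_algHom_apply (FiniteField.frobeniusAlgHom F K) _ g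

variable [Algebra.IsAlgebraic F K]

lemma pow_card_pow_eq_self_iff (γ : K) (k : ℕ) :
    γ ^ Fintype.card F ^ k = γ ↔ (minpoly F γ).natDegree ∣ k := by
  have hγint : IsIntegral F γ := Algebra.IsIntegral.isIntegral γ
  rw [(minpoly.irreducible hγint).natDegree_dvd_iff_dvd_X_pow_card_pow_sub_X,
    minpoly.dvd_iff, Nat.card_eq_fintype_card]
  simp [sub_eq_zero]

lemma natDegree_minpoly_pos (γ : K) : 0 < (minpoly F γ).natDegree :=
  minpoly.natDegree_pos (Algebra.IsIntegral.isIntegral γ)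

lemma roots_map_minpoly (γ : K) :
    ((minpoly F γ).map (algebraMap F K)).roots =
      (Multiset.range (minpoly F γ).natDegree).map fun i => γ ^ Fintype.card F ^ i := by
  have hγint : IsIntegral F γ := Algebra.IsIntegral.isIntegral γ
  have hne : (minpoly F γ).map (algebraMap F K) ≠ 0 := ((minpoly.monic hγint).map _).ne_zero
  symm
  refine Multiset.eq_of_le_of_card_le ?_ ?_
  · rw [Multiset.le_iff_subset]
    · intro x hx
      obtain ⟨i, -, rfl⟩ := Multiset.mem_map.1 hx
      rw [mem_roots hne, IsRoot.def, eval_map_algebraMap, aeval_pow_card_pow, minpoly.aeval,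
        zero_pow (pow_ne_zero _ Fintype.card_ne_zero)]
    · refine Multiset.Nodup.map_on ?_ (Multiset.nodup_range _)
      have key : ∀ i j, i < j → j < (minpoly F γ).natDegree →
          γ ^ Fintype.card F ^ i ≠ γ ^ Fintype.card F ^ j := by
        intro i j hij hj h
        have h1 : (γ ^ Fintype.card F ^ (j - i)) ^ Fintype.card F ^ i =
            γ ^ Fintype.card F ^ i := by
          rw [← pow_mul, ← pow_add, Nat.sub_add_cancel hij.le, h]
        have h2 : (FiniteField.frobeniusAlgHom F K ^ i) (γ ^ Fintype.card F ^ (j - i)) =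
            (FiniteField.frobeniusAlgHom F K ^ i) γ := by
          have : ∀ x : K, (FiniteField.frobeniusAlgHom F K ^ i) x = x ^ Fintype.card F ^ i := by
            intro x
            rw [AlgHom.coe_pow, FiniteField.coe_frobeniusAlgHom, pow_iterate]
          rw [this, this, h1]
        have h3 := (pow_card_pow_eq_self_iff γ (j - i)).1
          ((FiniteField.frobeniusAlgHom F K ^ i).injective h2)
        have := Nat.le_of_dvd (by omega) h3
        omega
      intro i hi j hj h
      rw [Multiset.mem_range] at hi hj
      rcases lt_trichotomy i j with hlt | heq | hlt
      · exact absurd h (key i j hlt hj)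
      · exact heq
      · exact absurd h.symm (key j i hlt hi)
  · rw [Multiset.card_map, Multiset.card_range]
    exact (card_roots' _).trans natDegree_map_le

lemma two_mul_half_mul_geom {q : ℕ} (hq : Odd q) (e : ℕ) :
    (q / 2) * ∑ i ∈ Finset.range e, q ^ i = (q ^ e - 1) / 2 := by
  obtain ⟨t, ht⟩ := hq
  have h1 : q / 2 = t := by omega
  have h2 : 1 ≤ q ^ e := Nat.one_le_pow _ _ (by omega)
  have h3 := geom_sum_mul_of_one_le (x := q) (by omega) e
  rw [h1]
  have h4 : q - 1 = 2 * t := by omega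
  rw [h4] at h3
  generalize ∑ i ∈ Finset.range e, q ^ i = s at *
  have : s * (2 * t) = 2 * (t * s) := by ring
  omega

variable [IsAlgClosed K]

lemma algebraMap_symb_minpoly (hodd : Odd (Fintype.card F)) (D : F[X]) (γ : K) :
    ((symb D (minpoly F γ) : ℤ) : K) =
      aeval γ D ^ ((Fintype.card F ^ (minpoly F γ).natDegree - 1) / 2) := by
  have hγint : IsIntegral F γ := Algebra.IsIntegral.isIntegral γ
  have hchar : ringChar F ≠ 2 := by
    intro h
    have := FiniteField.even_card_iff_char_two.1 h
    rw [Nat.odd_iff] at hodd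
    omega
  have h1 := quadraticChar_eq_pow_of_char_ne_two' hchar (resultant (minpoly F γ) D)
  have h2 := congrArg (algebraMap F K) h1
  rw [map_intCast, map_pow, ← resultant_map_map] at h2
  rw [symb, h2]
  have hmon := minpoly.monic hγint
  have h3 := resultant_eq_prod_eval ((minpoly F γ).map (algebraMap F K)) (D.map (algebraMap F K))
    D.natDegree natDegree_map_le (IsAlgClosed.splits _)
  rw [(hmon.map _).leadingCoeff, one_pow, one_mul, hmon.natDegree_map, roots_map_minpoly,
    Multiset.map_map] at h3
  rw [h3]
  have h4 : (Multiset.map ((eval · (D.map (algebraMap F K))) ∘ fun i => γ ^ Fintype.card F ^ i)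
      (Multiset.range (minpoly F γ).natDegree)).prod =
      ∏ i ∈ Finset.range (minpoly F γ).natDegree, aeval γ D ^ Fintype.card F ^ i := by
    rw [Finset.prod_eq_multiset_prod, Finset.range_val]
    refine congrArg _ (Multiset.map_congr rfl fun i _ => ?_)
    simp only [Function.comp_apply, eval_map_algebraMap]
    exact aeval_pow_card_pow D γ i
  rw [h4, Finset.prod_pow_eq_pow_sum, ← pow_mul, mul_comm, two_mul_half_mul_geom hodd]

lemma algebraMap_symb_minpoly_pow (hodd : Odd (Fintype.card F)) (D : F[X]) (γ : K) (j : ℕ) :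
    ((symb D (minpoly F γ) ^ j : ℤ) : K) =
      aeval γ D ^ ((Fintype.card F ^ ((minpoly F γ).natDegree * j) - 1) / 2) := by
  induction j with
  | zero => simp
  | succ j ih =>
    set e := (minpoly F γ).natDegree
    set q := Fintype.card F
    have h1 : (q ^ (e * (j + 1)) - 1) / 2 =
        (q ^ (e * j) - 1) / 2 + ((q ^ e - 1) / 2) * q ^ (e * j) := by
      rw [Nat.mul_succ, pow_add]
      obtain ⟨a, ha⟩ := hodd.pow (n := e * j)
      obtain ⟨b, hb⟩ := hodd.pow (n := e)
      rw [ha, hb]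
      have h5 : (2 * a + 1) * (2 * b + 1) = 2 * (a + b * (2 * a + 1)) + 1 := by ring
      rw [h5]
      have h6 : ∀ x, (2 * x + 1 - 1) / 2 = x := fun x => by omega
      rw [h6, h6, h6]
    rw [h1, pow_add (aeval γ D), pow_mul (aeval γ D), ← ih,
      ← algebraMap_symb_minpoly hodd, pow_succ]
    push_cast
    congr 1
    have h2 : symb D (minpoly F γ) ^ (q ^ (e * j)) = symb D (minpoly F γ) := by
      have ho : Odd (q ^ (e * j)) := hodd.pow
      rcases eq_or_ne (resultant (minpoly F γ) D) 0 with h0 | h0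
      · rw [symb, h0, quadraticChar_zero, zero_pow]
        exact pow_ne_zero _ Fintype.card_ne_zero
      · rcases quadraticChar_dichotomy h0 with h | h
        · rw [symb, h, one_pow]
        · rw [symb, h, ho.neg_one_pow]
    exact_mod_cast congrArg (Int.cast (R := K)) h2.symm

/-- The elements of `K` fixed by the `k`-th power of the Frobenius. -/
noncomputable def fixedPts (F K : Type) [Field F] [Fintype F] [Field K] (k : ℕ) : Finset K := by
  classical exact (X ^ Fintype.card F ^ k - X : K[X]).roots.toFinset

lemma X_pow_card_pow_sub_X_ne_zero {k : ℕ} (hk : k ≠ 0) :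
    (X ^ Fintype.card F ^ k - X : K[X]) ≠ 0 :=
  FiniteField.X_pow_card_sub_X_ne_zero K (Nat.one_lt_pow hk Fintype.one_lt_card)

lemma mem_fixedPts {k : ℕ} (hk : k ≠ 0) {γ : K} :
    γ ∈ fixedPts F K k ↔ γ ^ Fintype.card F ^ k = γ := by
  simp [fixedPts, X_pow_card_pow_sub_X_ne_zero (F := F) (K := K) hk, sub_eq_zero]

lemma card_fixedPts {k : ℕ} (hk : k ≠ 0) : (fixedPts F K k).card = Fintype.card F ^ k := by
  obtain ⟨p, hp⟩ := CharP.exists F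
  obtain ⟨n, hpp, hn⟩ := FiniteField.card F p
  have : CharP K p := charP_of_injective_algebraMap (algebraMap F K).injective p
  have hsep : (X ^ Fintype.card F ^ k - X : K[X]).Separable := by
    refine galois_poly_separable p _ ?_
    rw [hn, ← pow_mul]
    exact dvd_pow_self _ (mul_ne_zero n.ne_zero hk)
  classical
  have h1 : (fixedPts F K k) = (X ^ Fintype.card F ^ k - X : K[X]).roots.toFinset := by
    simp [fixedPts]
  rw [h1, Multiset.toFinset_card_of_nodup (nodup_roots hsep), 
    ← (IsAlgClosed.splits (X ^ Fintype.card F ^ k - X : K[X])).natDegree_eq_card_roots,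
    FiniteField.X_pow_card_sub_X_natDegree_eq _ (Nat.one_lt_pow hk Fintype.one_lt_card)]
end Frobenius

section Euler
open Polynomial
variable {K : Type} [Field K] [Algebra F K] [Algebra.IsAlgebraic F K] [IsAlgClosed K]

lemma minpoly_pow_dvd_iff {g : F[X]} (hg : g ≠ 0) (γ : K) (j : ℕ) :
    minpoly F γ ^ j ∣ g ↔ j ≤ (g.map (algebraMap F K)).rootMultiplicity γ := by
  have hγint : IsIntegral F γ := Algebra.IsIntegral.isIntegral γ
  have hmap : ∀ {h : F[X]}, h ≠ 0 → h.map (algebraMap F K) ≠ 0 := fun h0 =>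
    (Polynomial.map_ne_zero_iff (algebraMap F K).injective).2 h0
  have hroot : (X - C γ) ∣ (minpoly F γ).map (algebraMap F K) := by
    rw [dvd_iff_isRoot, IsRoot.def, eval_map_algebraMap, minpoly.aeval]
  constructor
  · intro h
    rw [le_rootMultiplicity_iff (hmap hg)]
    refine (pow_dvd_pow_of_dvd hroot j).trans ?_
    rw [← Polynomial.map_pow]
    exact Polynomial.map_dvd (algebraMap F K) h
  · induction j generalizing g with
    | zero => simp
    | succ j ih =>
      intro h
      obtain ⟨k, rfl⟩ := ih hg (Nat.le_of_succ_le h)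
      have hk : k ≠ 0 := right_ne_zero_of_mul hg
      have hone : ((minpoly F γ).map (algebraMap F K)).rootMultiplicity γ ≤ 1 :=
        rootMultiplicity_le_one_of_separable
          ((PerfectField.separable_of_irreducible (minpoly.irreducible hγint)).map) γ
      rw [Polynomial.map_mul, rootMultiplicity_mul (by
        rw [← Polynomial.map_mul]; exact hmap hg), Polynomial.map_pow] at h
      have hpow : ∀ i, rootMultiplicity γ ((minpoly F γ).map (algebraMap F K) ^ i) ≤ i := by
        intro i
        classical
        rw [← count_roots, roots_pow, Multiset.count_nsmul, count_roots]
        exact (Nat.mul_le_mul_left i hone).trans (by simp)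
      have h1 : 0 < rootMultiplicity γ (k.map (algebraMap F K)) := by
        have := hpow j
        omega
      rw [rootMultiplicity_pos (hmap hk), IsRoot.def, eval_map_algebraMap] at h1
      rw [pow_succ]
      exact mul_dvd_mul_left _ (minpoly.dvd F γ h1)

open scoped Classical in
lemma card_filter_minpoly_pow_dvd {g : F[X]} (hg : g ≠ 0) (γ : K) :
    ((Finset.Icc 1 g.natDegree).filter fun k => γ ∈ fixedPts F K k ∧
      minpoly F γ ^ (k / (minpoly F γ).natDegree) ∣ g).card =
        (g.map (algebraMap F K)).rootMultiplicity γ := by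
  set m := (g.map (algebraMap F K)).rootMultiplicity γ with hm
  set e := (minpoly F γ).natDegree with he
  have hepos : 0 < e := natDegree_minpoly_pos γ
  have hem : m * e ≤ g.natDegree := by
    have h := natDegree_le_of_dvd ((minpoly_pow_dvd_iff hg γ m).2 le_rfl) hg
    rwa [natDegree_pow] at h
  have : ((Finset.Icc 1 g.natDegree).filter fun k => γ ∈ fixedPts F K k ∧
      minpoly F γ ^ (k / e) ∣ g) = (Finset.Icc 1 m).image fun j => e * j := by
    ext k
    simp only [Finset.mem_filter, Finset.mem_Icc, Finset.mem_image]
    constructor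
    · rintro ⟨⟨hk1, hkn⟩, hk, hdvd⟩
      rw [mem_fixedPts (by omega), pow_card_pow_eq_self_iff] at hk
      obtain ⟨j, rfl⟩ := hk
      rw [Nat.mul_div_cancel_left _ hepos, minpoly_pow_dvd_iff hg] at hdvd
      exact ⟨j, ⟨Nat.pos_of_ne_zero (by rintro rfl; simp at hk1), hdvd⟩, rfl⟩
    · rintro ⟨j, ⟨hj1, hjm⟩, rfl⟩
      have h1 : 0 < e * j := Nat.mul_pos hepos hj1
      refine ⟨⟨h1, ?_⟩, ?_, ?_⟩
      · calc e * j ≤ e * m := Nat.mul_le_mul_left _ hjm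
          _ ≤ _ := by rwa [mul_comm]
      · rw [mem_fixedPts h1.ne', pow_card_pow_eq_self_iff]
        exact dvd_mul_right _ _
      · rw [Nat.mul_div_cancel_left _ hepos, minpoly_pow_dvd_iff hg]
        exact hjm
  rw [this, Finset.card_image_of_injective _ fun a b h => Nat.eq_of_mul_eq_mul_left hepos h]
  simp

open scoped Classical in
lemma sum_card_filter_minpoly_pow_dvd (K : Type) [Field K] [Algebra F K]
    [Algebra.IsAlgebraic F K] [IsAlgClosed K] {g : F[X]} (hg : g ≠ 0) :
    ∑ k ∈ Finset.Icc 1 g.natDegree, ((fixedPts F K k).filter fun γ =>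
      minpoly F γ ^ (k / (minpoly F γ).natDegree) ∣ g).card = g.natDegree := by
  classical
  have hg' : g.map (algebraMap F K) ≠ 0 :=
    (Polynomial.map_ne_zero_iff (algebraMap F K).injective).2 hg
  have h1 : ∀ k ∈ Finset.Icc 1 g.natDegree, ((fixedPts F K k).filter fun γ =>
      minpoly F γ ^ (k / (minpoly F γ).natDegree) ∣ g).card =
      (((g.map (algebraMap F K)).roots.toFinset).filter fun γ => γ ∈ fixedPts F K k ∧
        minpoly F γ ^ (k / (minpoly F γ).natDegree) ∣ g).card := by
    intro k hk
    rw [Finset.mem_Icc] at hk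
    congr 1
    ext γ
    simp only [Finset.mem_filter, Multiset.mem_toFinset]
    refine ⟨fun h => ⟨?_, h⟩, fun h => h.2⟩
    have h2 := h.1
    rw [mem_fixedPts (by omega), pow_card_pow_eq_self_iff] at h2
    have h3 : 0 < k / (minpoly F γ).natDegree :=
      Nat.div_pos (Nat.le_of_dvd (by omega) h2) (natDegree_minpoly_pos γ)
    have h4 := h3.trans_le ((minpoly_pow_dvd_iff hg γ _).1 h.2)
    rw [rootMultiplicity_pos hg'] at h4
    rwa [mem_roots hg']
  rw [Finset.sum_congr rfl h1]
  have h5 := Finset.sum_card_bipartiteAbove_eq_sum_card_bipartiteBelow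
    (s := Finset.Icc 1 g.natDegree) (t := (g.map (algebraMap F K)).roots.toFinset)
    (fun k γ => γ ∈ fixedPts F K k ∧ minpoly F γ ^ (k / (minpoly F γ).natDegree) ∣ g)
  simp only [Finset.bipartiteAbove, Finset.bipartiteBelow] at h5
  rw [h5, Finset.sum_congr rfl fun γ _ => card_filter_minpoly_pow_dvd hg γ]
  simp only [← count_roots]
  rw [Multiset.toFinset_sum_count_eq, ← (IsAlgClosed.splits _).natDegree_eq_card_roots,
    natDegree_map]

/-- The coefficients of the `L`-polynomial. -/
noncomputable def lcoef (D : F[X]) (n : ℕ) : ℤ := ∑ g ∈ monicDegree F n, symb D g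

/-- The character sum over the extension of degree `k`. -/
noncomputable def extSum (K : Type) [Field K] [Algebra F K] (D : F[X]) (k : ℕ) : ℤ :=
  ∑ γ ∈ fixedPts F K k, symb D (minpoly F γ) ^ (k / (minpoly F γ).natDegree)

theorem natCast_mul_lcoef (K : Type) [Field K] [Algebra F K]
    [Algebra.IsAlgebraic F K] [IsAlgClosed K] (D : F[X]) (n : ℕ) :
    (n : ℤ) * lcoef D n = ∑ k ∈ Finset.Icc 1 n, extSum K D k * lcoef D (n - k) := by
  classical
  have h1 : (n : ℤ) * lcoef D n = ∑ g ∈ monicDegree F n, ∑ k ∈ Finset.Icc 1 n,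
      ∑ γ ∈ fixedPts F K k,
        if minpoly F γ ^ (k / (minpoly F γ).natDegree) ∣ g then symb D g else 0 := by
    rw [lcoef, Finset.mul_sum]
    refine Finset.sum_congr rfl fun g hg => ?_
    obtain ⟨hmon, rfl⟩ := mem_monicDegree.1 hg
    conv_lhs => rw [← sum_card_filter_minpoly_pow_dvd K hmon.ne_zero]
    push_cast
    rw [Finset.sum_mul]
    refine Finset.sum_congr rfl fun k _ => ?_
    rw [← Finset.sum_filter, Finset.sum_const, nsmul_eq_mul]
  rw [h1, Finset.sum_comm]
  refine Finset.sum_congr rfl fun k hk => ?_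
  rw [Finset.mem_Icc] at hk
  rw [Finset.sum_comm, extSum, Finset.sum_mul]
  refine Finset.sum_congr rfl fun γ hγ => ?_
  rw [mem_fixedPts (by omega), pow_card_pow_eq_self_iff] at hγ
  have hγint : IsIntegral F γ := Algebra.IsIntegral.isIntegral γ
  have hmon := minpoly.monic hγint
  obtain ⟨j, hj⟩ := hγ
  have hkj : k / (minpoly F γ).natDegree = j := by
    rw [hj, Nat.mul_div_cancel_left _ (natDegree_minpoly_pos γ)]
  rw [hkj]
  set P := minpoly F γ ^ j with hP
  have hPmon : P.Monic := hmon.pow j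
  have hPdeg : P.natDegree = k := by rw [hP, hmon.natDegree_pow, hj, mul_comm]
  rw [← Finset.sum_filter, lcoef, Finset.mul_sum]
  symm
  refine Finset.sum_nbij (fun h => P * h) ?_ ?_ ?_ ?_
  · intro h hh
    obtain ⟨hh, hhn⟩ := mem_monicDegree.1 hh
    rw [Finset.mem_filter, mem_monicDegree]
    refine ⟨⟨hPmon.mul hh, ?_⟩, dvd_mul_right _ _⟩
    rw [hPmon.natDegree_mul hh, hPdeg, hhn]
    omega
  · intro a _ b _ hab
    exact mul_left_cancel₀ hPmon.ne_zero hab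
  · intro g hg
    rw [Finset.mem_coe, Finset.mem_filter, mem_monicDegree] at hg
    obtain ⟨⟨hg, hgn⟩, h, rfl⟩ := hg
    have hh : h.Monic := hPmon.of_mul_monic_left hg
    refine ⟨h, ?_, rfl⟩
    rw [Finset.mem_coe, mem_monicDegree]
    refine ⟨hh, ?_⟩
    rw [hPmon.natDegree_mul hh] at hgn
    omega
  · intro h hh
    rw [symb_mul hPmon.ne_zero (mem_monicDegree.1 hh).1.ne_zero, hP, symb_pow hmon.ne_zero]

lemma lcoef_zero (D : F[X]) : lcoef D 0 = 1 := by
  have : monicDegree F 0 = {1} := by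
    ext g
    simp only [mem_monicDegree, Finset.mem_singleton]
    constructor
    · rintro ⟨h1, h2⟩
      exact h1.natDegree_eq_zero.1 h2
    · rintro rfl
      simp
  rw [lcoef, this, Finset.sum_singleton, symb_one]

lemma lcoef_one (D : F[X]) : lcoef D 1 = ∑ a : F, quadraticChar F (D.eval a) := by
  symm
  refine Finset.sum_nbij (fun a => X - C a) ?_ ?_ ?_ ?_
  · intro a _
    simp [monic_X_sub_C]
  · intro a _ b _ h
    simpa using h
  · intro g hg
    rw [Finset.mem_coe, mem_monicDegree] at hg
    refine ⟨-g.coeff 0, by simp, ?_⟩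
    have := hg.1.eq_X_add_C hg.2
    simp only [map_neg, sub_neg_eq_add]
    exact this.symm
  · intro a _
    rw [symb_X_sub_C]
end Euler

section Stepanov
open Polynomial
variable {K : Type} [Field K] [Algebra F K] [Algebra.IsAlgebraic F K] [IsAlgClosed K]

lemma expand_card_pow (D : F[X]) (k : ℕ) :
    expand F (Fintype.card F ^ k) D = D ^ Fintype.card F ^ k := by
  induction k with
  | zero => simp
  | succ k ih => rw [pow_succ, mul_comm, expand_mul, ih, map_pow, FiniteField.expand_card,
      ← pow_mul]

lemma two_mul_card_filter_le (hodd : Odd (Fintype.card F)) {D : F[X]} {β : K}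
    (hβ : Odd ((D.map (algebraMap F K)).rootMultiplicity β)) {k : ℕ} (hk : k ≠ 0)
    (hlarge : 4 * D.natDegree + 10 ≤ Nat.sqrt (Fintype.card F ^ k)) {ε : ℤ}
    (hε : ε = 1 ∨ ε = -1) :
    2 * ((fixedPts F K k).filter fun γ =>
      symb D (minpoly F γ) ^ (k / (minpoly F γ).natDegree) = ε).card ≤
      Fintype.card F ^ k + 10 * (D.natDegree + 1) * Nat.sqrt (Fintype.card F ^ k) := by
  obtain ⟨p, hp⟩ := CharP.exists F
  obtain ⟨n, hpp, hn⟩ := FiniteField.card F p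
  have : Fact p.Prime := ⟨hpp⟩
  have : CharP K p := charP_of_injective_algebraMap (algebraMap F K).injective p
  have hQ : Fintype.card F ^ k = p ^ ((n : ℕ) * k) := by rw [hn, pow_mul]
  have hinf : Infinite K := IsAlgClosed.instInfinite
  have hε' : (ε : K) ≠ 0 := by
    rcases hε with rfl | rfl <;> simp
  have hD : (D.map (algebraMap F K)) ^ (p ^ ((n : ℕ) * k)) =
      expand K (p ^ ((n : ℕ) * k)) (D.map (algebraMap F K)) := by
    rw [← map_expand, ← hQ, expand_card_pow, Polynomial.map_pow]
  have hnd : (D.map (algebraMap F K)).natDegree = D.natDegree := natDegree_map _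
  have key := two_mul_card_le_of_eval_pow_eq p ((n : ℕ) * k) (hQ ▸ hodd.pow) hD hβ hε'
    (Z := (fixedPts F K k).filter fun γ =>
      symb D (minpoly F γ) ^ (k / (minpoly F γ).natDegree) = ε) (by
      intro γ hγ
      obtain ⟨h1, h2⟩ := Finset.mem_filter.1 hγ
      rw [mem_fixedPts hk] at h1
      refine ⟨hQ ▸ h1, ?_⟩
      have hdvd := (pow_card_pow_eq_self_iff γ k).1 h1
      have h3 := algebraMap_symb_minpoly_pow hodd D γ (k / (minpoly F γ).natDegree)
      rw [Nat.mul_div_cancel' hdvd, h2, hQ] at h3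
      rw [eval_map_algebraMap]
      exact h3.symm)
    (by rw [hnd, ← hQ]; exact hlarge)
  rw [hnd, ← hQ] at key
  exact key

lemma symb_trichotomy (D g : F[X]) : symb D g = 0 ∨ symb D g = 1 ∨ symb D g = -1 := by
  rcases eq_or_ne (resultant g D) 0 with h | h
  · left
    rw [symb, h, quadraticChar_zero]
  · right
    exact quadraticChar_dichotomy h

lemma symb_pow_trichotomy (D g : F[X]) (j : ℕ) :
    symb D g ^ j = 0 ∨ symb D g ^ j = 1 ∨ symb D g ^ j = -1 := by
  rcases symb_trichotomy D g with h | h | h <;> rw [h]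
  · rcases Nat.eq_zero_or_pos j with rfl | hj
    · simp
    · simp [hj.ne']
  · simp
  · rcases neg_one_pow_eq_or ℤ j with h | h <;> simp [h]

lemma card_filter_symb_pow_eq_zero_le (hodd : Odd (Fintype.card F)) {D : F[X]} (hD0 : D ≠ 0)
    (k : ℕ) :
    ((fixedPts F K k).filter fun γ =>
      symb D (minpoly F γ) ^ (k / (minpoly F γ).natDegree) = 0).card ≤ D.natDegree := by
  classical
  have hD0' : D.map (algebraMap F K) ≠ 0 :=
    (Polynomial.map_ne_zero_iff (algebraMap F K).injective).2 hD0
  have hsub : ((fixedPts F K k).filter fun γ =>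
      symb D (minpoly F γ) ^ (k / (minpoly F γ).natDegree) = 0) ⊆
      (D.map (algebraMap F K)).roots.toFinset := by
    intro γ hγ
    obtain ⟨-, h2⟩ := Finset.mem_filter.1 hγ
    have h3 := algebraMap_symb_minpoly_pow hodd D γ (k / (minpoly F γ).natDegree)
    rw [h2, Int.cast_zero] at h3
    rw [Multiset.mem_toFinset, mem_roots hD0', IsRoot.def, eval_map_algebraMap]
    exact eq_zero_of_pow_eq_zero h3.symm
  calc _ ≤ _ := Finset.card_le_card hsub
    _ ≤ _ := Multiset.toFinset_card_le _
    _ ≤ _ := card_roots' _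
    _ ≤ _ := natDegree_map_le

lemma card_filter_add_card_filter_add (D : F[X]) {k : ℕ} (hk : k ≠ 0) :
    ((fixedPts F K k).filter fun γ =>
      symb D (minpoly F γ) ^ (k / (minpoly F γ).natDegree) = 1).card +
    ((fixedPts F K k).filter fun γ =>
      symb D (minpoly F γ) ^ (k / (minpoly F γ).natDegree) = -1).card +
    ((fixedPts F K k).filter fun γ =>
      symb D (minpoly F γ) ^ (k / (minpoly F γ).natDegree) = 0).card = Fintype.card F ^ k := by
  rw [← card_fixedPts (F := F) (K := K) hk]
  simp only [Finset.card_filter, ← Finset.sum_add_distrib]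
  rw [Finset.card_eq_sum_ones]
  refine Finset.sum_congr rfl fun γ _ => ?_
  rcases symb_pow_trichotomy D (minpoly F γ) (k / (minpoly F γ).natDegree) with h | h | h <;>
    simp [h]

lemma extSum_eq (D : F[X]) (k : ℕ) :
    extSum K D k = (((fixedPts F K k).filter fun γ =>
      symb D (minpoly F γ) ^ (k / (minpoly F γ).natDegree) = 1).card : ℤ) -
    (((fixedPts F K k).filter fun γ =>
      symb D (minpoly F γ) ^ (k / (minpoly F γ).natDegree) = -1).card : ℤ) := by
  simp only [Finset.card_filter]
  push_cast
  rw [← Finset.sum_sub_distrib]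
  refine Finset.sum_congr rfl fun γ _ => ?_
  rcases symb_pow_trichotomy D (minpoly F γ) (k / (minpoly F γ).natDegree) with h | h | h <;>
    simp [h]

theorem abs_extSum_le (hodd : Odd (Fintype.card F)) {D : F[X]} {β : K}
    (hβ : Odd ((D.map (algebraMap F K)).rootMultiplicity β)) {k : ℕ} (hk : k ≠ 0) :
    |(extSum K D k : ℝ)| ≤ (12 * D.natDegree + 30 : ℕ) * √(Fintype.card F : ℝ) ^ k := by
  have hD0 : D ≠ 0 := by
    rintro rfl
    simp at hβ
  have h1 := extSum_eq (K := K) D k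
  have h2 := card_filter_add_card_filter_add (K := K) D hk
  have h3 := card_filter_symb_pow_eq_zero_le (K := K) hodd hD0 k
  have hpos := two_mul_card_filter_le hodd hβ hk (ε := 1)
  have hneg := two_mul_card_filter_le hodd hβ hk (ε := -1)
  set a := ((fixedPts F K k).filter fun γ =>
      symb D (minpoly F γ) ^ (k / (minpoly F γ).natDegree) = 1).card
  set b := ((fixedPts F K k).filter fun γ =>
      symb D (minpoly F γ) ^ (k / (minpoly F γ).natDegree) = -1).card
  set c := ((fixedPts F K k).filter fun γ =>
      symb D (minpoly F γ) ^ (k / (minpoly F γ).natDegree) = 0).card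
  set d := D.natDegree
  set M := Nat.sqrt (Fintype.card F ^ k) with hM
  have hQpos : 0 < Fintype.card F ^ k := pow_pos Fintype.card_pos _
  have hMpos : 0 < M := Nat.sqrt_pos.2 hQpos
  have hQle : Fintype.card F ^ k ≤ M * M + M + M := Nat.sqrt_le_add _
  have key : |extSum K D k| ≤ ((12 * d + 30) * M : ℕ) := by
    rw [h1]
    by_cases hl : 4 * d + 10 ≤ M
    · have e1 := hpos hl (Or.inl rfl)
      have e2 := hneg hl (Or.inr rfl)
      have e3 : d * 1 ≤ d * M := Nat.mul_le_mul_left _ hMpos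
      have e4 : 10 * (d + 1) * M + d ≤ (12 * d + 30) * M := by nlinarith
      rw [abs_le]
      constructor <;> push_cast <;> zify at * <;> linarith
    · push Not at hl
      have e1 : M * M ≤ (4 * d + 10) * M := Nat.mul_le_mul_right _ hl.le
      have e2 : M * 1 ≤ M * M := Nat.mul_le_mul_left _ hMpos
      have e3 : a + b ≤ (12 * d + 30) * M := by nlinarith
      rw [abs_le]
      constructor <;> push_cast <;> zify at * <;> linarith
  have hMle : (M : ℝ) ≤ √(Fintype.card F : ℝ) ^ k := by
    refine (sq_le_sq₀ (Nat.cast_nonneg _) (by positivity)).1 ?_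
    rw [← pow_mul, mul_comm k, pow_mul, Real.sq_sqrt (Nat.cast_nonneg _)]
    have := Nat.sqrt_le' (Fintype.card F ^ k)
    rw [← hM] at this
    exact_mod_cast this
  calc |(extSum K D k : ℝ)| ≤ (((12 * d + 30) * M : ℕ) : ℝ) := by exact_mod_cast key
    _ = (12 * d + 30 : ℕ) * (M : ℝ) := by push_cast; ring
    _ ≤ _ := by gcongr

theorem exists_rsymb_eq_neg_one (hodd : Odd (Fintype.card F)) {D : F[X]} {β : K}
    (hβ : Odd ((D.map (algebraMap F K)).rootMultiplicity β)) :
    ∃ P : F[X], IsCoprime D P ∧ rsymb D P = -1 := by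
  have hD0 : D ≠ 0 := by
    rintro rfl
    simp at hβ
  set d := D.natDegree with hd
  set m := 12 * (d + 1) with hm
  have hM : Nat.sqrt (Fintype.card F ^ (2 * m)) = Fintype.card F ^ m := by
    rw [two_mul, pow_add, Nat.sqrt_eq]
  have hMm : m < Fintype.card F ^ m := Nat.lt_pow_self Fintype.one_lt_card
  have hk : 2 * m ≠ 0 := by omega
  have h2 := card_filter_add_card_filter_add (K := K) D hk
  have h3 := card_filter_symb_pow_eq_zero_le (K := K) hodd hD0 (2 * m)
  have hpos := two_mul_card_filter_le hodd hβ hk (ε := 1) (by rw [hM]; omega) (Or.inl rfl)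
  rw [hM] at hpos
  have hne : ((fixedPts F K (2 * m)).filter fun γ =>
      symb D (minpoly F γ) ^ (2 * m / (minpoly F γ).natDegree) = -1).Nonempty := by
    rw [← Finset.card_pos]
    by_contra h0
    have hsq : Fintype.card F ^ (2 * m) = Fintype.card F ^ m * Fintype.card F ^ m := by
      rw [two_mul, pow_add]
    rw [hsq] at h2 hpos
    generalize Fintype.card F ^ m = M at *
    have h4 : m * M ≤ M * M := Nat.mul_le_mul_right _ hMm.le
    have h5 : d * 1 ≤ d * M := Nat.mul_le_mul_left _ (by omega)
    rw [hm] at h4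
    nlinarith
  obtain ⟨γ, hγ⟩ := hne
  obtain ⟨h1, h2⟩ := Finset.mem_filter.1 hγ
  rw [mem_fixedPts hk, pow_card_pow_eq_self_iff] at h1
  obtain ⟨j, hj⟩ := h1
  rw [hj, Nat.mul_div_cancel_left _ (natDegree_minpoly_pos γ)] at h2
  have hs : symb D (minpoly F γ) = -1 := by
    rcases symb_trichotomy D (minpoly F γ) with h | h | h
    · rw [h] at h2
      rcases Nat.eq_zero_or_pos j with rfl | hjp
      · simp at h2
      · simp [hjp.ne'] at h2
    · rw [h] at h2
      simp at h2
    · exact h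
  have hjodd : ¬ Even j := by
    intro hev
    rw [hs, hev.neg_one_pow] at h2
    norm_num at h2
  have heven : Even (minpoly F γ).natDegree := by
    have h4 : Even ((minpoly F γ).natDegree * j) := hj ▸ even_two_mul m
    exact (Nat.even_mul.1 h4).resolve_right hjodd
  refine ⟨minpoly F γ, ?_, ?_⟩
  · have hirr := minpoly.irreducible (Algebra.IsIntegral.isIntegral (R := F) γ)
    refine (hirr.coprime_iff_not_dvd.2 fun hdvd => ?_).symm
    rw [minpoly.dvd_iff] at hdvd
    have h5 := algebraMap_symb_minpoly hodd D γ
    rw [hs, hdvd, zero_pow] at h5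
    · simp at h5
    · have h6 : 2 < Fintype.card F := by
        have := Fintype.one_lt_card (α := F)
        rw [Nat.odd_iff] at hodd
        omega
      have h7 := Nat.pow_le_pow_right (n := Fintype.card F) (by omega)
        (natDegree_minpoly_pos (F := F) γ)
      simp at h7
      omega
  · have h6 := symb_eq_rsymb D (minpoly F γ)
    rw [(heven.mul_right _).neg_one_pow, map_one, one_mul, hs] at h6
    exact h6.symm
end Stepanov

section LPolynomial
open Polynomial Filter Topology

lemma one_le_mul_norm_of_eval_eq_zero {a S : ℕ → ℂ} {d : ℕ} (ha0 : a 0 = 1)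
    (ha : ∀ n, d ≤ n → a n = 0)
    (hrec : ∀ n : ℕ, (n : ℂ) * a n = ∑ x ∈ Finset.HasAntidiagonal.antidiagonal n, a x.1 * S x.2)
    {B s : ℝ} (hs : 0 < s) (hS : ∀ k, ‖S k‖ ≤ B * s ^ k) {z : ℂ}
    (hz : ∑ n ∈ Finset.range d, a n * z ^ n = 0) : 1 ≤ s * ‖z‖ := by
  by_contra hlt
  push Not at hlt
  obtain ⟨ρ, hzρ, hρs⟩ : ∃ ρ, ‖z‖ < ρ ∧ ρ < 1 / s :=
    exists_between (by rw [lt_div_iff₀ hs]; linarith)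
  have hρ0 : 0 ≤ ρ := (norm_nonneg z).trans hzρ.le
  have hsρ : s * ρ < 1 := by
    rw [lt_div_iff₀ hs] at hρs
    linarith
  have hsum : Summable fun k => B * (s * ρ) ^ k :=
    (summable_geometric_of_lt_one (by positivity) hsρ).mul_left B
  have hbd : ∀ w : ℂ, ‖w‖ ≤ ρ → ∀ k, ‖S k * w ^ k‖ ≤ B * (s * ρ) ^ k := by
    intro w hw k
    rw [norm_mul, norm_pow, mul_pow, ← mul_assoc]
    exact mul_le_mul (hS k) (pow_le_pow_left₀ (norm_nonneg _) hw k) (by positivity)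
      ((norm_nonneg _).trans (hS k))
  set L : ℂ[X] := ∑ n ∈ Finset.range d, C (a n) * X ^ n with hL
  have hLeval : ∀ w, L.eval w = ∑ n ∈ Finset.range d, a n * w ^ n := by
    intro w
    simp [hL, eval_finsetSum]
  have hLder : ∀ w, w * L.derivative.eval w = ∑ n ∈ Finset.range d, (n : ℂ) * a n * w ^ n := by
    intro w
    simp only [hL, derivative_sum, eval_finsetSum, Finset.mul_sum, derivative_C_mul_X_pow,
      eval_mul, eval_C, eval_pow, eval_X]
    refine Finset.sum_congr rfl fun n _ => ?_
    rcases n with _ | n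
    · simp
    · rw [Nat.add_sub_cancel, pow_succ]
      ring
  have hfun : ∀ w : ℂ, ‖w‖ ≤ ρ → w * L.derivative.eval w = L.eval w * ∑' k, S k * w ^ k := by
    intro w hw
    have hsS : Summable fun k => ‖S k * w ^ k‖ :=
      Summable.of_nonneg_of_le (fun _ => norm_nonneg _) (hbd w hw) hsum
    have hsa : Summable fun k => ‖a k * w ^ k‖ :=
      summable_of_ne_finset_zero (s := Finset.range d) fun n hn => by
        rw [ha n (by simpa using hn)]
        simp
    have h1 : L.eval w = ∑' n, a n * w ^ n := by
      rw [hLeval, tsum_eq_sum (s := Finset.range d)]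
      intro n hn
      rw [ha n (by simpa using hn), zero_mul]
    have h2 : w * L.derivative.eval w = ∑' n : ℕ, (n : ℂ) * a n * w ^ n := by
      rw [hLder, tsum_eq_sum (s := Finset.range d)]
      intro n hn
      rw [ha n (by simpa using hn), mul_zero, zero_mul]
    rw [h1, h2, tsum_mul_tsum_eq_tsum_sum_antidiagonal_of_summable_norm hsa hsS]
    refine tsum_congr fun n => ?_
    rw [hrec, Finset.sum_mul]
    refine Finset.sum_congr rfl fun x hx => ?_
    rw [← Finset.HasAntidiagonal.mem_antidiagonal.1 hx, pow_add]
    ring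
  have hd : 0 < d := by
    rcases Nat.eq_zero_or_pos d with rfl | h
    · have := ha 0 le_rfl
      rw [ha0] at this
      exact absurd this one_ne_zero
    · exact h
  have hL0 : L.eval 0 = 1 := by
    rw [hLeval, Finset.sum_eq_single 0]
    · simp [ha0]
    · intro n _ hn
      simp [hn]
    · intro h
      simp at h
      omega
  have hLne : L ≠ 0 := by
    intro h
    rw [h] at hL0
    simp at hL0
  have hzroot : L.eval z = 0 := by rw [hLeval, hz]
  have hzne : z ≠ 0 := by
    rintro rfl
    rw [hL0] at hzroot
    exact one_ne_zero hzroot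
  obtain ⟨M, hM, hMz⟩ := exists_eq_pow_rootMultiplicity_mul_and_not_dvd L hLne z
  have hmpos : 0 < L.rootMultiplicity z := (rootMultiplicity_pos hLne).2 hzroot
  obtain ⟨m, hm⟩ : ∃ m, L.rootMultiplicity z = m + 1 := ⟨L.rootMultiplicity z - 1, by omega⟩
  rw [hm] at hM
  rw [dvd_iff_isRoot, IsRoot.def] at hMz
  have hineq : ∀ w : ℂ, w ≠ z → ‖w‖ ≤ ρ →
      ‖w * ((m + 1) * M.eval w + (w - z) * M.derivative.eval w)‖ ≤
        ‖(w - z) * M.eval w‖ * ∑' k, B * (s * ρ) ^ k := by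
    intro w hwz hw
    have h1 := hfun w hw
    rw [hM] at h1
    simp only [derivative_mul, derivative_X_sub_C_pow, eval_mul, eval_add, eval_pow, eval_sub,
      eval_X, eval_C, Nat.add_sub_cancel] at h1
    have h2 : w * ((m + 1) * M.eval w + (w - z) * M.derivative.eval w) =
        (w - z) * M.eval w * ∑' k, S k * w ^ k := by
      refine mul_left_cancel₀ (pow_ne_zero m (sub_ne_zero.2 hwz)) ?_
      push_cast at h1
      rw [pow_succ] at h1
      linear_combination h1
    rw [h2, norm_mul]
    refine mul_le_mul_of_nonneg_left ?_ (norm_nonneg _)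
    exact tsum_of_norm_bounded hsum.hasSum (hbd w hw)
  have hlim1 : Tendsto (fun w : ℂ => ‖w * ((m + 1) * M.eval w + (w - z) * M.derivative.eval w)‖)
      (𝓝[≠] z) (𝓝 ‖z * ((m + 1) * M.eval z + (z - z) * M.derivative.eval z)‖) := by
    have : Continuous fun w : ℂ =>
        ‖w * ((m + 1) * M.eval w + (w - z) * M.derivative.eval w)‖ := by fun_prop
    exact this.continuousAt.tendsto.mono_left nhdsWithin_le_nhds
  have hlim2 : Tendsto (fun w : ℂ => ‖(w - z) * M.eval w‖ * ∑' k, B * (s * ρ) ^ k)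
      (𝓝[≠] z) (𝓝 (‖(z - z) * M.eval z‖ * ∑' k, B * (s * ρ) ^ k)) := by
    have : Continuous fun w : ℂ => ‖(w - z) * M.eval w‖ * ∑' k, B * (s * ρ) ^ k := by fun_prop
    exact this.continuousAt.tendsto.mono_left nhdsWithin_le_nhds
  have hev : ∀ᶠ w in 𝓝[≠] z, ‖w * ((m + 1) * M.eval w + (w - z) * M.derivative.eval w)‖ ≤
      ‖(w - z) * M.eval w‖ * ∑' k, B * (s * ρ) ^ k := by
    have h1 : ∀ᶠ w in 𝓝[≠] z, ‖w‖ < ρ :=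
      (continuous_norm.continuousAt.tendsto.mono_left nhdsWithin_le_nhds).eventually
        (gt_mem_nhds hzρ)
    filter_upwards [h1, self_mem_nhdsWithin] with w hw hwz
    exact hineq w hwz hw.le
  have hfinal := le_of_tendsto_of_tendsto hlim1 hlim2 hev
  simp only [sub_self, zero_mul, add_zero, norm_zero] at hfinal
  have h3 := norm_le_zero_iff.1 hfinal
  rcases mul_eq_zero.1 h3 with h | h
  · exact hzne h
  · rcases mul_eq_zero.1 h with h | h
    · exact Nat.cast_add_one_ne_zero m h
    · exact hMz h

lemma norm_multiset_sum_le_card_mul {s : ℝ} {R : Multiset ℂ} (h : ∀ w ∈ R, ‖w‖ ≤ s) :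
    ‖R.sum‖ ≤ R.card * s := by
  induction R using Multiset.induction_on with
  | empty => simp
  | cons w R ih =>
    rw [Multiset.sum_cons, Multiset.card_cons]
    have h1 := ih fun v hv => h v (Multiset.mem_cons_of_mem hv)
    have h2 := h w (Multiset.mem_cons_self w R)
    have h3 := norm_add_le w R.sum
    push_cast
    linarith

theorem norm_coeff_one_le {a S : ℕ → ℂ} {d : ℕ} (ha0 : a 0 = 1)
    (ha : ∀ n, d + 1 ≤ n → a n = 0)
    (hrec : ∀ n : ℕ, (n : ℂ) * a n = ∑ x ∈ Finset.HasAntidiagonal.antidiagonal n, a x.1 * S x.2)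
    {B s : ℝ} (hs : 0 < s) (hS : ∀ k, ‖S k‖ ≤ B * s ^ k) :
    ‖a 1‖ ≤ d * s ∧
      (∑ n ∈ Finset.range (d + 1), a n = 0 → ‖a 1‖ ≤ ((d : ℝ) - 1) * s + 1) := by
  rcases Nat.eq_zero_or_pos d with rfl | hd
  · rw [ha 1 le_rfl]
    simp [ha0]
  set R : ℂ[X] := ∑ n ∈ Finset.range (d + 1), C (a n) * X ^ (d - n) with hR
  have hcoeff : ∀ i ≤ d, R.coeff (d - i) = a i := by
    intro i hi
    simp only [hR, finsetSum_coeff, coeff_C_mul_X_pow]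
    rw [Finset.sum_eq_single i]
    · simp
    · intro n hn hne
      rw [Finset.mem_range] at hn
      rw [if_neg]
      omega
    · intro h
      simp at h
      omega
  have hdegle : R.natDegree ≤ d := by
    refine natDegree_sum_le_of_forall_le _ _ fun n _ => ?_
    exact (natDegree_C_mul_X_pow_le _ _).trans (Nat.sub_le _ _)
  have hlead : R.coeff d = 1 := by
    have := hcoeff 0 (Nat.zero_le _)
    rwa [Nat.sub_zero, ha0] at this
  have hdeg : R.natDegree = d :=
    le_antisymm hdegle (le_natDegree_of_ne_zero (by rw [hlead]; exact one_ne_zero))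
  have hmonic : R.Monic := by rw [Monic, leadingCoeff, hdeg, hlead]
  have hnext : a 1 = -R.roots.sum := by
    have h1 := (IsAlgClosed.splits R).nextCoeff_eq_neg_sum_roots_of_monic hmonic
    rw [nextCoeff_of_natDegree_pos (by omega), hdeg, hcoeff 1 hd] at h1
    exact h1
  have hcard : R.roots.card = d := by
    rw [← (IsAlgClosed.splits R).natDegree_eq_card_roots, hdeg]
  have hroots : ∀ w ∈ R.roots, ‖w‖ ≤ s := by
    intro w hw
    rcases eq_or_ne w 0 with rfl | hw0
    · simpa using hs.le
    have hw' : R.eval w = 0 := (mem_roots hmonic.ne_zero).1 hw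
    have h1 : ∑ n ∈ Finset.range (d + 1), a n * w⁻¹ ^ n = 0 := by
      have : w ^ d * ∑ n ∈ Finset.range (d + 1), a n * w⁻¹ ^ n = R.eval w := by
        simp only [hR, eval_finsetSum, eval_mul, eval_C, eval_pow, eval_X, Finset.mul_sum]
        refine Finset.sum_congr rfl fun n hn => ?_
        rw [Finset.mem_range] at hn
        obtain ⟨k, hk⟩ := Nat.exists_eq_add_of_le (Nat.le_of_lt_succ hn)
        rw [hk, Nat.add_sub_cancel_left, pow_add, inv_pow]
        field_simp
      rw [hw'] at this
      exact (mul_eq_zero.1 this).resolve_left (pow_ne_zero _ hw0)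
    have h2 := one_le_mul_norm_of_eval_eq_zero ha0 ha hrec hs hS h1
    rw [norm_inv, ← div_eq_mul_inv, le_div_iff₀ (norm_pos_iff.2 hw0)] at h2
    linarith
  refine ⟨?_, fun hsum => ?_⟩
  · rw [hnext, norm_neg, ← hcard]
    exact norm_multiset_sum_le_card_mul hroots
  · have h1 : (1 : ℂ) ∈ R.roots := by
      rw [mem_roots hmonic.ne_zero, IsRoot.def]
      simpa [hR, eval_finsetSum] using hsum
    obtain ⟨T, hT⟩ := Multiset.exists_cons_of_mem h1
    have hTcard : T.card + 1 = d := by rw [← hcard, hT, Multiset.card_cons]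
    have h2 := norm_multiset_sum_le_card_mul (R := T) (s := s) fun w hw =>
      hroots w (by rw [hT]; exact Multiset.mem_cons_of_mem hw)
    rw [hnext, norm_neg, hT, Multiset.sum_cons, ← hTcard]
    have h3 := norm_add_le (1 : ℂ) T.sum
    rw [norm_one] at h3
    push_cast
    linarith
end LPolynomial

section Weil
open Polynomial
variable {K : Type} [Field K] [Algebra F K] [Algebra.IsAlgebraic F K] [IsAlgClosed K]

lemma natDegree_pos_of_odd_rootMultiplicity {D : F[X]} {β : K}
    (hβ : Odd ((D.map (algebraMap F K)).rootMultiplicity β)) : 0 < D.natDegree := by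
  have hD0 : D ≠ 0 := by
    rintro rfl
    simp at hβ
  have hmap : D.map (algebraMap F K) ≠ 0 :=
    (Polynomial.map_ne_zero_iff (algebraMap F K).injective).2 hD0
  have hr := (rootMultiplicity_pos hmap).1 hβ.pos
  by_contra h
  rw [eq_C_of_natDegree_eq_zero (Nat.eq_zero_of_not_pos h)] at hr hD0
  simp at hr
  exact hD0 (by rw [hr, C_0])

lemma lcoef_eq_mul_sum_rsymb (D : F[X]) (n : ℕ) :
    lcoef D n = quadraticChar F ((-1) ^ (n * D.natDegree)) * ∑ g ∈ monicDegree F n, rsymb D g := by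
  rw [lcoef, Finset.mul_sum]
  refine Finset.sum_congr rfl fun g hg => ?_
  rw [symb_eq_rsymb, (mem_monicDegree.1 hg).2]

theorem abs_sum_quadraticChar_le_of_monic (hodd : Odd (Fintype.card F)) {D : F[X]}
    (hD : D.Monic) {β : K} (hβ : Odd ((D.map (algebraMap F K)).rootMultiplicity β)) :
    |((∑ a : F, quadraticChar F (D.eval a) : ℤ) : ℝ)| ≤
        ((D.natDegree : ℝ) - 1) * √(Fintype.card F) ∧
      (Even D.natDegree → |((∑ a : F, quadraticChar F (D.eval a) : ℤ) : ℝ)| ≤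
        ((D.natDegree : ℝ) - 2) * √(Fintype.card F) + 1) := by
  have hpos : 0 < D.natDegree := natDegree_pos_of_odd_rootMultiplicity hβ
  obtain ⟨d, hd⟩ : ∃ d, D.natDegree = d + 1 := ⟨D.natDegree - 1, by omega⟩
  obtain ⟨P, hcop, hP⟩ := exists_rsymb_eq_neg_one hodd hβ
  have h0 := sum_lowDegree_rsymb hD hcop hP
  set S : ℕ → ℂ := fun k => if k = 0 then 0 else (extSum K D k : ℂ) with hS
  have hq : (0 : ℝ) < √(Fintype.card F) := Real.sqrt_pos.2 (by exact_mod_cast Fintype.card_pos)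
  have key := norm_coeff_one_le (a := fun n => (lcoef D n : ℂ)) (S := S) (d := d)
    (B := (12 * D.natDegree + 30 : ℕ)) (s := √(Fintype.card F : ℝ))
    (by simp [lcoef_zero]) ?_ ?_ hq ?_
  · have e1 : ‖((lcoef D 1 : ℤ) : ℂ)‖ = |((∑ a : F, quadraticChar F (D.eval a) : ℤ) : ℝ)| := by
      rw [lcoef_one, Complex.norm_intCast]
    rw [e1] at key
    rw [hd]
    refine ⟨?_, fun hev => ?_⟩
    · have := key.1
      push_cast at this ⊢
      linarith
    · have h2 : ∑ n ∈ Finset.range (d + 1), ((lcoef D n : ℤ) : ℂ) = 0 := by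
        rw [← Int.cast_sum, Int.cast_eq_zero]
        have h3 := sum_range_sum_monicDegree_rsymb hD (hd ▸ hev) hpos.ne' h0
        rw [hd] at h3
        rw [← h3]
        refine Finset.sum_congr rfl fun n _ => ?_
        rw [lcoef_eq_mul_sum_rsymb, hd, (hev.mul_left n).neg_one_pow, map_one, one_mul]
      have := key.2 h2
      push_cast at this ⊢
      linarith
  · intro n hn
    rw [lcoef_eq_mul_sum_rsymb, sum_monicDegree_rsymb hD h0 (by omega)]
    simp
  · intro n
    have h1 := natCast_mul_lcoef K D n
    have h2 : (n : ℂ) * (lcoef D n : ℂ) =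
        ∑ k ∈ Finset.Icc 1 n, (extSum K D k : ℂ) * (lcoef D (n - k) : ℂ) := by
      exact_mod_cast congrArg (Int.cast : ℤ → ℂ) h1
    rw [h2, Finset.Nat.sum_antidiagonal_eq_sum_range_succ
      (fun i j => ((lcoef D i : ℤ) : ℂ) * S j) n, ← Finset.sum_range_reflect,
      Finset.sum_range_succ']
    have h3 : ((lcoef D (n + 1 - 1 - 0) : ℤ) : ℂ) * S (n - (n + 1 - 1 - 0)) = 0 := by
      simp [hS]
    rw [h3, add_zero]
    refine Finset.sum_bij' (fun k _ => k - 1) (fun k _ => k + 1) ?_ ?_ ?_ ?_ ?_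
    · intro k hk
      simp only [Finset.mem_Icc, Finset.mem_range] at hk ⊢
      omega
    · intro k hk
      simp only [Finset.mem_Icc, Finset.mem_range] at hk ⊢
      omega
    · intro k hk
      simp only [Finset.mem_Icc] at hk
      omega
    · intro k hk
      omega
    · intro k hk
      simp only [Finset.mem_Icc] at hk
      have e1 : n + 1 - 1 - (k - 1 + 1) = n - k := by omega
      have e2 : n - (n - k) = k := by omega
      rw [e1, e2, hS]
      simp only
      rw [if_neg (by omega), mul_comm]
  · intro k
    by_cases hk : k = 0
    · simp only [hS, hk, if_true, norm_zero]
      positivity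
    · simp only [hS, hk, if_false, Complex.norm_intCast]
      exact abs_extSum_le hodd hβ hk

/-- **Weil's bound** for quadratic character sums of polynomials over a finite field. -/
theorem abs_sum_quadraticChar_le (hodd : Odd (Fintype.card F)) {D : F[X]} {β : K}
    (hβ : Odd ((D.map (algebraMap F K)).rootMultiplicity β)) :
    |((∑ a : F, quadraticChar F (D.eval a) : ℤ) : ℝ)| ≤
        ((D.natDegree : ℝ) - 1) * √(Fintype.card F) ∧
      (Even D.natDegree → |((∑ a : F, quadraticChar F (D.eval a) : ℤ) : ℝ)| ≤
        ((D.natDegree : ℝ) - 2) * √(Fintype.card F) + 1) := by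
  have hD0 : D ≠ 0 := by
    rintro rfl
    simp at hβ
  have hlc : D.leadingCoeff ≠ 0 := leadingCoeff_ne_zero.2 hD0
  set D₁ := C D.leadingCoeff⁻¹ * D with hD₁
  have hfac : D = C D.leadingCoeff * D₁ := by
    rw [hD₁, ← mul_assoc, ← C_mul, mul_inv_cancel₀ hlc, C_1, one_mul]
  have hmonic : D₁.Monic := by
    rw [Monic, hD₁, leadingCoeff_mul, leadingCoeff_C, inv_mul_cancel₀ hlc]
  have hdeg : D₁.natDegree = D.natDegree := natDegree_C_mul (inv_ne_zero hlc)
  have hD₁0 : D₁.map (algebraMap F K) ≠ 0 :=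
    (Polynomial.map_ne_zero_iff (algebraMap F K).injective).2 hmonic.ne_zero
  have hmult : (D₁.map (algebraMap F K)).rootMultiplicity β =
      (D.map (algebraMap F K)).rootMultiplicity β := by
    have hc : (algebraMap F K) D.leadingCoeff⁻¹ ≠ 0 :=
      (map_ne_zero (algebraMap F K)).2 (inv_ne_zero hlc)
    classical
    rw [← count_roots, ← count_roots, hD₁, Polynomial.map_mul, map_C, roots_C_mul _ hc]
  have key := abs_sum_quadraticChar_le_of_monic hodd hmonic (β := β) (hmult ▸ hβ)
  have hsum : |((∑ a : F, quadraticChar F (D.eval a) : ℤ) : ℝ)| =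
      |((∑ a : F, quadraticChar F (D₁.eval a) : ℤ) : ℝ)| := by
    have h1 : ∑ a : F, quadraticChar F (D.eval a) =
        quadraticChar F D.leadingCoeff * ∑ a : F, quadraticChar F (D₁.eval a) := by
      rw [Finset.mul_sum]
      refine Finset.sum_congr rfl fun a _ => ?_
      conv_lhs => rw [hfac, eval_mul, eval_C, map_mul]
    rw [h1, Int.cast_mul, abs_mul]
    rcases quadraticChar_dichotomy hlc with h | h <;> rw [h] <;> simp
  rw [hsum, ← hdeg]
  exact key
end Weil

section CubicDisc
open Polynomial

/-- The discriminant of `X³ + A X² + B X + C`. -/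
def cubicDisc {R : Type*} [CommRing R] (A B C : R) : R :=
  A ^ 2 * B ^ 2 - 4 * B ^ 3 - 4 * A ^ 3 * C - 27 * C ^ 2 + 18 * A * B * C

variable {K : Type*} [Field K]

lemma map_cubicDisc {R S : Type*} [CommRing R] [CommRing S] (φ : R →+* S) (A B C : R) :
    φ (cubicDisc A B C) = cubicDisc (φ A) (φ B) (φ C) := by
  simp only [cubicDisc, map_add, map_sub, map_mul, map_pow, map_ofNat]

lemma exists_double_root [IsAlgClosed K] {A B C : K} (h : cubicDisc A B C = 0) :
    ∃ t s, A = -(2 * t + s) ∧ B = t ^ 2 + 2 * t * s ∧ C = -(t ^ 2 * s) := by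
  obtain ⟨x, hx⟩ : ∃ x, x ^ 3 + A * x ^ 2 + B * x + C = 0 := by
    obtain ⟨x, hx⟩ := IsAlgClosed.exists_root
      (X ^ 3 + Polynomial.C A * X ^ 2 + Polynomial.C B * X + Polynomial.C C)
      (by rw [show degree _ = (3 : ℕ) by compute_degree!]; norm_num)
    exact ⟨x, by simpa using hx⟩
  obtain ⟨y, hy⟩ : ∃ y, y ^ 2 + (A + x) * y + (B + (A + x) * x) = 0 := by
    obtain ⟨y, hy⟩ := IsAlgClosed.exists_root
      (X ^ 2 + Polynomial.C (A + x) * X + Polynomial.C (B + (A + x) * x))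
      (by rw [show degree _ = (2 : ℕ) by compute_degree!]; norm_num)
    exact ⟨y, by simpa using hy⟩
  obtain ⟨z, hz⟩ : ∃ z, z = -A - x - y := ⟨_, rfl⟩
  have hA : A = -(x + y + z) := by rw [hz]; ring
  have hB : B = x * y + x * z + y * z := by
    rw [hz]
    linear_combination hy
  have hC : C = -(x * y * z) := by
    rw [hz]
    linear_combination hx - x * hy
  have hprod : ((x - y) * (x - z) * (y - z)) ^ 2 = 0 := by
    rw [← h, hA, hB, hC, cubicDisc]
    ring
  have h0 : (x - y) * (x - z) * (y - z) = 0 := by simpa using hprod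
  rcases mul_eq_zero.1 h0 with h1 | h1
  · rcases mul_eq_zero.1 h1 with h2 | h2
    · obtain rfl := sub_eq_zero.1 h2
      exact ⟨x, z, by rw [hA]; ring, by rw [hB]; ring, by rw [hC]; ring⟩
    · obtain rfl := sub_eq_zero.1 h2
      exact ⟨x, y, by rw [hA]; ring, by rw [hB]; ring, by rw [hC]; ring⟩
  · obtain rfl := sub_eq_zero.1 h1
    exact ⟨y, x, by rw [hA]; ring, by rw [hB]; ring, by rw [hC]; ring⟩

lemma eval_cubicDisc (A B C : K[X]) (β : K) :
    (cubicDisc A B C).eval β = cubicDisc (A.eval β) (B.eval β) (C.eval β) :=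
  map_cubicDisc (evalRingHom β) A B C

lemma eval_derivative_cubicDisc {A B C : K[X]} {β t s : K} (hA : A.eval β = -(2 * t + s))
    (hB : B.eval β = t ^ 2 + 2 * t * s) (hC : C.eval β = -(t ^ 2 * s)) :
    (derivative (cubicDisc A B C)).eval β = 4 * (s - t) ^ 3 *
      (t ^ 2 * A.derivative.eval β + t * B.derivative.eval β + C.derivative.eval β) := by
  have h4 : (4 : K[X]) = Polynomial.C 4 := rfl
  have h18 : (18 : K[X]) = Polynomial.C 18 := rfl
  have h27 : (27 : K[X]) = Polynomial.C 27 := rfl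
  simp only [cubicDisc, h4, h18, h27, derivative_add, derivative_sub, derivative_mul,
    derivative_pow, derivative_C, eval_add, eval_sub, eval_mul, eval_pow, eval_C, hA, hB, hC,
    eval_zero]
  push_cast
  ring

/-- At a multiple root of the discriminant of a transversal family of cubics, the cubic has a
triple root. -/
lemma exists_triple_root [IsAlgClosed K] (h2 : (2 : K) ≠ 0) {A B C : K[X]} {β : K}
    (h0 : (cubicDisc A B C).eval β = 0) (h1 : (derivative (cubicDisc A B C)).eval β = 0)
    (htr : ∀ t s, A.eval β = -(2 * t + s) → B.eval β = t ^ 2 + 2 * t * s →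
      C.eval β = -(t ^ 2 * s) →
      t ^ 2 * A.derivative.eval β + t * B.derivative.eval β + C.derivative.eval β ≠ 0) :
    ∃ t, A.eval β = -(3 * t) ∧ B.eval β = 3 * t ^ 2 ∧ C.eval β = -t ^ 3 ∧
      t ^ 2 * A.derivative.eval β + t * B.derivative.eval β + C.derivative.eval β ≠ 0 := by
  rw [eval_cubicDisc] at h0
  obtain ⟨t, s, hA, hB, hC⟩ := exists_double_root h0
  rw [eval_derivative_cubicDisc hA hB hC] at h1
  have h4 : (4 : K) ≠ 0 := by
    have : (4 : K) = 2 * 2 := by norm_num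
    rw [this]
    exact mul_ne_zero h2 h2
  have hts : t = s := by
    have := (mul_eq_zero.1 h1).resolve_right (htr t s hA hB hC)
    have := (mul_eq_zero.1 this).resolve_left h4
    exact (sub_eq_zero.1 (pow_eq_zero_iff (by norm_num) |>.1 this)).symm
  subst hts
  exact ⟨t, by rw [hA]; ring, by rw [hB]; ring, by rw [hC]; ring, htr t t hA hB hC⟩

lemma exists_eq_C_mul_sq [IsAlgClosed K] {D : K[X]}
    (h : ∀ β, Even (D.rootMultiplicity β)) :
    ∃ G : K[X], G.Monic ∧ D = C D.leadingCoeff * G ^ 2 := by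
  classical
  refine ⟨∏ β ∈ D.roots.toFinset, (X - C β) ^ (D.rootMultiplicity β / 2),
    monic_prod_of_monic _ _ fun β _ => (monic_X_sub_C β).pow _, ?_⟩
  have h1 : D.roots.toFinset.prod (fun β => (X - C β) ^ (D.rootMultiplicity β)) =
      (∏ β ∈ D.roots.toFinset, (X - C β) ^ (D.rootMultiplicity β / 2)) ^ 2 := by
    rw [← Finset.prod_pow]
    refine Finset.prod_congr rfl fun β _ => ?_
    rw [← pow_mul, Nat.div_mul_cancel (h β).two_dvd]
  rw [← h1, ← prod_multiset_root_eq_finset_root]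
  exact (IsAlgClosed.splits D).eq_prod_roots

lemma dvd_of_forall_root [IsAlgClosed K] {G p : K[X]}
    (hG : G.Monic) (h1 : ∀ β, G.eval β = 0 → G.rootMultiplicity β ≤ 1)
    (h : ∀ β, G.eval β = 0 → p.eval β = 0) : G ∣ p := by
  classical
  rcases eq_or_ne p 0 with rfl | hp
  · exact dvd_zero _
  have hle : G.roots ≤ p.roots := by
    rw [Multiset.le_iff_count]
    intro β
    rw [count_roots, count_roots]
    by_cases hβ : G.eval β = 0
    · exact (h1 β hβ).trans ((rootMultiplicity_pos hp).2 (h β hβ))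
    · rw [rootMultiplicity_eq_zero hβ]
      exact Nat.zero_le _
  rw [(IsAlgClosed.splits G).eq_prod_roots_of_monic hG]
  exact (Multiset.prod_X_sub_C_dvd_iff_le_roots hp _).2 hle

lemma derivative_eval_eq_zero_of_two_le {D : K[X]} {β : K} (h : (X - C β) ^ 2 ∣ D) :
    D.eval β = 0 ∧ D.derivative.eval β = 0 := by
  obtain ⟨E, rfl⟩ := h
  constructor <;> simp [derivative_mul, derivative_X_sub_C_pow]

lemma sq_dvd_of_eval_eq_zero_of_even {D : K[X]} (h : ∀ β, Even (D.rootMultiplicity β)) {β : K}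
    (hβ : D.eval β = 0) : (X - C β) ^ 2 ∣ D := by
  rcases eq_or_ne D 0 with rfl | hD
  · exact dvd_zero _
  rw [← le_rootMultiplicity_iff hD]
  have h1 := (rootMultiplicity_pos hD).2 hβ
  have h2 := (h β).two_dvd
  omega

/-- The two covariants of the cubic `X³ + A X² + B X + C` which vanish on cubes. -/
lemma neg_mul_cubicDisc {R : Type*} [CommRing R] (A B C : R) :
    -27 * cubicDisc A B C =
      (2 * A ^ 3 - 9 * A * B + 27 * C) ^ 2 + 4 * (3 * B - A ^ 2) ^ 3 := by
  rw [cubicDisc]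
  ring

/-- If all roots of the discriminant of a transversal family of cubics have even multiplicity,
the multiplicities are exactly two. -/
lemma rootMultiplicity_le_one_of_cubicDisc_eq (h3 : (3 : K) ≠ 0) {A B C G : K[X]} {l : K}
    (hG : cubicDisc A B C = Polynomial.C l * G ^ 2) (hG0 : G ≠ 0) {β t : K}
    (hA : A.eval β = -(3 * t)) (hB : B.eval β = 3 * t ^ 2)
    (htr : t ^ 2 * A.derivative.eval β + t * B.derivative.eval β + C.derivative.eval β ≠ 0) :
    G.rootMultiplicity β ≤ 1 := by
  by_contra hlt
  have hdvd : (X - Polynomial.C β) ^ 2 ∣ G := (le_rootMultiplicity_iff hG0).1 (by omega)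
  have hp : (X - Polynomial.C β) ∣ 3 * B - A ^ 2 := by
    have h3 : (3 : K[X]) = Polynomial.C 3 := rfl
    rw [dvd_iff_isRoot, IsRoot.def, h3]
    simp only [eval_sub, eval_mul, eval_pow, eval_C, hA, hB]
    ring
  obtain ⟨r, hr⟩ : ∃ r, r = 2 * A ^ 3 - 9 * A * B + 27 * C := ⟨_, rfl⟩
  have hr2 : (X - Polynomial.C β) ^ 3 ∣ r ^ 2 := by
    have h1 : r ^ 2 = -27 * (Polynomial.C l * G ^ 2) - 4 * (3 * B - A ^ 2) ^ 3 := by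
      rw [← hG, neg_mul_cubicDisc, hr]
      ring
    rw [h1]
    refine dvd_sub (Dvd.dvd.mul_left (Dvd.dvd.mul_left ?_ _) _)
      (Dvd.dvd.mul_left (pow_dvd_pow_of_dvd hp 3) _)
    refine (pow_dvd_pow _ (by norm_num : 3 ≤ 4)).trans ?_
    have := pow_dvd_pow_of_dvd hdvd 2
    rwa [← pow_mul] at this
  have hrr : (X - Polynomial.C β) ^ 2 ∣ r := by
    rcases eq_or_ne r 0 with h0 | h0
    · rw [h0]
      exact dvd_zero _
    · rw [← le_rootMultiplicity_iff (pow_ne_zero 2 h0), sq,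
        rootMultiplicity_mul (mul_ne_zero h0 h0)] at hr2
      exact (le_rootMultiplicity_iff h0).1 (by omega)
  have h1 := (derivative_eval_eq_zero_of_two_le hrr).2
  have h2 : (2 : K[X]) = Polynomial.C 2 := rfl
  have h9 : (9 : K[X]) = Polynomial.C 9 := rfl
  have h27 : (27 : K[X]) = Polynomial.C 27 := rfl
  rw [hr] at h1
  simp only [h2, h9, h27, derivative_add, derivative_sub, derivative_mul,
    derivative_pow, derivative_C, eval_add, eval_sub, eval_mul, eval_pow, eval_C, hA, hB,
    eval_zero] at h1
  push_cast at h1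
  have h4 : (3 : K) ^ 3 * (t ^ 2 * A.derivative.eval β + t * B.derivative.eval β +
      C.derivative.eval β) = 0 := by
    linear_combination h1
  exact htr ((mul_eq_zero.1 h4).resolve_left (pow_ne_zero 3 h3))
end CubicDisc

section OddRoots
open Polynomial

/-- The discriminant of the cubic cut out on `y² = x³ + a₂ x² + a₄ x + a₆` by the line of slope `X`
through `(0, y₀)`. -/
noncomputable def slopeDisc {R : Type*} [CommRing R] (a₂ a₄ a₆ y₀ : R) : R[X] :=
  cubicDisc (C a₂ - X ^ 2) (C a₄ - C (2 * y₀) * X) (C (a₆ - y₀ ^ 2))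

/-- The discriminant of the cubic cut out on `y² = x³ + a₂ x² + a₄ x + a₆` by the line of slope `b`
and intercept `X`. -/
noncomputable def interceptDisc {R : Type*} [CommRing R] (a₂ a₄ a₆ b : R) : R[X] :=
  cubicDisc (C (a₂ - b ^ 2)) (C a₄ - C (2 * b) * X) (C a₆ - X ^ 2)

lemma exists_slopeDisc_eq {R : Type*} [CommRing R] (a₂ a₄ a₆ y₀ : R) :
    ∃ E : R[X], E.natDegree ≤ 4 ∧
      slopeDisc a₂ a₄ a₆ y₀ = C (4 * a₆) * X ^ 6 + C (-4 * a₄ * y₀) * X ^ 5 + E := by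
  obtain ⟨c, hc⟩ : ∃ c, c = a₆ - y₀ ^ 2 := ⟨_, rfl⟩
  refine ⟨C (a₄ ^ 2 - 8 * a₂ * y₀ ^ 2 - 12 * c * a₂) * X ^ 4 +
    C (8 * a₂ * a₄ * y₀ + 32 * y₀ ^ 3 + 36 * c * y₀) * X ^ 3 +
    C (4 * a₂ ^ 2 * y₀ ^ 2 - 2 * a₂ * a₄ ^ 2 - 48 * a₄ * y₀ ^ 2 + 12 * c * a₂ ^ 2
      - 18 * c * a₄) * X ^ 2 +
    C (24 * a₄ ^ 2 * y₀ - 4 * a₂ ^ 2 * a₄ * y₀ - 36 * c * a₂ * y₀) * X +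
    C (a₂ ^ 2 * a₄ ^ 2 - 4 * a₄ ^ 3 - 4 * c * a₂ ^ 3 - 27 * c ^ 2 + 18 * c * a₂ * a₄),
    by compute_degree, ?_⟩
  have ha : a₆ = c + y₀ ^ 2 := by rw [hc]; ring
  rw [slopeDisc, ← hc, cubicDisc, ha]
  simp only [map_add, map_sub, map_mul, map_pow, map_neg, map_ofNat]
  ring

lemma exists_interceptDisc_eq {R : Type*} [CommRing R] (a₂ a₄ a₆ b : R) :
    ∃ E : R[X], E.natDegree ≤ 2 ∧
      interceptDisc a₂ a₄ a₆ b =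
        C (-27) * X ^ 4 + C (32 * b ^ 3 + 36 * (a₂ - b ^ 2) * b) * X ^ 3 + E := by
  obtain ⟨c, hc⟩ : ∃ c, c = a₂ - b ^ 2 := ⟨_, rfl⟩
  refine ⟨C (4 * c ^ 2 * b ^ 2 - 48 * a₄ * b ^ 2 + 4 * c ^ 3 + 54 * a₆ - 18 * c * a₄) * X ^ 2 +
    C (24 * a₄ ^ 2 * b - 4 * c ^ 2 * a₄ * b - 36 * c * a₆ * b) * X +
    C (c ^ 2 * a₄ ^ 2 - 4 * a₄ ^ 3 - 4 * c ^ 3 * a₆ - 27 * a₆ ^ 2 + 18 * c * a₄ * a₆),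
    by compute_degree, ?_⟩
  rw [interceptDisc, ← hc, cubicDisc]
  simp only [map_add, map_sub, map_mul, map_pow, map_neg, map_ofNat]
  ring

lemma coeff_slopeDisc {R : Type*} [CommRing R] (a₂ a₄ a₆ y₀ : R) :
    (slopeDisc a₂ a₄ a₆ y₀).natDegree ≤ 6 ∧
    (slopeDisc a₂ a₄ a₆ y₀).coeff 6 = 4 * a₆ ∧
    (slopeDisc a₂ a₄ a₆ y₀).coeff 5 = -4 * a₄ * y₀ := by
  obtain ⟨E, hE, h⟩ := exists_slopeDisc_eq a₂ a₄ a₆ y₀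
  rw [h]
  refine ⟨?_, ?_, ?_⟩
  · have : E.natDegree ≤ 6 := hE.trans (by norm_num)
    compute_degree
    exact max_le le_rfl this
  · rw [coeff_add, coeff_add, coeff_C_mul_X_pow, coeff_C_mul_X_pow,
      coeff_eq_zero_of_natDegree_lt (lt_of_le_of_lt hE (by norm_num : 4 < 6))]
    norm_num
  · rw [coeff_add, coeff_add, coeff_C_mul_X_pow, coeff_C_mul_X_pow,
      coeff_eq_zero_of_natDegree_lt (lt_of_le_of_lt hE (by norm_num : 4 < 5))]
    norm_num

lemma coeff_interceptDisc {R : Type*} [CommRing R] (a₂ a₄ a₆ b : R) :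
    (interceptDisc a₂ a₄ a₆ b).natDegree ≤ 4 ∧
    (interceptDisc a₂ a₄ a₆ b).coeff 4 = -27 ∧
    (interceptDisc a₂ a₄ a₆ b).coeff 3 = 32 * b ^ 3 + 36 * (a₂ - b ^ 2) * b := by
  obtain ⟨E, hE, h⟩ := exists_interceptDisc_eq a₂ a₄ a₆ b
  rw [h]
  refine ⟨?_, ?_, ?_⟩
  · have : E.natDegree ≤ 4 := hE.trans (by norm_num)
    compute_degree
    exact max_le le_rfl this
  · rw [coeff_add, coeff_add, coeff_C_mul_X_pow, coeff_C_mul_X_pow,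
      coeff_eq_zero_of_natDegree_lt (lt_of_le_of_lt hE (by norm_num : 2 < 4))]
    norm_num
  · rw [coeff_add, coeff_add, coeff_C_mul_X_pow, coeff_C_mul_X_pow,
      coeff_eq_zero_of_natDegree_lt (lt_of_le_of_lt hE (by norm_num : 2 < 3))]
    norm_num

variable {K : Type*} [Field K]

/-- A line meeting a smooth cubic `y² = f(x)` doubly over `t` does not meet it on the `x`-axis. -/
lemma add_mul_ne_zero_of_double_root {a₂ a₄ a₆ b y₀ t s : K} (hf : cubicDisc a₂ a₄ a₆ ≠ 0)
    (hA : a₂ - b ^ 2 = -(2 * t + s)) (hB : a₄ - 2 * y₀ * b = t ^ 2 + 2 * t * s)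
    (hC : a₆ - y₀ ^ 2 = -(t ^ 2 * s)) : y₀ + b * t ≠ 0 := by
  intro h
  have hy : y₀ = -(b * t) := by linear_combination h
  have h2 : a₂ = b ^ 2 - 2 * t - s := by linear_combination hA
  have h4 : a₄ = -2 * b ^ 2 * t + t ^ 2 + 2 * t * s := by
    rw [hy] at hB
    linear_combination hB
  have h6 : a₆ = b ^ 2 * t ^ 2 - t ^ 2 * s := by
    rw [hy] at hC
    linear_combination hC
  refine hf ?_
  rw [h2, h4, h6, cubicDisc]
  ring

variable [IsAlgClosed K] {a₂ a₄ a₆ : K}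

lemma slopeDisc_root (h2 : (2 : K) ≠ 0) (hf : cubicDisc a₂ a₄ a₆ ≠ 0) {y₀ : K}
    (hy : a₆ ≠ y₀ ^ 2) (hev : ∀ β, Even ((slopeDisc a₂ a₄ a₆ y₀).rootMultiplicity β)) {β : K}
    (hβ : (slopeDisc a₂ a₄ a₆ y₀).eval β = 0) :
    ∃ t, a₂ - β ^ 2 = -(3 * t) ∧ a₄ - 2 * y₀ * β = 3 * t ^ 2 ∧ a₆ - y₀ ^ 2 = -t ^ 3 ∧
      t ^ 2 * (derivative (C a₂ - X ^ 2 : K[X])).eval β +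
        t * (derivative (C a₄ - C (2 * y₀) * X : K[X])).eval β +
        (derivative (C (a₆ - y₀ ^ 2) : K[X])).eval β ≠ 0 := by
  have h1 := derivative_eval_eq_zero_of_two_le (sq_dvd_of_eval_eq_zero_of_even hev hβ)
  have := exists_triple_root h2 h1.1 h1.2 ?_
  · simpa only [eval_sub, eval_mul, eval_pow, eval_C, eval_X] using this
  · intro t s hA hB hC
    simp only [eval_sub, eval_mul, eval_pow, eval_C, eval_X] at hA hB hC
    have hy1 := add_mul_ne_zero_of_double_root hf hA hB hC
    have ht : t ≠ 0 := by
      rintro rfl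
      exact hy (by linear_combination hC)
    have e : t ^ 2 * (derivative (C a₂ - X ^ 2 : K[X])).eval β +
        t * (derivative (C a₄ - C (2 * y₀) * X : K[X])).eval β +
        (derivative (C (a₆ - y₀ ^ 2) : K[X])).eval β = -(2 * t * (y₀ + β * t)) := by
      simp only [derivative_sub, derivative_C, derivative_X_pow, derivative_mul, derivative_X,
        eval_sub, eval_add, eval_mul, eval_zero, eval_C, eval_pow, eval_X, eval_one]
      push_cast
      ring
    rw [e]
    exact neg_ne_zero.2 (mul_ne_zero (mul_ne_zero h2 ht) hy1)

lemma interceptDisc_root (h2 : (2 : K) ≠ 0) (hf : cubicDisc a₂ a₄ a₆ ≠ 0) {b : K}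
    (hev : ∀ β, Even ((interceptDisc a₂ a₄ a₆ b).rootMultiplicity β)) {β : K}
    (hβ : (interceptDisc a₂ a₄ a₆ b).eval β = 0) :
    ∃ t, a₂ - b ^ 2 = -(3 * t) ∧ a₄ - 2 * b * β = 3 * t ^ 2 ∧ a₆ - β ^ 2 = -t ^ 3 ∧
      t ^ 2 * (derivative (C (a₂ - b ^ 2) : K[X])).eval β +
        t * (derivative (C a₄ - C (2 * b) * X : K[X])).eval β +
        (derivative (C a₆ - X ^ 2 : K[X])).eval β ≠ 0 := by
  have h1 := derivative_eval_eq_zero_of_two_le (sq_dvd_of_eval_eq_zero_of_even hev hβ)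
  have := exists_triple_root h2 h1.1 h1.2 ?_
  · simpa only [eval_sub, eval_mul, eval_pow, eval_C, eval_X] using this
  · intro t s hA hB hC
    simp only [eval_sub, eval_mul, eval_pow, eval_C, eval_X] at hA hB hC
    have hy1 := add_mul_ne_zero_of_double_root (b := b) (y₀ := β) hf hA
      (by linear_combination hB) hC
    have e : t ^ 2 * (derivative (C (a₂ - b ^ 2) : K[X])).eval β +
        t * (derivative (C a₄ - C (2 * b) * X : K[X])).eval β +
        (derivative (C a₆ - X ^ 2 : K[X])).eval β = -(2 * (β + b * t)) := by
      simp only [derivative_sub, derivative_C, derivative_X_pow, derivative_mul, derivative_X,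
        eval_sub, eval_add, eval_mul, eval_zero, eval_C, eval_pow, eval_X, eval_one]
      push_cast
      ring
    rw [e]
    exact neg_ne_zero.2 (mul_ne_zero h2 hy1)

end OddRoots

section OddRoots
open Polynomial
variable {K : Type*} [Field K]

lemma coeffs_eq_zero_of_quartic {e₄ e₃ e₂ e₁ e₀ : K}
    (h : C e₄ * X ^ 4 + C e₃ * X ^ 3 + C e₂ * X ^ 2 + C e₁ * X + C e₀ = 0) :
    e₄ = 0 ∧ e₃ = 0 ∧ e₀ = 0 := by
  refine ⟨?_, ?_, ?_⟩
  · simpa [coeff_X, coeff_X_pow, coeff_C] using congrArg (fun p => coeff p 4) h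
  · simpa [coeff_X, coeff_X_pow, coeff_C] using congrArg (fun p => coeff p 3) h
  · simpa [coeff_X, coeff_X_pow, coeff_C] using congrArg (fun p => coeff p 0) h

lemma eq_of_mul_dvd_covariants {a₂ a₄ a₆ y₀ : K} (h2 : (2 : K) ≠ 0) (h3 : (3 : K) ≠ 0)
    (h6 : a₆ ≠ 0) {G : K[X]} (hGm : G.Monic) (hG3 : G.natDegree = 3)
    (hG : slopeDisc a₂ a₄ a₆ y₀ = C (4 * a₆) * G ^ 2)
    (hp : G ∣ 3 * (C a₄ - C (2 * y₀) * X) - (C a₂ - X ^ 2) ^ 2)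
    (hr : G ∣ 2 * (C a₂ - X ^ 2) ^ 3 - 9 * (C a₂ - X ^ 2) * (C a₄ - C (2 * y₀) * X) +
      27 * C (a₆ - y₀ ^ 2)) : a₂ ^ 2 = 3 * a₄ := by
  obtain ⟨m, hm⟩ := hp
  obtain ⟨h, hh⟩ := hr
  have hpe : 3 * (C a₄ - C (2 * y₀) * X) - (C a₂ - X ^ 2) ^ 2 =
      C (-1) * X ^ 4 + C (2 * a₂) * X ^ 2 + C (-6 * y₀) * X + C (3 * a₄ - a₂ ^ 2) := by
    simp only [map_sub, map_mul, map_pow, map_neg, map_ofNat, map_one]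
    ring
  have hpdeg : (C (-1) * X ^ 4 + C (2 * a₂) * X ^ 2 + C (-6 * y₀) * X +
      C (3 * a₄ - a₂ ^ 2)).natDegree = 4 := by
    compute_degree!
  have hm0 : m ≠ 0 := by
    rintro rfl
    rw [← hpe, hm, mul_zero, natDegree_zero] at hpdeg
    exact absurd hpdeg (by norm_num)
  have hm1 : m.natDegree = 1 := by
    have := hGm.natDegree_mul' hm0
    rw [← hm, hpe, hpdeg, hG3] at this
    omega
  have hmc : m.coeff 1 = -1 := by
    have h1 : (G * m).coeff (3 + 1) = G.coeff 3 * m.coeff 1 :=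
      coeff_mul_add_eq_of_natDegree_le hG3.le hm1.le
    rw [← hm, hpe, ← hG3, coeff_natDegree, hGm.leadingCoeff, one_mul] at h1
    rw [← h1, hG3]
    simp only [coeff_add, coeff_C_mul, coeff_X_pow, coeff_X, coeff_C]
    norm_num
  obtain ⟨l, hl⟩ : ∃ l, l = m.coeff 0 := ⟨_, rfl⟩
  have hme : m = -(X - C l) := by
    rw [eq_X_add_C_of_natDegree_le_one hm1.le, hmc, ← hl]
    simp only [map_neg, map_one]
    ring
  have hG0 : G ≠ 0 := hGm.ne_zero
  have hid : h ^ 2 = 4 * G * (X - C l) ^ 3 - C (108 * a₆) := by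
    have h1 := neg_mul_cubicDisc (C a₂ - X ^ 2) (C a₄ - C (2 * y₀) * X) (C (a₆ - y₀ ^ 2))
    rw [hm, hh, hme] at h1
    rw [slopeDisc] at hG
    rw [hG] at h1
    refine mul_left_cancel₀ (pow_ne_zero 2 hG0) ?_
    simp only [map_mul, map_ofNat] at h1 ⊢
    linear_combination -h1
  obtain ⟨w, hw⟩ : ∃ w, w = h.eval l := ⟨_, rfl⟩
  have hw2 : w ^ 2 = -(108 * a₆) := by
    have := congrArg (eval l) hid
    simpa [← hw] using this
  have hw0 : w ≠ 0 := by
    rintro rfl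
    have : (2 : K) ^ 2 * 3 ^ 3 * a₆ = 0 := by linear_combination hw2
    exact mul_ne_zero (mul_ne_zero (pow_ne_zero 2 h2) (pow_ne_zero 3 h3)) h6 this
  have hfac : (h - C w) * (h + C w) = 4 * G * (X - C l) ^ 3 := by
    have hCw : C w ^ 2 = -C (108 * a₆) := by rw [← map_pow, hw2, map_neg]
    linear_combination hid - hCw
  have hcop : IsCoprime ((X - C l) ^ 3) (h + C w) := by
    refine IsCoprime.pow_left ?_
    rw [(irreducible_X_sub_C l).coprime_iff_not_dvd, dvd_iff_isRoot, IsRoot.def, eval_add, eval_C,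
      ← hw, ← two_mul]
    exact mul_ne_zero h2 hw0
  obtain ⟨k, hk⟩ : (X - C l) ^ 3 ∣ h - C w :=
    hcop.dvd_of_dvd_mul_right (by rw [hfac]; exact dvd_mul_left _ _)
  have hdegh : h.natDegree ≤ 3 := by
    rcases eq_or_ne h 0 with rfl | hne
    · simp
    have h1 := hGm.natDegree_mul' hne
    rw [← hh, hG3] at h1
    have h2 : (2 * (C a₂ - X ^ 2) ^ 3 - 9 * (C a₂ - X ^ 2) * (C a₄ - C (2 * y₀) * X) +
      27 * C (a₆ - y₀ ^ 2)).natDegree ≤ 6 := by compute_degree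
    omega
  obtain ⟨κ, hκ⟩ : ∃ κ, k = C κ := by
    rcases eq_or_ne k 0 with rfl | hne
    · exact ⟨0, by simp⟩
    refine ⟨k.coeff 0, eq_C_of_natDegree_eq_zero ?_⟩
    have h1 := ((monic_X_sub_C l).pow 3).natDegree_mul' hne
    rw [← hk, natDegree_pow, natDegree_X_sub_C] at h1
    have h2 : (h - C w).natDegree ≤ 3 := by
      rw [natDegree_sub_C]
      exact hdegh
    omega
  have hG4 : C κ * (C κ * (X - C l) ^ 3 + 2 * C w) = 4 * G := by
    refine mul_left_cancel₀ (pow_ne_zero 3 (X_sub_C_ne_zero l)) ?_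
    have e : h + C w = (X - C l) ^ 3 * C κ + 2 * C w := by
      rw [hκ] at hk
      linear_combination hk
    rw [hk, e, hκ] at hfac
    linear_combination hfac
  have hquart : C (κ ^ 2 - 4) * X ^ 4 + C (-4 * κ ^ 2 * l) * X ^ 3 +
      C (8 * a₂ + 6 * κ ^ 2 * l ^ 2) * X ^ 2 +
      C (-24 * y₀ - 4 * κ ^ 2 * l ^ 3 + 2 * κ * w) * X +
      C (4 * (3 * a₄ - a₂ ^ 2) + κ ^ 2 * l ^ 4 - 2 * κ * w * l) = 0 := by
    rw [hme] at hm
    simp only [map_add, map_sub, map_mul, map_pow, map_neg, map_ofNat] at hm ⊢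
    linear_combination 4 * hm + (X - C l) * hG4
  obtain ⟨e4, e3, e0⟩ := coeffs_eq_zero_of_quartic hquart
  have hl0 : l = 0 := by
    have : (2 : K) ^ 4 * l = 0 := by linear_combination -e3 - 4 * l * e4
    exact (mul_eq_zero.1 this).resolve_left (pow_ne_zero 4 h2)
  rw [hl0] at e0
  have h4 : (2 : K) ^ 2 * (3 * a₄ - a₂ ^ 2) = 0 := by linear_combination e0
  have := (mul_eq_zero.1 h4).resolve_left (pow_ne_zero 2 h2)
  linear_combination -this

variable [IsAlgClosed K] {a₂ a₄ a₆ : K}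

theorem exists_odd_rootMultiplicity_slopeDisc (h2 : (2 : K) ≠ 0) (hf : cubicDisc a₂ a₄ a₆ ≠ 0)
    (hj : a₂ ^ 2 ≠ 3 * a₄) {y₀ : K} (hy : a₆ ≠ y₀ ^ 2) :
    ∃ β, Odd ((slopeDisc a₂ a₄ a₆ y₀).rootMultiplicity β) := by
  by_contra hcon
  push Not at hcon
  have hev : ∀ β, Even ((slopeDisc a₂ a₄ a₆ y₀).rootMultiplicity β) := fun β =>
    Nat.not_odd_iff_even.1 (hcon β)
  obtain ⟨G, hGm, hG⟩ := exists_eq_C_mul_sq hev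
  obtain ⟨hdeg, hc6, hc5⟩ := coeff_slopeDisc a₂ a₄ a₆ y₀
  have h4 : (4 : K) ≠ 0 := by
    have : (4 : K) = 2 * 2 := by norm_num
    rw [this]
    exact mul_ne_zero h2 h2
  by_cases h6 : a₆ = 0
  · have ha4 : a₄ ≠ 0 := by
      rintro rfl
      exact hf (by rw [h6, cubicDisc]; ring)
    have hy0 : y₀ ≠ 0 := by
      rintro rfl
      exact hy (by rw [h6]; ring)
    have hc5' : (slopeDisc a₂ a₄ a₆ y₀).coeff 5 ≠ 0 := by
      rw [hc5]
      exact mul_ne_zero (mul_ne_zero (neg_ne_zero.2 h4) ha4) hy0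
    have hd5 : (slopeDisc a₂ a₄ a₆ y₀).natDegree = 5 := by
      refine le_antisymm ?_ (le_natDegree_of_ne_zero hc5')
      rw [natDegree_le_iff_coeff_eq_zero]
      intro N hN
      rcases Nat.lt_or_ge 6 N with h | h
      · exact coeff_eq_zero_of_natDegree_lt (lt_of_le_of_lt hdeg h)
      · rw [show N = 6 by omega, hc6, h6, mul_zero]
    have hlc : (slopeDisc a₂ a₄ a₆ y₀).leadingCoeff ≠ 0 := by
      rwa [leadingCoeff, hd5]
    rw [hG, natDegree_C_mul hlc, natDegree_pow] at hd5
    omega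
  have hc6' : (slopeDisc a₂ a₄ a₆ y₀).coeff 6 ≠ 0 := by
    rw [hc6]
    exact mul_ne_zero h4 h6
  have hd6 : (slopeDisc a₂ a₄ a₆ y₀).natDegree = 6 :=
    le_antisymm hdeg (le_natDegree_of_ne_zero hc6')
  have hlc : (slopeDisc a₂ a₄ a₆ y₀).leadingCoeff = 4 * a₆ := by rw [leadingCoeff, hd6, hc6]
  rw [hlc] at hG
  have hG3 : G.natDegree = 3 := by
    rw [hG, natDegree_C_mul (mul_ne_zero h4 h6), natDegree_pow] at hd6
    omega
  have hroot : ∀ β, G.eval β = 0 → (slopeDisc a₂ a₄ a₆ y₀).eval β = 0 := by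
    intro β hβ
    rw [hG, eval_mul, eval_pow, hβ]
    ring
  by_cases h3 : (3 : K) = 0
  · have hroot' : ∀ β, (slopeDisc a₂ a₄ a₆ y₀).eval β = 0 → a₂ = β ^ 2 ∧ a₄ = 2 * y₀ * β := by
      intro β hβ
      obtain ⟨t, hA, hB, -⟩ := slopeDisc_root h2 hf hy hev hβ
      exact ⟨by linear_combination hA - t * h3, by linear_combination hB + t ^ 2 * h3⟩
    have ha2 : a₂ ≠ 0 := by
      rintro rfl
      exact hj (by rw [h3]; ring)
    obtain ⟨β, hβ⟩ : ∃ β, G.eval β = 0 := by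
      refine IsAlgClosed.exists_root G ?_
      rw [degree_eq_natDegree hGm.ne_zero, hG3]
      norm_num
    obtain ⟨hβ2, hβ4⟩ := hroot' β (hroot β hβ)
    have hβ0 : β ≠ 0 := by
      rintro rfl
      exact ha2 (by rw [hβ2]; ring)
    by_cases hy0 : y₀ = 0
    · have ha4 : a₄ = 0 := by rw [hβ4, hy0]; ring
      have hD : slopeDisc a₂ a₄ a₆ y₀ = C (4 * a₆) * (X + C β) ^ 3 * (X - C β) ^ 3 := by
        have h3' : (3 : K[X]) = 0 := by
          rw [show (3 : K[X]) = C 3 from rfl, h3, C_0]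
        rw [slopeDisc, cubicDisc, ha4, hy0, hβ2]
        simp only [map_mul, map_sub, map_pow, map_zero, map_ofNat]
        linear_combination (-9 * C a₆ ^ 2) * h3'
      refine hcon β ?_
      have hne : C (4 * a₆) * (X + C β) ^ 3 ≠ 0 :=
        mul_ne_zero (C_ne_zero.2 (mul_ne_zero h4 h6)) (pow_ne_zero 3 (X_add_C_ne_zero β))
      rw [hD, rootMultiplicity_mul_X_sub_C_pow hne, rootMultiplicity_eq_zero]
      · decide
      · simp only [IsRoot.def, eval_mul, eval_C, eval_pow, eval_add, eval_X, ← two_mul]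
        exact mul_ne_zero (mul_ne_zero h4 h6) (pow_ne_zero 3 (mul_ne_zero h2 hβ0))
    · have huniq : ∀ γ ∈ G.roots, γ = β := by
        intro γ hγ
        have h1 := (hroot' γ (hroot γ ((mem_roots hGm.ne_zero).1 hγ))).2
        exact mul_left_cancel₀ (mul_ne_zero h2 hy0) (h1.symm.trans hβ4)
      have hGe : G = (X - C β) ^ 3 := by
        have h1 := (IsAlgClosed.splits G).eq_prod_roots_of_monic hGm
        have h3 : G.roots = Multiset.replicate 3 β := by
          rw [Multiset.eq_replicate]
          exact ⟨by rw [← (IsAlgClosed.splits G).natDegree_eq_card_roots, hG3], huniq⟩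
        rw [h1, h3]
        simp only [Multiset.map_replicate, Multiset.prod_replicate]
      have h1 : (slopeDisc a₂ a₄ a₆ y₀).coeff 5 = -24 * a₆ * β := by
        rw [hG, hGe, ← pow_mul, coeff_C_mul, sub_eq_add_neg, ← C_neg, coeff_X_add_C_pow]
        norm_num
        ring
      rw [hc5] at h1
      have h5 : (2 : K) ^ 3 * y₀ ^ 2 * β = 0 := by
        rw [hβ4] at h1
        linear_combination -h1 + 8 * a₆ * β * h3
      exact mul_ne_zero (mul_ne_zero (pow_ne_zero 3 h2) (pow_ne_zero 2 hy0)) hβ0 h5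
  · have hmult : ∀ β, G.eval β = 0 → G.rootMultiplicity β ≤ 1 := by
      intro β hβ
      obtain ⟨t, hA, hB, -, htr⟩ := slopeDisc_root h2 hf hy hev (hroot β hβ)
      exact rootMultiplicity_le_one_of_cubicDisc_eq h3 hG hGm.ne_zero
        (by simpa using hA) (by simpa using hB) htr
    refine hj (eq_of_mul_dvd_covariants h2 h3 h6 hGm hG3 hG ?_ ?_)
    · refine dvd_of_forall_root hGm hmult fun β hβ => ?_
      obtain ⟨t, hA, hB, -⟩ := slopeDisc_root h2 hf hy hev (hroot β hβ)
      rw [show (3 : K[X]) = C 3 from rfl]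
      simp only [eval_sub, eval_mul, eval_pow, eval_C, eval_X, hA, hB]
      ring
    · refine dvd_of_forall_root hGm hmult fun β hβ => ?_
      obtain ⟨t, hA, hB, hC, -⟩ := slopeDisc_root h2 hf hy hev (hroot β hβ)
      rw [show (2 : K[X]) = C 2 from rfl, show (9 : K[X]) = C 9 from rfl,
        show (27 : K[X]) = C 27 from rfl]
      simp only [eval_add, eval_sub, eval_mul, eval_pow, eval_C, eval_X, hA, hB, hC]
      ring

theorem exists_odd_rootMultiplicity_interceptDisc (h2 : (2 : K) ≠ 0)
    (hf : cubicDisc a₂ a₄ a₆ ≠ 0) (hj : a₂ ^ 2 ≠ 3 * a₄) (b : K) :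
    ∃ β, Odd ((interceptDisc a₂ a₄ a₆ b).rootMultiplicity β) := by
  by_contra hcon
  push Not at hcon
  have hev : ∀ β, Even ((interceptDisc a₂ a₄ a₆ b).rootMultiplicity β) := fun β =>
    Nat.not_odd_iff_even.1 (hcon β)
  obtain ⟨G, hGm, hG⟩ := exists_eq_C_mul_sq hev
  obtain ⟨hdeg, hc4, hc3⟩ := coeff_interceptDisc a₂ a₄ a₆ b
  by_cases h3 : (3 : K) = 0
  · have ha2 : a₂ ≠ 0 := by
      rintro rfl
      exact hj (by rw [h3]; ring)
    by_cases hb : b = 0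
    · have hD : interceptDisc a₂ a₄ a₆ b = C (4 * a₂ ^ 3) * X ^ 2 + C (cubicDisc a₂ a₄ a₆) := by
        have h3' : (3 : K[X]) = 0 := by
          rw [show (3 : K[X]) = C 3 from rfl, h3, C_0]
        rw [interceptDisc, hb, map_cubicDisc, cubicDisc, cubicDisc]
        simp only [map_mul, map_sub, map_pow, map_zero, map_ofNat]
        linear_combination (-9 * X ^ 4 + 18 * C a₆ * X ^ 2 - 6 * C a₂ * C a₄ * X ^ 2) * h3'
      have hne : 4 * a₂ ^ 3 ≠ 0 := by
        have : (4 : K) = 2 * 2 := by norm_num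
        rw [this]
        exact mul_ne_zero (mul_ne_zero h2 h2) (pow_ne_zero 3 ha2)
      obtain ⟨β, hβ⟩ : ∃ β, (interceptDisc a₂ a₄ a₆ b).eval β = 0 := by
        refine IsAlgClosed.exists_root _ ?_
        rw [hD, show degree _ = (2 : ℕ) by
          compute_degree!
          exact not_or.1 fun h => hne (by rcases h with h | h <;> rw [h] <;> ring)]
        norm_num
      have h1 := (derivative_eval_eq_zero_of_two_le (sq_dvd_of_eval_eq_zero_of_even hev hβ)).2
      rw [hD] at h1 hβ
      simp only [derivative_add, derivative_C_mul_X_pow, derivative_C, eval_add, eval_mul, eval_C,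
        eval_pow, eval_X, eval_zero] at h1 hβ
      have hβ0 : β = 0 := by
        have h5 : 4 * a₂ ^ 3 * 2 * β = 0 := by
          push_cast at h1
          linear_combination h1
        exact (mul_eq_zero.1 h5).resolve_left (mul_ne_zero hne h2)
      refine hf ?_
      rw [hβ0] at hβ
      linear_combination hβ
    · have hc3' : (interceptDisc a₂ a₄ a₆ b).coeff 3 ≠ 0 := by
        rw [hc3]
        have : 32 * b ^ 3 + 36 * (a₂ - b ^ 2) * b = 2 ^ 5 * b ^ 3 := by
          linear_combination 12 * (a₂ - b ^ 2) * b * h3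
        rw [this]
        exact mul_ne_zero (pow_ne_zero 5 h2) (pow_ne_zero 3 hb)
      have hd3 : (interceptDisc a₂ a₄ a₆ b).natDegree = 3 := by
        refine le_antisymm ?_ (le_natDegree_of_ne_zero hc3')
        rw [natDegree_le_iff_coeff_eq_zero]
        intro N hN
        rcases Nat.lt_or_ge 4 N with h | h
        · exact coeff_eq_zero_of_natDegree_lt (lt_of_le_of_lt hdeg h)
        · rw [show N = 4 by omega, hc4]
          linear_combination -9 * h3
      have hlc : (interceptDisc a₂ a₄ a₆ b).leadingCoeff ≠ 0 := by
        rwa [leadingCoeff, hd3]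
      rw [hG, natDegree_C_mul hlc, natDegree_pow] at hd3
      omega
  · have hc4' : (interceptDisc a₂ a₄ a₆ b).coeff 4 ≠ 0 := by
      rw [hc4, show (-27 : K) = -3 ^ 3 by norm_num]
      exact neg_ne_zero.2 (pow_ne_zero 3 h3)
    have hd4 : (interceptDisc a₂ a₄ a₆ b).natDegree = 4 :=
      le_antisymm hdeg (le_natDegree_of_ne_zero hc4')
    have hlc : (interceptDisc a₂ a₄ a₆ b).leadingCoeff ≠ 0 := by rwa [leadingCoeff, hd4]
    have hG2 : G.natDegree = 2 := by
      rw [hG, natDegree_C_mul hlc, natDegree_pow] at hd4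
      omega
    have hroot : ∀ β, G.eval β = 0 → (interceptDisc a₂ a₄ a₆ b).eval β = 0 := by
      intro β hβ
      rw [hG, eval_mul, eval_pow, hβ]
      ring
    have hmult : ∀ β, G.eval β = 0 → G.rootMultiplicity β ≤ 1 := by
      intro β hβ
      obtain ⟨t, hA, hB, -, htr⟩ := interceptDisc_root h2 hf hev (hroot β hβ)
      exact rootMultiplicity_le_one_of_cubicDisc_eq h3 hG hGm.ne_zero
        (by simpa using hA) (by simpa using hB) htr
    have hdvd : G ∣ C (-6 * b) * X + C (3 * a₄ - (a₂ - b ^ 2) ^ 2) := by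
      refine dvd_of_forall_root hGm hmult fun β hβ => ?_
      obtain ⟨t, hA, hB, -⟩ := interceptDisc_root h2 hf hev (hroot β hβ)
      simp only [eval_add, eval_mul, eval_C, eval_X, hA]
      linear_combination 3 * hB
    have h0 : C (-6 * b) * X + C (3 * a₄ - (a₂ - b ^ 2) ^ 2) = 0 := by
      by_contra hne
      have h1 := natDegree_le_of_dvd hdvd hne
      have h5 : (C (-6 * b) * X + C (3 * a₄ - (a₂ - b ^ 2) ^ 2)).natDegree ≤ 1 := by
        compute_degree
      omega
    have hb6 : -6 * b = 0 := by
      have := congrArg (fun p => coeff p 1) h0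
      simpa only [coeff_add, coeff_C_mul, coeff_X_one, coeff_C_succ, mul_one, add_zero,
        coeff_zero] using this
    have hc0 : 3 * a₄ - (a₂ - b ^ 2) ^ 2 = 0 := by
      have := congrArg (eval 0) h0
      simpa only [eval_add, eval_mul, eval_C, eval_X, mul_zero, zero_add, eval_zero] using this
    have hb : b = 0 := by
      have h5 : 2 * 3 * b = 0 := by linear_combination -hb6
      exact (mul_eq_zero.1 h5).resolve_left (mul_ne_zero h2 h3)
    rw [hb] at hc0
    exact hj (by linear_combination -hc0)
end OddRoots

section Counting
open Polynomial

/-- The cubic `X³ + A X² + B X + C` has three distinct roots in the ground field. -/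
def HasThreeRoots (A B C : F) : Prop :=
  ∃ x y z : F, x ≠ y ∧ x ≠ z ∧ y ≠ z ∧ x ^ 3 + A * x ^ 2 + B * x + C = 0 ∧
    y ^ 3 + A * y ^ 2 + B * y + C = 0 ∧ z ^ 3 + A * z ^ 2 + B * z + C = 0

lemma hasThreeRoots_of_two_roots {A B C x y : F} (hD : cubicDisc A B C ≠ 0) (hxy : x ≠ y)
    (hx : x ^ 3 + A * x ^ 2 + B * x + C = 0) (hy : y ^ 3 + A * y ^ 2 + B * y + C = 0) :
    HasThreeRoots A B C := by
  have hxy' : x - y ≠ 0 := sub_ne_zero.2 hxy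
  have hB : B = -(x ^ 2 + x * y + y ^ 2) - A * (x + y) := by
    refine mul_left_cancel₀ hxy' ?_
    linear_combination hx - hy
  have hC : C = x * y * (x + y + A) := by
    rw [hB] at hx
    linear_combination hx
  refine ⟨x, y, -A - x - y, hxy, fun h => hD ?_, fun h => hD ?_, hx, hy, ?_⟩
  · have hA : A = -2 * x - y := by linear_combination h
    rw [hB, hC, hA, cubicDisc]
    ring
  · have hA : A = -x - 2 * y := by linear_combination h
    rw [hB, hC, hA, cubicDisc]
    ring
  · rw [hB, hC]
    ring

lemma hasThreeRoots_of_isSquare {A B C x : F} (h2 : (2 : F) ≠ 0) (hD : cubicDisc A B C ≠ 0)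
    (hsq : IsSquare (cubicDisc A B C)) (hx : x ^ 3 + A * x ^ 2 + B * x + C = 0) :
    HasThreeRoots A B C := by
  obtain ⟨s, hs⟩ := hsq
  obtain ⟨u, hu⟩ : ∃ u, u = A + x := ⟨_, rfl⟩
  obtain ⟨v, hv⟩ : ∃ v, v = B + u * x := ⟨_, rfl⟩
  have hA : A = u - x := by rw [hu]; ring
  have hB : B = v - u * x := by rw [hv]; ring
  have hC : C = -(v * x) := by
    rw [hA, hB] at hx
    linear_combination hx
  obtain ⟨e, he⟩ : ∃ e, e = x ^ 2 + u * x + v := ⟨_, rfl⟩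
  have hDe : cubicDisc A B C = (u ^ 2 - 4 * v) * e ^ 2 := by
    rw [he, hA, hB, hC, cubicDisc]
    ring
  have he0 : e ≠ 0 := by
    rintro rfl
    rw [hDe] at hD
    simp at hD
  obtain ⟨w, hw⟩ : ∃ w, w = s / e := ⟨_, rfl⟩
  have hwe : w * e = s := by rw [hw, div_mul_cancel₀ _ he0]
  have hw2 : u ^ 2 - 4 * v = w ^ 2 := by
    refine mul_right_cancel₀ (pow_ne_zero 2 he0) ?_
    rw [← hDe, hs, ← hwe]
    ring
  obtain ⟨y, hy⟩ : ∃ y, 2 * y = w - u := ⟨(w - u) / 2, by field_simp⟩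
  have hyq : y ^ 2 + u * y + v = 0 := by
    have : 2 ^ 2 * (y ^ 2 + u * y + v) = 0 := by
      linear_combination (2 * y + w + u) * hy - hw2
    exact (mul_eq_zero.1 this).resolve_left (pow_ne_zero 2 h2)
  refine hasThreeRoots_of_two_roots hD (x := x) (y := y) ?_ hx ?_
  · rintro rfl
    exact he0 (he.trans hyq)
  · rw [hA, hB, hC]
    linear_combination (y - x) * hyq

lemma two_mul_card_roots_le {A B C : F} (h2 : (2 : F) ≠ 0) (hno : ¬ HasThreeRoots A B C) :
    2 * ((Finset.univ.filter fun x : F => x ^ 3 + A * x ^ 2 + B * x + C = 0).card : ℤ) ≤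
      1 - quadraticChar F (cubicDisc A B C) + if cubicDisc A B C = 0 then 3 else 0 := by
  set R := Finset.univ.filter fun x : F => x ^ 3 + A * x ^ 2 + B * x + C = 0 with hR
  have hmem : ∀ x, x ∈ R ↔ x ^ 3 + A * x ^ 2 + B * x + C = 0 := by simp [hR]
  by_cases hD : cubicDisc A B C = 0
  · have h3 : R.card ≤ 2 := by
      by_contra hlt
      obtain ⟨x, hx, y, hy, z, hz, hxy, hxz, hyz⟩ := Finset.two_lt_card.1 (not_le.1 hlt)
      exact hno ⟨x, y, z, hxy, hxz, hyz, (hmem x).1 hx, (hmem y).1 hy, (hmem z).1 hz⟩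
    rw [hD, quadraticChar_zero, if_pos rfl]
    omega
  · have h1 : R.card ≤ 1 := by
      by_contra hlt
      obtain ⟨x, hx, y, hy, hxy⟩ := Finset.one_lt_card.1 (not_le.1 hlt)
      exact hno (hasThreeRoots_of_two_roots hD hxy ((hmem x).1 hx) ((hmem y).1 hy))
    rw [if_neg hD]
    rcases quadraticChar_dichotomy hD with h | h
    · have h0 : R.card = 0 := by
        rw [Finset.card_eq_zero, Finset.eq_empty_iff_forall_notMem]
        intro x hx
        exact hno (hasThreeRoots_of_isSquare h2 hD
          ((quadraticChar_one_iff_isSquare hD).1 h) ((hmem x).1 hx))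
      rw [h, h0]
      simp
    · rw [h]
      omega

lemma two_ne_zero_of_odd_card (hodd : Odd (Fintype.card F)) : (2 : F) ≠ 0 := by
  intro h
  have h1 : ringChar F = 2 := by
    have := ringChar.dvd (R := F) (x := 2) (by exact_mod_cast h)
    rcases (Nat.dvd_prime Nat.prime_two).1 this with h1 | h1
    · exact absurd h1 CharP.ringChar_ne_one
    · exact h1
  have := FiniteField.even_card_iff_char_two.1 h1
  rw [Nat.odd_iff] at hodd
  omega

lemma neg_le_sum_quadraticChar (hodd : Odd (Fintype.card F)) {D : F[X]} {m : ℕ}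
    (hdeg : D.natDegree ≤ 2 * m)
    (hβ : ∃ β, Odd ((D.map (algebraMap F (AlgebraicClosure F))).rootMultiplicity β)) :
    -((2 * m - 2 : ℝ) * √(Fintype.card F) + 1) ≤
      ((∑ a : F, quadraticChar F (D.eval a) : ℤ) : ℝ) := by
  obtain ⟨β, hβ⟩ := hβ
  have key := abs_sum_quadraticChar_le hodd hβ
  refine neg_le_of_abs_le ?_
  have hs : 0 ≤ √(Fintype.card F : ℝ) := Real.sqrt_nonneg _
  rcases Nat.even_or_odd D.natDegree with he | ho
  · refine (key.2 he).trans ?_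
    have : (D.natDegree : ℝ) ≤ 2 * m := by exact_mod_cast hdeg
    nlinarith
  · refine key.1.trans ?_
    have h1 : D.natDegree + 1 ≤ 2 * m := by
      obtain ⟨r, hr⟩ := ho
      omega
    have : (D.natDegree : ℝ) + 1 ≤ 2 * m := by exact_mod_cast h1
    nlinarith

/-- A family of cubics with many roots has a totally split member. -/
theorem exists_hasThreeRoots (hodd : Odd (Fintype.card F)) {A B C : F[X]} {m : ℕ}
    (hdeg : (cubicDisc A B C).natDegree ≤ 2 * m)
    (hβ : ∃ β, Odd (((cubicDisc A B C).map
      (algebraMap F (AlgebraicClosure F))).rootMultiplicity β))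
    (hcount : (Fintype.card F : ℝ) + (2 * m - 2) * √(Fintype.card F) + 1 + 6 * m <
      2 * (∑ t : F, (Finset.univ.filter fun x : F =>
        x ^ 3 + A.eval t * x ^ 2 + B.eval t * x + C.eval t = 0).card : ℕ)) :
    ∃ t, HasThreeRoots (A.eval t) (B.eval t) (C.eval t) := by
  by_contra hno
  push Not at hno
  have h2 := two_ne_zero_of_odd_card hodd
  have hD0 : cubicDisc A B C ≠ 0 := by
    intro h
    obtain ⟨β, hβ⟩ := hβ
    rw [h] at hβ
    simp at hβ
  have h1 : ∑ t : F, 2 * ((Finset.univ.filter fun x : F =>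
        x ^ 3 + A.eval t * x ^ 2 + B.eval t * x + C.eval t = 0).card : ℤ) ≤
      ∑ t : F, (1 - quadraticChar F ((cubicDisc A B C).eval t) +
        if (cubicDisc A B C).eval t = 0 then 3 else 0) := by
    refine Finset.sum_le_sum fun t _ => ?_
    rw [eval_cubicDisc]
    exact two_mul_card_roots_le h2 (hno t)
  have hz : (∑ t : F, if (cubicDisc A B C).eval t = 0 then (3 : ℤ) else 0) ≤ 6 * m := by
    rw [← Finset.sum_filter, Finset.sum_const, nsmul_eq_mul]
    have hle : (Finset.univ.filter fun t => (cubicDisc A B C).eval t = 0).card ≤ 2 * m := by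
      refine le_trans ?_ hdeg
      refine le_trans (Finset.card_le_card ?_)
        ((Multiset.toFinset_card_le _).trans (card_roots' (cubicDisc A B C)))
      intro t ht
      rw [Multiset.mem_toFinset, mem_roots hD0]
      simpa using ht
    have : ((Finset.univ.filter fun t => (cubicDisc A B C).eval t = 0).card : ℤ) ≤ 2 * m := by
      exact_mod_cast hle
    linarith
  rw [Finset.sum_add_distrib, Finset.sum_sub_distrib, ← Finset.mul_sum] at h1
  simp only [Finset.sum_const, Finset.card_univ, nsmul_eq_mul, mul_one] at h1
  have h3 : 2 * ((∑ t : F, (Finset.univ.filter fun x : F =>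
        x ^ 3 + A.eval t * x ^ 2 + B.eval t * x + C.eval t = 0).card : ℕ) : ℤ) ≤
      Fintype.card F - ∑ t : F, quadraticChar F ((cubicDisc A B C).eval t) + 6 * m := by
    push_cast
    linarith
  have h4 : 2 * ((∑ t : F, (Finset.univ.filter fun x : F =>
        x ^ 3 + A.eval t * x ^ 2 + B.eval t * x + C.eval t = 0).card : ℕ) : ℝ) ≤
      Fintype.card F - ((∑ t : F, quadraticChar F ((cubicDisc A B C).eval t) : ℤ) : ℝ)
        + 6 * m := by
    exact_mod_cast h3
  have h5 := neg_le_sum_quadraticChar hodd hdeg hβ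
  linarith
end Counting

section Lines
open Polynomial

lemma neg_le_sum_quadraticChar_cubic (hodd : Odd (Fintype.card F)) {a₂ a₄ a₆ : F}
    (hf : cubicDisc a₂ a₄ a₆ ≠ 0) :
    -(2 * √(Fintype.card F)) ≤
      ((∑ x : F, quadraticChar F (x ^ 3 + a₂ * x ^ 2 + a₄ * x + a₆) : ℤ) : ℝ) := by
  set K := AlgebraicClosure F
  set φ := algebraMap F K with hφ
  set D : F[X] := X ^ 3 + C a₂ * X ^ 2 + C a₄ * X + C a₆ with hD
  have hdeg : D.natDegree = 3 := by
    rw [hD]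
    compute_degree!
  have hDmap : D.map φ = X ^ 3 + C (φ a₂) * X ^ 2 + C (φ a₄) * X + C (φ a₆) := by
    simp [hD]
  have hdeg' : (D.map φ).natDegree = 3 := by rw [natDegree_map, hdeg]
  have h0 : D.map φ ≠ 0 := by
    intro h
    rw [h] at hdeg'
    simp at hdeg'
  obtain ⟨β, hβ⟩ : ∃ β, (D.map φ).eval β = 0 := by
    refine IsAlgClosed.exists_root _ ?_
    rw [degree_eq_natDegree h0, hdeg']
    norm_num
  have hmult : Odd ((D.map φ).rootMultiplicity β) := by
    have h1 : ¬ 2 ≤ (D.map φ).rootMultiplicity β := by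
      intro h
      obtain ⟨e0, e1⟩ := derivative_eval_eq_zero_of_two_le ((le_rootMultiplicity_iff h0).1 h)
      rw [hDmap] at e0 e1
      simp only [derivative_add, derivative_X_pow, derivative_mul, derivative_C, derivative_X,
        eval_add, eval_mul, eval_C, eval_pow, eval_X, eval_zero, eval_one] at e0 e1
      push_cast at e1
      have ha4 : φ a₄ = -3 * β ^ 2 - 2 * φ a₂ * β := by linear_combination e1
      have ha6 : φ a₆ = 2 * β ^ 3 + φ a₂ * β ^ 2 := by
        linear_combination e0 - β * e1
      refine hf ((map_eq_zero φ).1 ?_)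
      rw [map_cubicDisc, ha4, ha6, cubicDisc]
      ring
    have h2 := (rootMultiplicity_pos h0).2 hβ
    rw [show (D.map φ).rootMultiplicity β = 1 by omega]
    exact odd_one
  have key := (abs_sum_quadraticChar_le hodd hmult).1
  rw [hdeg] at key
  have e : ∀ x, D.eval x = x ^ 3 + a₂ * x ^ 2 + a₄ * x + a₆ := by
    intro x
    simp [hD]
  simp only [e] at key
  refine neg_le_of_abs_le (key.trans ?_)
  push_cast
  linarith

lemma card_sq_eq (hodd : Odd (Fintype.card F)) (a : F) :
    ((Finset.univ.filter fun y : F => y ^ 2 = a).card : ℤ) = quadraticChar F a + 1 := by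
  have hF : ringChar F ≠ 2 := by
    intro h
    have := FiniteField.even_card_iff_char_two.1 h
    rw [Nat.odd_iff] at hodd
    omega
  rw [← quadraticChar_card_sqrts hF a]
  congr 2
  ext y
  simp

lemma sub_le_sum_card_sq_eq (hodd : Odd (Fintype.card F)) {a₂ a₄ a₆ : F}
    (hf : cubicDisc a₂ a₄ a₆ ≠ 0) :
    (Fintype.card F : ℝ) - 2 * √(Fintype.card F) ≤ (∑ x : F, (Finset.univ.filter fun y : F =>
      y ^ 2 = x ^ 3 + a₂ * x ^ 2 + a₄ * x + a₆).card : ℕ) := by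
  have h1 : ((∑ x : F, (Finset.univ.filter fun y : F =>
      y ^ 2 = x ^ 3 + a₂ * x ^ 2 + a₄ * x + a₆).card : ℕ) : ℤ) =
      (∑ x : F, quadraticChar F (x ^ 3 + a₂ * x ^ 2 + a₄ * x + a₆)) + Fintype.card F := by
    push_cast
    simp only [card_sq_eq hodd, Finset.sum_add_distrib, Finset.sum_const, Finset.card_univ,
      nsmul_eq_mul, mul_one]
  have h2 : ((∑ x : F, (Finset.univ.filter fun y : F =>
      y ^ 2 = x ^ 3 + a₂ * x ^ 2 + a₄ * x + a₆).card : ℕ) : ℝ) =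
      ((∑ x : F, quadraticChar F (x ^ 3 + a₂ * x ^ 2 + a₄ * x + a₆) : ℤ) : ℝ) +
        Fintype.card F := by
    exact_mod_cast h1
  have := neg_le_sum_quadraticChar_cubic hodd hf
  linarith

lemma card_filter_eq_sum_comm {α β : Type*} [Fintype α] [Fintype β] (P : α → β → Prop)
    [∀ a b, Decidable (P a b)] :
    ∑ a, (Finset.univ.filter fun b => P a b).card =
      ∑ b, (Finset.univ.filter fun a => P a b).card := by
  simp only [Finset.card_filter]
  exact Finset.sum_comm

lemma map_slopeDisc {R S : Type*} [CommRing R] [CommRing S] (φ : R →+* S)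
    (a₂ a₄ a₆ y₀ : R) :
    (slopeDisc a₂ a₄ a₆ y₀).map φ = slopeDisc (φ a₂) (φ a₄) (φ a₆) (φ y₀) := by
  rw [slopeDisc, slopeDisc, ← coe_mapRingHom, map_cubicDisc]
  simp [map_ofNat φ 2]

lemma map_interceptDisc {R S : Type*} [CommRing R] [CommRing S] (φ : R →+* S)
    (a₂ a₄ a₆ b : R) :
    (interceptDisc a₂ a₄ a₆ b).map φ = interceptDisc (φ a₂) (φ a₄) (φ a₆) (φ b) := by
  rw [interceptDisc, interceptDisc, ← coe_mapRingHom, map_cubicDisc]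
  simp [map_ofNat φ 2]

lemma eleven_le_sqrt_card (hq : 121 ≤ Fintype.card F) :
    11 ≤ √(Fintype.card F : ℝ) ∧
      √(Fintype.card F : ℝ) * √(Fintype.card F : ℝ) = Fintype.card F := by
  refine ⟨Real.le_sqrt_of_sq_le ?_, Real.mul_self_sqrt (Nat.cast_nonneg _)⟩
  have : (121 : ℝ) ≤ Fintype.card F := by exact_mod_cast hq
  linarith

/-- Through an affine point `(0, y₀)` off the curve `y² = x³ + a₂ x² + a₄ x + a₆` there is a line
meeting the curve in three distinct affine points. -/
theorem exists_slope_hasThreeRoots (hq : 121 ≤ Fintype.card F) (hodd : Odd (Fintype.card F))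
    {a₂ a₄ a₆ : F} (hf : cubicDisc a₂ a₄ a₆ ≠ 0) (hj : a₂ ^ 2 ≠ 3 * a₄) {y₀ : F}
    (hy : a₆ ≠ y₀ ^ 2) :
    ∃ b, HasThreeRoots (a₂ - b ^ 2) (a₄ - 2 * y₀ * b) (a₆ - y₀ ^ 2) := by
  have h2 := two_ne_zero_of_odd_card hodd
  set φ := algebraMap F (AlgebraicClosure F) with hφ
  have hφi : Function.Injective φ := φ.injective
  have key := exists_hasThreeRoots hodd (A := C a₂ - X ^ 2) (B := C a₄ - C (2 * y₀) * X)
    (C := C (a₆ - y₀ ^ 2)) (m := 3) (coeff_slopeDisc a₂ a₄ a₆ y₀).1 ?_ ?_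
  · simpa only [eval_sub, eval_mul, eval_pow, eval_C, eval_X] using key
  · have := exists_odd_rootMultiplicity_slopeDisc (a₂ := φ a₂) (a₄ := φ a₄) (a₆ := φ a₆)
      (y₀ := φ y₀) (by rw [← map_ofNat φ 2]; exact (map_ne_zero φ).2 h2)
      (by rw [← map_cubicDisc]; exact (map_ne_zero φ).2 hf)
      (fun h => hj (hφi (by simpa [map_ofNat φ 3] using h))) (fun h => hy (hφi (by simpa using h)))
    rwa [← map_slopeDisc] at this
  · simp only [eval_sub, eval_mul, eval_pow, eval_C, eval_X]
    rw [card_filter_eq_sum_comm]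
    have hle : ∑ x : F, (Finset.univ.filter fun y : F =>
          y ^ 2 = x ^ 3 + a₂ * x ^ 2 + a₄ * x + a₆).card ≤
        (∑ x : F, (Finset.univ.filter fun b : F =>
          x ^ 3 + (a₂ - b ^ 2) * x ^ 2 + (a₄ - 2 * y₀ * b) * x + (a₆ - y₀ ^ 2) = 0).card) + 2 := by
      rw [← Finset.add_sum_erase _ _ (Finset.mem_univ (0 : F)), add_comm,
        ← Finset.add_sum_erase (f := fun x : F => (Finset.univ.filter fun b : F =>
          x ^ 3 + (a₂ - b ^ 2) * x ^ 2 + (a₄ - 2 * y₀ * b) * x + (a₆ - y₀ ^ 2) = 0).card) _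
          (Finset.mem_univ (0 : F))]
      have e1 : (Finset.univ.filter fun y : F =>
          y ^ 2 = 0 ^ 3 + a₂ * 0 ^ 2 + a₄ * 0 + a₆).card ≤ 2 := by
        have h3 := card_sq_eq hodd (0 ^ 3 + a₂ * 0 ^ 2 + a₄ * 0 + a₆)
        have h4 : quadraticChar F (0 ^ 3 + a₂ * 0 ^ 2 + a₄ * 0 + a₆) ≤ 1 := by
          by_cases h : 0 ^ 3 + a₂ * 0 ^ 2 + a₄ * 0 + a₆ = 0
          · rw [h, quadraticChar_zero]
            norm_num
          · rcases quadraticChar_dichotomy h with h | h <;> rw [h]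
            norm_num
        omega
      have e2 : ∀ x ∈ Finset.univ.erase (0 : F), (Finset.univ.filter fun y : F =>
          y ^ 2 = x ^ 3 + a₂ * x ^ 2 + a₄ * x + a₆).card ≤
          (Finset.univ.filter fun b : F =>
          x ^ 3 + (a₂ - b ^ 2) * x ^ 2 + (a₄ - 2 * y₀ * b) * x + (a₆ - y₀ ^ 2) = 0).card := by
        intro x hx
        have hx0 : x ≠ 0 := (Finset.mem_erase.1 hx).1
        refine Finset.card_le_card_of_injOn (fun y => (y - y₀) / x) ?_ ?_
        · intro y hy
          simp only [Finset.coe_filter, Finset.mem_univ, true_and, Set.mem_ofPred_eq] at hy ⊢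
          have e : (y - y₀) / x * x = y - y₀ := div_mul_cancel₀ _ hx0
          linear_combination -hy - ((y - y₀) / x * x + (y - y₀) + 2 * y₀) * e
        · intro y _ z _ h
          have := (div_left_inj' hx0).1 h
          linear_combination this
      have e3 := Finset.sum_le_sum e2
      omega
    have h3 := sub_le_sum_card_sq_eq hodd hf
    have h4 : ((∑ x : F, (Finset.univ.filter fun y : F =>
          y ^ 2 = x ^ 3 + a₂ * x ^ 2 + a₄ * x + a₆).card : ℕ) : ℝ) ≤
        ((∑ x : F, (Finset.univ.filter fun b : F =>
          x ^ 3 + (a₂ - b ^ 2) * x ^ 2 + (a₄ - 2 * y₀ * b) * x + (a₆ - y₀ ^ 2) = 0).card : ℕ) : ℝ)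
            + 2 := by
      exact_mod_cast hle
    obtain ⟨h5, h6⟩ := eleven_le_sqrt_card hq
    push_cast at h3 h4 ⊢
    nlinarith

/-- Every non-vertical direction contains a line meeting the curve
`y² = x³ + a₂ x² + a₄ x + a₆` in three distinct affine points. -/
theorem exists_intercept_hasThreeRoots (hq : 121 ≤ Fintype.card F) (hodd : Odd (Fintype.card F))
    {a₂ a₄ a₆ : F} (hf : cubicDisc a₂ a₄ a₆ ≠ 0) (hj : a₂ ^ 2 ≠ 3 * a₄) (b : F) :
    ∃ c, HasThreeRoots (a₂ - b ^ 2) (a₄ - 2 * b * c) (a₆ - c ^ 2) := by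
  have h2 := two_ne_zero_of_odd_card hodd
  set φ := algebraMap F (AlgebraicClosure F) with hφ
  have hφi : Function.Injective φ := φ.injective
  have key := exists_hasThreeRoots hodd (A := C (a₂ - b ^ 2)) (B := C a₄ - C (2 * b) * X)
    (C := C a₆ - X ^ 2) (m := 2) (coeff_interceptDisc a₂ a₄ a₆ b).1 ?_ ?_
  · simpa only [eval_sub, eval_mul, eval_pow, eval_C, eval_X] using key
  · have := exists_odd_rootMultiplicity_interceptDisc (a₂ := φ a₂) (a₄ := φ a₄) (a₆ := φ a₆)
      (by rw [← map_ofNat φ 2]; exact (map_ne_zero φ).2 h2)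
      (by rw [← map_cubicDisc]; exact (map_ne_zero φ).2 hf)
      (fun h => hj (hφi (by simpa [map_ofNat φ 3] using h))) (φ b)
    rwa [← map_interceptDisc] at this
  · simp only [eval_sub, eval_mul, eval_pow, eval_C, eval_X]
    rw [card_filter_eq_sum_comm]
    have hle : ∑ x : F, (Finset.univ.filter fun y : F =>
          y ^ 2 = x ^ 3 + a₂ * x ^ 2 + a₄ * x + a₆).card ≤
        ∑ x : F, (Finset.univ.filter fun c : F =>
          x ^ 3 + (a₂ - b ^ 2) * x ^ 2 + (a₄ - 2 * b * c) * x + (a₆ - c ^ 2) = 0).card := by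
      refine Finset.sum_le_sum fun x _ => ?_
      refine Finset.card_le_card_of_injOn (fun y => y - b * x) ?_ ?_
      · intro y hy
        simp only [Finset.coe_filter, Finset.mem_univ, true_and, Set.mem_ofPred_eq] at hy ⊢
        linear_combination -hy
      · intro y _ z _ h
        simpa using h
    have h3 := sub_le_sum_card_sq_eq hodd hf
    have h4 : ((∑ x : F, (Finset.univ.filter fun y : F =>
          y ^ 2 = x ^ 3 + a₂ * x ^ 2 + a₄ * x + a₆).card : ℕ) : ℝ) ≤
        ((∑ x : F, (Finset.univ.filter fun c : F =>
          x ^ 3 + (a₂ - b ^ 2) * x ^ 2 + (a₄ - 2 * b * c) * x + (a₆ - c ^ 2) = 0).card : ℕ) : ℝ)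
        := by
      exact_mod_cast hle
    obtain ⟨h5, h6⟩ := eleven_le_sqrt_card hq
    push_cast at h3 h4 ⊢
    nlinarith
end Lines

section PlaneSections
open Polynomial

variable {a₂ a₄ a₆ : F}

/-- The vector `(1, x, y, x²)` of an affine point, and `(0, 0, 0, 1)` at infinity. -/
def pointVec : Option (F × F) → Fin 4 → F
  | none => ![0, 0, 0, 1]
  | some p => ![1, p.1, p.2, p.1 ^ 2]

/-- The points of `y² = x³ + a₂ x² + a₄ x + a₆`, with `none` as the point at infinity. -/
def shortCurve (a₂ a₄ a₆ : F) : Finset (Option (F × F)) :=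
  Finset.insertNone (Finset.univ.filter fun p : F × F =>
    p.2 ^ 2 = p.1 ^ 3 + a₂ * p.1 ^ 2 + a₄ * p.1 + a₆)

/-- The points of `shortCurve` in the plane with coefficient vector `a`. -/
def planeSection (a₂ a₄ a₆ : F) (a : Fin 4 → F) : Finset (Option (F × F)) :=
  (shortCurve a₂ a₄ a₆).filter fun p => a ⬝ᵥ pointVec p = 0

lemma some_mem_shortCurve {x y : F} :
    some (x, y) ∈ shortCurve a₂ a₄ a₆ ↔ y ^ 2 = x ^ 3 + a₂ * x ^ 2 + a₄ * x + a₆ := by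
  simp [shortCurve]

lemma none_mem_shortCurve : none ∈ shortCurve a₂ a₄ a₆ := by
  simp [shortCurve]

lemma dotProduct_four (a v : Fin 4 → F) :
    a ⬝ᵥ v = a 0 * v 0 + a 1 * v 1 + a 2 * v 2 + a 3 * v 3 := by
  simp [dotProduct, Fin.sum_univ_four]

lemma some_mem_planeSection {a : Fin 4 → F} {x y : F} :
    some (x, y) ∈ planeSection a₂ a₄ a₆ a ↔ y ^ 2 = x ^ 3 + a₂ * x ^ 2 + a₄ * x + a₆ ∧
      a 0 + a 1 * x + a 2 * y + a 3 * x ^ 2 = 0 := by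
  simp [planeSection, some_mem_shortCurve, dotProduct_four, pointVec]

lemma none_mem_planeSection {a : Fin 4 → F} : none ∈ planeSection a₂ a₄ a₆ a ↔ a 3 = 0 := by
  simp [planeSection, none_mem_shortCurve, dotProduct_four, pointVec]

lemma card_le_of_forall_isRoot {s : Finset F} {p : F[X]} (hp : p ≠ 0)
    (h : ∀ x ∈ s, p.eval x = 0) : s.card ≤ p.natDegree :=
  Polynomial.card_le_degree_of_subset_roots fun x hx => (mem_roots hp).2 (h x hx)

/-- The affine part of a plane section. -/
lemma exists_affine_part (a : Fin 4 → F) : ∃ s : Finset (F × F),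
    (∀ p ∈ s, p.2 ^ 2 = p.1 ^ 3 + a₂ * p.1 ^ 2 + a₄ * p.1 + a₆ ∧
      a 0 + a 1 * p.1 + a 2 * p.2 + a 3 * p.1 ^ 2 = 0) ∧
    (planeSection a₂ a₄ a₆ a).card = s.card + if a 3 = 0 then 1 else 0 := by
  refine ⟨Finset.eraseNone (planeSection a₂ a₄ a₆ a), fun p hp => ?_, ?_⟩
  · exact some_mem_planeSection.1 (Finset.mem_eraseNone.1 hp)
  · split_ifs with h
    · have h' := none_mem_planeSection (a₂ := a₂) (a₄ := a₄) (a₆ := a₆) (a := a) |>.2 h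
      rw [Finset.card_eraseNone_of_mem h', Nat.sub_add_cancel (Finset.card_pos.2 ⟨_, h'⟩)]
    · rw [Finset.card_eraseNone_of_not_mem (none_mem_planeSection.not.2 h), add_zero]

lemma card_filter_fst_le_two {s : Finset (F × F)} {f : F → F} (hs : ∀ p ∈ s, p.2 ^ 2 = f p.1)
    (x : F) : (s.filter fun p => p.1 = x).card ≤ 2 := by
  have hinj : Set.InjOn Prod.snd (s.filter fun p => p.1 = x : Set (F × F)) := by
    intro p hp p' hp' h
    simp only [Finset.coe_filter, Set.mem_ofPred_eq] at hp hp'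
    exact Prod.ext (hp.2.trans hp'.2.symm) h
  rw [← Finset.card_image_of_injOn (by simpa using hinj)]
  refine (card_le_of_forall_isRoot (X_pow_sub_C_ne_zero two_pos (f x)) ?_).trans
    (natDegree_X_pow_sub_C).le
  intro y hy
  obtain ⟨p, hp, rfl⟩ := Finset.mem_image.1 hy
  obtain ⟨hps, rfl⟩ := Finset.mem_filter.1 hp
  simp [hs p hps]

lemma card_le_of_quadratic {s : Finset F} {α β δ : F} (h : ¬(β = 0 ∧ δ = 0))
    (hs : ∀ x ∈ s, α + β * x + δ * x ^ 2 = 0) : s.card + (if δ = 0 then 1 else 0) ≤ 2 := by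
  have heval : ∀ x ∈ s, (C δ * X ^ 2 + C β * X + C α : F[X]).eval x = 0 := fun x hx => by
    simp only [eval_add, eval_mul, eval_pow, eval_C, eval_X]
    linear_combination hs x hx
  split_ifs with hδ
  · subst hδ
    have hβ : β ≠ 0 := fun h' => h ⟨h', rfl⟩
    simp only [map_zero, zero_mul, zero_add] at heval
    have := card_le_of_forall_isRoot (fun h0 => hβ (by simpa using congrArg (coeff · 1) h0)) heval
    rw [natDegree_linear hβ] at this
    omega
  · have := card_le_of_forall_isRoot (fun h0 => hδ (by
      simpa [coeff_X, coeff_C] using congrArg (coeff · 2) h0)) heval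
    rw [natDegree_quadratic hδ] at this
    omega

lemma card_le_of_quartic {s : Finset F} {α β γ δ : F} (hγ : γ ≠ 0)
    (hs : ∀ x ∈ s, (α + β * x + δ * x ^ 2) ^ 2 =
      γ ^ 2 * (x ^ 3 + a₂ * x ^ 2 + a₄ * x + a₆)) :
    s.card + (if δ = 0 then 1 else 0) ≤ 4 := by
  split_ifs with hδ
  · subst hδ
    have heval : ∀ x ∈ s, (C (-γ ^ 2) * X ^ 3 + C (β ^ 2 - γ ^ 2 * a₂) * X ^ 2 +
        C (2 * α * β - γ ^ 2 * a₄) * X + C (α ^ 2 - γ ^ 2 * a₆) : F[X]).eval x = 0 := by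
      intro x hx
      simp only [eval_add, eval_mul, eval_pow, eval_C, eval_X]
      linear_combination hs x hx
    have hγ' : -γ ^ 2 ≠ 0 := neg_ne_zero.2 (pow_ne_zero 2 hγ)
    have hdeg := natDegree_cubic (b := β ^ 2 - γ ^ 2 * a₂) (c := 2 * α * β - γ ^ 2 * a₄)
      (d := α ^ 2 - γ ^ 2 * a₆) hγ'
    have := card_le_of_forall_isRoot (ne_zero_of_natDegree_gt (n := 2) (by rw [hdeg]; norm_num))
      heval
    omega
  · have heval : ∀ x ∈ s, (C (δ ^ 2) * X ^ 4 + (C (2 * β * δ - γ ^ 2) * X ^ 3 +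
        C (β ^ 2 + 2 * α * δ - γ ^ 2 * a₂) * X ^ 2 +
        C (2 * α * β - γ ^ 2 * a₄) * X + C (α ^ 2 - γ ^ 2 * a₆)) : F[X]).eval x = 0 := by
      intro x hx
      simp only [eval_add, eval_mul, eval_pow, eval_C, eval_X]
      linear_combination hs x hx
    have hδ' : δ ^ 2 ≠ 0 := pow_ne_zero 2 hδ
    have hdeg : (C (δ ^ 2) * X ^ 4 + (C (2 * β * δ - γ ^ 2) * X ^ 3 +
        C (β ^ 2 + 2 * α * δ - γ ^ 2 * a₂) * X ^ 2 +
        C (2 * α * β - γ ^ 2 * a₄) * X + C (α ^ 2 - γ ^ 2 * a₆)) : F[X]).natDegree = 4 := by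
      compute_degree!
    have := card_le_of_forall_isRoot (ne_zero_of_natDegree_gt (n := 3) (by rw [hdeg]; norm_num))
      heval
    omega

/-- A plane meets the curve in at most four points. -/
theorem card_planeSection_le {a : Fin 4 → F} (ha : a ≠ 0) :
    (planeSection a₂ a₄ a₆ a).card ≤ 4 := by
  obtain ⟨s, hs, hcard⟩ := exists_affine_part (a₂ := a₂) (a₄ := a₄) (a₆ := a₆) a
  rw [hcard]
  by_cases hγ : a 2 = 0
  · by_cases hβδ : a 1 = 0 ∧ a 3 = 0
    · have hα : a 0 ≠ 0 := fun h => ha (funext fun i => by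
        fin_cases i
        · exact h
        · exact hβδ.1
        · exact hγ
        · exact hβδ.2)
      have : s = ∅ := Finset.eq_empty_of_forall_notMem fun p hp => hα (by
        simpa [hγ, hβδ] using (hs p hp).2)
      subst this
      split_ifs <;> simp
    · have h1 : s.card ≤ 2 * (s.image Prod.fst).card := by
        refine Finset.card_le_mul_card_image s 2 fun x _ => ?_
        exact card_filter_fst_le_two (f := fun x => x ^ 3 + a₂ * x ^ 2 + a₄ * x + a₆)
          (fun p hp => (hs p hp).1) x
      have h2 := card_le_of_quadratic (s := s.image Prod.fst) (α := a 0) hβδ (by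
        intro x hx
        obtain ⟨p, hp, rfl⟩ := Finset.mem_image.1 hx
        simpa [hγ] using (hs p hp).2)
      split_ifs at h2 ⊢ <;> omega
  · have hinj : Set.InjOn Prod.fst (s : Set (F × F)) := by
      intro p hp p' hp' h
      refine Prod.ext h (mul_left_cancel₀ hγ ?_)
      have h1 := (hs p hp).2
      have h2 := (hs p' hp').2
      rw [← h] at h2
      linear_combination h1 - h2
    rw [← Finset.card_image_of_injOn hinj]
    refine card_le_of_quartic (a₂ := a₂) (a₄ := a₄) (a₆ := a₆) (α := a 0) (β := a 1) hγ ?_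
    intro x hx
    obtain ⟨p, hp, rfl⟩ := Finset.mem_image.1 hx
    obtain ⟨h1, h2⟩ := hs p hp
    rw [← h1]
    linear_combination (a 0 + a 1 * p.1 + a 3 * p.1 ^ 2 - a 2 * p.2) * h2

end PlaneSections

section ExtensionPoints
open Polynomial

variable {a₂ a₄ a₆ : F}

lemma vec_dotProduct (α β γ δ : F) (v : Fin 4 → F) :
    ![α, β, γ, δ] ⬝ᵥ v = α * v 0 + β * v 1 + γ * v 2 + δ * v 3 := by
  rw [dotProduct_four]
  rfl

lemma cubicDisc_shift (x₀ : F) :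
    cubicDisc (a₂ + 3 * x₀) (a₄ + 2 * a₂ * x₀ + 3 * x₀ ^ 2)
      (x₀ ^ 3 + a₂ * x₀ ^ 2 + a₄ * x₀ + a₆) = cubicDisc a₂ a₄ a₆ := by
  rw [cubicDisc, cubicDisc]
  ring

lemma exists_slope_hasThreeRoots_shift (hq : 121 ≤ Fintype.card F) (hodd : Odd (Fintype.card F))
    (hf : cubicDisc a₂ a₄ a₆ ≠ 0) (hj : a₂ ^ 2 ≠ 3 * a₄) {x₀ y₀ : F}
    (hy : x₀ ^ 3 + a₂ * x₀ ^ 2 + a₄ * x₀ + a₆ ≠ y₀ ^ 2) :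
    ∃ b, HasThreeRoots (a₂ + 3 * x₀ - b ^ 2) (a₄ + 2 * a₂ * x₀ + 3 * x₀ ^ 2 - 2 * y₀ * b)
      (x₀ ^ 3 + a₂ * x₀ ^ 2 + a₄ * x₀ + a₆ - y₀ ^ 2) :=
  exists_slope_hasThreeRoots hq hodd (by rwa [cubicDisc_shift])
    (fun h => hj (by linear_combination h)) hy

lemma four_le_card_planeSection_of_hasThreeRoots {b c : F}
    (h : HasThreeRoots (a₂ - b ^ 2) (a₄ - 2 * b * c) (a₆ - c ^ 2)) :
    4 ≤ (planeSection a₂ a₄ a₆ ![c, b, -1, 0]).card := by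
  obtain ⟨x, y, z, hxy, hxz, hyz, hx, hy, hz⟩ := h
  have hcard : ({none, some (x, b * x + c), some (y, b * y + c), some (z, b * z + c)} :
      Finset (Option (F × F))).card = 4 := by
    rw [Finset.card_insert_of_notMem, Finset.card_insert_of_notMem, Finset.card_insert_of_notMem,
      Finset.card_singleton] <;> simp [hxy, hxz, hyz]
  refine hcard.ge.trans (Finset.card_le_card ?_)
  simp only [Finset.insert_subset_iff, Finset.singleton_subset_iff, none_mem_planeSection,
    some_mem_planeSection]
  refine ⟨by simp, ⟨?_, ?_⟩, ⟨?_, ?_⟩, ⟨?_, ?_⟩⟩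
  · linear_combination -hx
  · simp; ring
  · linear_combination -hy
  · simp; ring
  · linear_combination -hz
  · simp; ring

/-- A vector through which some plane meets the curve in four points, unless the vector lies over
an affine point of the curve or over the direction of the vertical lines. -/
lemma exists_plane_of_not_exceptional (hq : 121 ≤ Fintype.card F) (hodd : Odd (Fintype.card F))
    (hf : cubicDisc a₂ a₄ a₆ ≠ 0) (hj : a₂ ^ 2 ≠ 3 * a₄) (v : Fin 4 → F) :
    (∃ a : Fin 4 → F, a ≠ 0 ∧ a ⬝ᵥ v = 0 ∧ 4 ≤ (planeSection a₂ a₄ a₆ a).card) ∨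
    (∃ x y, v 0 ≠ 0 ∧ v 1 = v 0 * x ∧ v 2 = v 0 * y ∧
      y ^ 2 = x ^ 3 + a₂ * x ^ 2 + a₄ * x + a₆) ∨
    (v 0 = 0 ∧ v 1 = 0 ∧ v 2 ≠ 0) := by
  have key : ∀ b c : F, HasThreeRoots (a₂ - b ^ 2) (a₄ - 2 * b * c) (a₆ - c ^ 2) →
      c * v 0 + b * v 1 = v 2 →
      ∃ a : Fin 4 → F, a ≠ 0 ∧ a ⬝ᵥ v = 0 ∧ 4 ≤ (planeSection a₂ a₄ a₆ a).card := by
    intro b c h hv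
    refine ⟨![c, b, -1, 0], fun h0 => ?_, ?_, four_le_card_planeSection_of_hasThreeRoots h⟩
    · simpa using congrFun h0 2
    · rw [vec_dotProduct]
      linear_combination hv
  by_cases h0 : v 0 = 0
  · by_cases h1 : v 1 = 0
    · by_cases h2 : v 2 = 0
      · obtain ⟨c, hc⟩ := exists_intercept_hasThreeRoots hq hodd hf hj 0
        exact Or.inl (key 0 c hc (by simp [h0, h1, h2]))
      · exact Or.inr (Or.inr ⟨h0, h1, h2⟩)
    · obtain ⟨c, hc⟩ := exists_intercept_hasThreeRoots hq hodd hf hj (v 2 / v 1)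
      exact Or.inl (key _ c hc (by rw [h0]; field_simp; ring))
  · obtain ⟨x, hx⟩ : ∃ x, v 1 = v 0 * x := ⟨v 1 / v 0, by field_simp⟩
    obtain ⟨y, hy⟩ : ∃ y, v 2 = v 0 * y := ⟨v 2 / v 0, by field_simp⟩
    by_cases hxy : y ^ 2 = x ^ 3 + a₂ * x ^ 2 + a₄ * x + a₆
    · exact Or.inr (Or.inl ⟨x, y, h0, hx, hy, hxy⟩)
    · obtain ⟨b, r, s, t, hrs, hrt, hst, hr, hs, ht⟩ :=
        exists_slope_hasThreeRoots_shift hq hodd hf hj (Ne.symm hxy)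
      refine Or.inl (key b (y - b * x)
        ⟨r + x, s + x, t + x, by simpa, by simpa, by simpa, ?_, ?_, ?_⟩ ?_)
      · linear_combination hr
      · linear_combination hs
      · linear_combination ht
      · rw [hx, hy]; ring

/-- There are two abscissas with nonzero square ordinate. -/
lemma exists_two_abscissas (hq : 121 ≤ Fintype.card F) (hodd : Odd (Fintype.card F))
    (hf : cubicDisc a₂ a₄ a₆ ≠ 0) : ∃ x y x' y' : F, x ≠ x' ∧ y ≠ 0 ∧ y' ≠ 0 ∧
      y ^ 2 = x ^ 3 + a₂ * x ^ 2 + a₄ * x + a₆ ∧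
      y' ^ 2 = x' ^ 3 + a₂ * x' ^ 2 + a₄ * x' + a₆ := by
  set S : Finset F := Finset.univ.filter fun x => ∃ y : F, y ≠ 0 ∧
    y ^ 2 = x ^ 3 + a₂ * x ^ 2 + a₄ * x + a₆ with hS
  set Z : Finset F := Finset.univ.filter fun x => x ^ 3 + a₂ * x ^ 2 + a₄ * x + a₆ = 0 with hZ
  have hZ3 : Z.card ≤ 4 := by
    have := card_le_of_quartic (s := Z) (a₂ := a₂) (a₄ := a₄) (a₆ := a₆) (α := 0) (β := 0)
      (δ := 0) (one_ne_zero (α := F)) (fun x hx => by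
        simpa [eq_comm] using (Finset.mem_filter.1 hx).2)
    omega
  suffices h : 1 < S.card by
    obtain ⟨x, hx, x', hx', hne⟩ := Finset.one_lt_card.1 h
    obtain ⟨y, hy, h1⟩ := (Finset.mem_filter.1 hx).2
    obtain ⟨y', hy', h2⟩ := (Finset.mem_filter.1 hx').2
    exact ⟨x, y, x', y', hne, hy, hy', h1, h2⟩
  have hle : ∑ x : F, (Finset.univ.filter fun y : F =>
      y ^ 2 = x ^ 3 + a₂ * x ^ 2 + a₄ * x + a₆).card ≤ 2 * (S ∪ Z).card := by
    rw [← Finset.sum_subset (Finset.subset_univ (S ∪ Z))]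
    · rw [mul_comm, ← smul_eq_mul]
      refine Finset.sum_le_card_nsmul _ _ _ fun x _ => ?_
      refine (card_le_of_forall_isRoot (X_pow_sub_C_ne_zero two_pos
        (x ^ 3 + a₂ * x ^ 2 + a₄ * x + a₆)) fun y hy => ?_).trans (natDegree_X_pow_sub_C).le
      simpa [sub_eq_zero] using hy
    · intro x _ hx
      rw [Finset.card_eq_zero, Finset.filter_eq_empty_iff]
      intro y _ hy
      refine hx (Finset.mem_union.2 ?_)
      by_cases hy0 : y = 0
      · exact Or.inr (by simp [hZ, ← hy, hy0])
      · exact Or.inl (by simpa [hS] using ⟨y, hy0, hy⟩)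
  have hunion := Finset.card_union_le S Z
  obtain ⟨h5, h6⟩ := eleven_le_sqrt_card hq
  have h7 := sub_le_sum_card_sq_eq hodd hf
  by_contra hcon
  have h8 : ∑ x : F, (Finset.univ.filter fun y : F =>
      y ^ 2 = x ^ 3 + a₂ * x ^ 2 + a₄ * x + a₆).card ≤ 10 := by omega
  have h9 : ((∑ x : F, (Finset.univ.filter fun y : F =>
      y ^ 2 = x ^ 3 + a₂ * x ^ 2 + a₄ * x + a₆).card : ℕ) : ℝ) ≤ 10 := by exact_mod_cast h8
  push_cast at h7 h9
  nlinarith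

lemma three_le_card_planeSection_vertical (h2 : (2 : F) ≠ 0) {x y : F} (hy : y ≠ 0)
    (h : y ^ 2 = x ^ 3 + a₂ * x ^ 2 + a₄ * x + a₆) :
    3 ≤ (planeSection a₂ a₄ a₆ ![-x, 1, 0, 0]).card := by
  have hne : y ≠ -y := fun h' => hy (by
    have : 2 * y = 0 := by linear_combination h'
    simpa [h2] using this)
  have hcard : ({none, some (x, y), some (x, -y)} : Finset (Option (F × F))).card = 3 := by
    rw [Finset.card_insert_of_notMem, Finset.card_insert_of_notMem, Finset.card_singleton] <;>
      simp [hne]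
  refine hcard.ge.trans (Finset.card_le_card ?_)
  simp [Finset.insert_subset_iff, none_mem_planeSection, some_mem_planeSection, h]

lemma four_le_card_planeSection_two_vertical (h2 : (2 : F) ≠ 0) {x y x' y' : F} (hx : x ≠ x')
    (hy : y ≠ 0) (hy' : y' ≠ 0) (h : y ^ 2 = x ^ 3 + a₂ * x ^ 2 + a₄ * x + a₆)
    (h' : y' ^ 2 = x' ^ 3 + a₂ * x' ^ 2 + a₄ * x' + a₆) :
    4 ≤ (planeSection a₂ a₄ a₆ ![x * x', -(x + x'), 0, 1]).card := by
  have hne : ∀ z : F, z ≠ 0 → z ≠ -z := fun z hz h' => hz (by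
    have : 2 * z = 0 := by linear_combination h'
    simpa [h2] using this)
  have hcard : ({some (x, y), some (x, -y), some (x', y'), some (x', -y')} :
      Finset (Option (F × F))).card = 4 := by
    rw [Finset.card_insert_of_notMem, Finset.card_insert_of_notMem, Finset.card_insert_of_notMem,
      Finset.card_singleton] <;> simp [hne _ hy, hne _ hy', hx]
  refine hcard.ge.trans (Finset.card_le_card ?_)
  simp only [Finset.insert_subset_iff, Finset.singleton_subset_iff, some_mem_planeSection]
  refine ⟨⟨h, ?_⟩, ⟨by rw [neg_sq, h], ?_⟩, ⟨h', ?_⟩, ⟨by rw [neg_sq, h'], ?_⟩⟩ <;> simp <;> ring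

lemma exists_plane_through_two {x y x' y' : F} (hx : x ≠ x')
    (h : y ^ 2 = x ^ 3 + a₂ * x ^ 2 + a₄ * x + a₆)
    (h' : y' ^ 2 = x' ^ 3 + a₂ * x' ^ 2 + a₄ * x' + a₆) :
    ∃ b c : F, y = b * x + c ∧ y' = b * x' + c ∧
      3 ≤ (planeSection a₂ a₄ a₆ ![c, b, -1, 0]).card := by
  have hx' : x - x' ≠ 0 := sub_ne_zero.2 hx
  obtain ⟨b, hb⟩ : ∃ b, b * (x - x') = y - y' := ⟨(y - y') / (x - x'), by field_simp⟩
  refine ⟨b, y - b * x, by ring, by linear_combination hb, ?_⟩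
  have hcard : ({none, some (x, y), some (x', y')} : Finset (Option (F × F))).card = 3 := by
    rw [Finset.card_insert_of_notMem, Finset.card_insert_of_notMem, Finset.card_singleton] <;>
      simp [hx]
  refine hcard.ge.trans (Finset.card_le_card ?_)
  simp only [Finset.insert_subset_iff, Finset.singleton_subset_iff, none_mem_planeSection,
    some_mem_planeSection]
  refine ⟨by simp, ⟨h, by simp⟩, h', ?_⟩
  simp
  linear_combination -hb

lemma card_four_of_abscissas_ne {x₁ x₂ x₃ x₄ y₁ y₂ y₃ y₄ : F} (h₁₂ : x₁ ≠ x₂) (h₁₃ : x₁ ≠ x₃)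
    (h₁₄ : x₁ ≠ x₄) (h₂₃ : x₂ ≠ x₃) (h₂₄ : x₂ ≠ x₄) (h₃₄ : x₃ ≠ x₄) :
    ({some (x₁, y₁), some (x₂, y₂), some (x₃, y₃), some (x₄, y₄)} :
      Finset (Option (F × F))).card = 4 := by
  rw [Finset.card_insert_of_notMem, Finset.card_insert_of_notMem, Finset.card_insert_of_notMem,
    Finset.card_singleton] <;> simp [*]

/-- Over a two-torsion point, the vectors `(0, 0, v₂, v₃)` with `v₂ ≠ 0` lie in a plane meeting
the curve in four points. -/
lemma exists_plane_of_two_torsion (hq : 121 ≤ Fintype.card F) (hodd : Odd (Fintype.card F))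
    (hf : cubicDisc a₂ a₄ a₆ ≠ 0) (hj : a₂ ^ 2 ≠ 3 * a₄) {e : F}
    (he : 0 = e ^ 3 + a₂ * e ^ 2 + a₄ * e + a₆) {v : Fin 4 → F} (h0 : v 0 = 0) (h1 : v 1 = 0)
    (hv : v 2 ≠ 0) :
    ∃ a : Fin 4 → F, a ≠ 0 ∧ a ⬝ᵥ v = 0 ∧ 4 ≤ (planeSection a₂ a₄ a₆ a).card := by
  have h2 := two_ne_zero_of_odd_card hodd
  by_cases h3 : v 3 = 0
  · obtain ⟨x, y, x', y', hx, hy, hy', h, h'⟩ := exists_two_abscissas hq hodd hf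
    refine ⟨![x * x', -(x + x'), 0, 1], fun h0 => ?_, ?_,
      four_le_card_planeSection_two_vertical h2 hx hy hy' h h'⟩
    · simpa using congrFun h0 3
    · rw [vec_dotProduct, h0, h1, h3]
      ring
  obtain ⟨u, hu⟩ : ∃ u, v 3 = u * v 2 := ⟨v 3 / v 2, by field_simp⟩
  have hu0 : u ≠ 0 := by
    rintro rfl
    simp [hu] at h3
  obtain ⟨A, hA⟩ : ∃ A, A = a₂ + 3 * e := ⟨_, rfl⟩
  obtain ⟨B, hB⟩ : ∃ B, B = a₄ + 2 * a₂ * e + 3 * e ^ 2 := ⟨_, rfl⟩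
  have hf' := cubicDisc_shift (a₂ := a₂) (a₄ := a₄) (a₆ := a₆) e
  rw [← he, ← hA, ← hB] at hf'
  have hB0 : B ≠ 0 := by
    rintro rfl
    exact hf (by rw [← hf', cubicDisc]; ring)
  obtain ⟨y₀, hy₀⟩ : ∃ y₀, u * y₀ = -B := ⟨-B / u, by field_simp⟩
  have hy0 : y₀ ≠ 0 := by
    rintro rfl
    exact hB0 (by linear_combination hy₀)
  obtain ⟨b, r, s, t, hrs, hrt, hst, hr, hs, ht⟩ :=
    exists_slope_hasThreeRoots (a₂ := A) (a₄ := B) (a₆ := 0) hq hodd (by rwa [hf'])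
      (fun h => hj (by rw [hA, hB] at h; linear_combination h)) (y₀ := y₀)
      (pow_ne_zero 2 hy0).symm
  have hne : ∀ z : F, z ^ 3 + (A - b ^ 2) * z ^ 2 + (B - 2 * y₀ * b) * z + (0 - y₀ ^ 2) = 0 →
      z ≠ 0 := by
    rintro z hz rfl
    exact hy0 (by simpa using hz)
  have hmem : ∀ z : F, z ^ 3 + (A - b ^ 2) * z ^ 2 + (B - 2 * y₀ * b) * z + (0 - y₀ ^ 2) = 0 →
      some (e + B / z, -B * (b * z + y₀) / z ^ 2) ∈ planeSection a₂ a₄ a₆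
        ![e ^ 2 + u * b * e, -2 * e - u * b, -u, 1] := by
    intro z hz
    have hz0 := hne z hz
    rw [some_mem_planeSection]
    constructor
    · have hexp : (e + B / z) ^ 3 + a₂ * (e + B / z) ^ 2 + a₄ * (e + B / z) + a₆ =
          (B / z) ^ 3 + A * (B / z) ^ 2 + B * (B / z) := by
        linear_combination -he - (B / z) * hB - (B / z) ^ 2 * hA
      rw [hexp]
      field_simp
      linear_combination -hz
    · simp
      field_simp
      linear_combination B * hy₀
  refine ⟨![e ^ 2 + u * b * e, -2 * e - u * b, -u, 1], fun h => ?_, ?_, ?_⟩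
  · simpa using congrFun h 3
  · rw [vec_dotProduct, h0, h1, hu]
    ring
  · have hdiv : ∀ z w : F, z ≠ 0 → w ≠ 0 → z ≠ w → e + B / z ≠ e + B / w := by
      intro z w hz hw hzw h
      rw [add_right_inj, div_eq_div_iff hz hw] at h
      exact hzw (mul_left_cancel₀ hB0 h).symm
    have hself : ∀ z : F, z ≠ 0 → e ≠ e + B / z := fun z hz h =>
      div_ne_zero hB0 hz (by linear_combination -h)
    have hr0 := hne r hr
    have hs0 := hne s hs
    have ht0 := hne t ht
    have hcard := card_four_of_abscissas_ne (y₁ := 0) (y₂ := -B * (b * r + y₀) / r ^ 2)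
      (y₃ := -B * (b * s + y₀) / s ^ 2) (y₄ := -B * (b * t + y₀) / t ^ 2) (hself r hr0)
      (hself s hs0) (hself t ht0) (hdiv r s hr0 hs0 hrs) (hdiv r t hr0 ht0 hrt)
      (hdiv s t hs0 ht0 hst)
    refine hcard.ge.trans (Finset.card_le_card ?_)
    rw [Finset.insert_subset_iff, Finset.insert_subset_iff, Finset.insert_subset_iff,
      Finset.singleton_subset_iff]
    refine ⟨some_mem_planeSection.2 ⟨by rw [← he]; ring, ?_⟩, hmem r hr, hmem s hs, hmem t ht⟩
    simp
    ring

/-- Two vectors one of which lies over an affine point of the curve, the other over the direction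
of the vertical lines. -/
lemma exists_plane_point_vertical (hq : 121 ≤ Fintype.card F) (hodd : Odd (Fintype.card F))
    (hf : cubicDisc a₂ a₄ a₆ ≠ 0) (hj : a₂ ^ 2 ≠ 3 * a₄) {v v' : Fin 4 → F}
    (hv : ∃ x y, v 0 ≠ 0 ∧ v 1 = v 0 * x ∧ v 2 = v 0 * y ∧
      y ^ 2 = x ^ 3 + a₂ * x ^ 2 + a₄ * x + a₆)
    (hv' : v' 0 = 0 ∧ v' 1 = 0 ∧ v' 2 ≠ 0) :
    ∃ a : Fin 4 → F, a ≠ 0 ∧ (a ⬝ᵥ v' = 0 ∧ 4 ≤ (planeSection a₂ a₄ a₆ a).card ∨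
      a ⬝ᵥ v = 0 ∧ a ⬝ᵥ v' = 0 ∧ 3 ≤ (planeSection a₂ a₄ a₆ a).card) := by
  obtain ⟨x, y, -, hx, -, h⟩ := hv
  obtain ⟨h0, h1, h2⟩ := hv'
  by_cases hy : y = 0
  · subst hy
    obtain ⟨a, ha, h⟩ := exists_plane_of_two_torsion hq hodd hf hj (by simpa using h) h0 h1 h2
    exact ⟨a, ha, Or.inl h⟩
  · refine ⟨![-x, 1, 0, 0], fun h => by simpa using congrFun h 1, Or.inr ⟨?_, ?_,
      three_le_card_planeSection_vertical (two_ne_zero_of_odd_card hodd) hy h⟩⟩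
    · rw [vec_dotProduct, hx]
      ring
    · rw [vec_dotProduct, h0, h1]
      ring

/-- Through any two vectors there is a plane containing at least five of the curve points and the
two vectors, counted together. -/
theorem exists_plane_five_le (hq : 121 ≤ Fintype.card F) (hodd : Odd (Fintype.card F))
    (hf : cubicDisc a₂ a₄ a₆ ≠ 0) (hj : a₂ ^ 2 ≠ 3 * a₄) (v v' : Fin 4 → F) :
    ∃ a : Fin 4 → F, a ≠ 0 ∧ 5 ≤ (planeSection a₂ a₄ a₆ a).card +
      (if a ⬝ᵥ v = 0 then 1 else 0) + if a ⬝ᵥ v' = 0 then 1 else 0 := by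
  suffices h : ∃ a : Fin 4 → F, a ≠ 0 ∧
      (a ⬝ᵥ v = 0 ∧ 4 ≤ (planeSection a₂ a₄ a₆ a).card ∨
        a ⬝ᵥ v' = 0 ∧ 4 ≤ (planeSection a₂ a₄ a₆ a).card ∨
        a ⬝ᵥ v = 0 ∧ a ⬝ᵥ v' = 0 ∧ 3 ≤ (planeSection a₂ a₄ a₆ a).card) by
    obtain ⟨a, ha, ⟨h, hc⟩ | ⟨h, hc⟩ | ⟨h, h', hc⟩⟩ := h
    · exact ⟨a, ha, by simp only [h, if_true]; omega⟩
    · exact ⟨a, ha, by simp only [h, if_true]; omega⟩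
    · exact ⟨a, ha, by simp only [h, h', if_true]; omega⟩
  have hchar := two_ne_zero_of_odd_card hodd
  obtain ⟨a, ha, h⟩ | hv | hv := exists_plane_of_not_exceptional hq hodd hf hj v
  · exact ⟨a, ha, Or.inl h⟩
  all_goals obtain ⟨a, ha, h⟩ | hv' | hv' := exists_plane_of_not_exceptional hq hodd hf hj v'
  · exact ⟨a, ha, Or.inr (Or.inl h)⟩
  · obtain ⟨x, y, -, hx, hy, h⟩ := hv
    obtain ⟨x', y', -, hx', hy', h'⟩ := hv'
    have hline : ∀ b c : F, y = b * x + c → y' = b * x' + c →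
        3 ≤ (planeSection a₂ a₄ a₆ ![c, b, -1, 0]).card →
        ![c, b, -1, 0] ≠ 0 ∧ (![c, b, -1, 0] ⬝ᵥ v = 0 ∧ ![c, b, -1, 0] ⬝ᵥ v' = 0 ∧
          3 ≤ (planeSection a₂ a₄ a₆ ![c, b, -1, 0]).card) := by
      intro b c hb hb' hcard
      refine ⟨fun h => by simpa using congrFun h 2, ?_, ?_, hcard⟩
      · rw [vec_dotProduct, hx, hy, hb]
        ring
      · rw [vec_dotProduct, hx', hy', hb']
        ring
    by_cases hxx : x = x'
    · subst hxx
      by_cases hy0 : y = 0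
      · have hy0' : y' = 0 := by
          rw [← h, hy0] at h'
          simpa using h'
        obtain ⟨s, t, s', t', hne, -, -, hs, hs'⟩ := exists_two_abscissas hq hodd hf
        obtain ⟨r, w, hr, hw⟩ : ∃ r w : F, x ≠ r ∧ w ^ 2 = r ^ 3 + a₂ * r ^ 2 + a₄ * r + a₆ := by
          by_cases hxs : x = s
          · exact ⟨s', t', hxs ▸ hne, hs'⟩
          · exact ⟨s, t, hxs, hs⟩
        obtain ⟨b, c, hb, -, hcard⟩ := exists_plane_through_two hr h hw
        obtain ⟨ha, hres⟩ := hline b c hb (by rw [hy0', ← hy0, hb]) hcard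
        exact ⟨_, ha, Or.inr (Or.inr hres)⟩
      · refine ⟨![-x, 1, 0, 0], fun h => by simpa using congrFun h 1, Or.inr (Or.inr ⟨?_, ?_,
          three_le_card_planeSection_vertical hchar hy0 h⟩)⟩
        · rw [vec_dotProduct, hx]
          ring
        · rw [vec_dotProduct, hx']
          ring
    · obtain ⟨b, c, hb, hb', hcard⟩ := exists_plane_through_two hxx h h'
      obtain ⟨ha, hres⟩ := hline b c hb hb' hcard
      exact ⟨_, ha, Or.inr (Or.inr hres)⟩
  · obtain ⟨a, ha, h⟩ := exists_plane_point_vertical hq hodd hf hj hv hv'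
    exact ⟨a, ha, Or.inr h⟩
  · exact ⟨a, ha, Or.inr (Or.inl h)⟩
  · obtain ⟨a, ha, h | ⟨h', h, hcard⟩⟩ := exists_plane_point_vertical hq hodd hf hj hv' hv
    · exact ⟨a, ha, Or.inl h⟩
    · exact ⟨a, ha, Or.inr (Or.inr ⟨h, h', hcard⟩)⟩
  · obtain ⟨x, y, -, -, -, hy, -, h, -⟩ := exists_two_abscissas hq hodd hf
    refine ⟨![-x, 1, 0, 0], fun h => by simpa using congrFun h 1, Or.inr (Or.inr ⟨?_, ?_,
      three_le_card_planeSection_vertical hchar hy h⟩)⟩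
    · rw [vec_dotProduct, hv.1, hv.2.1]
      ring
    · rw [vec_dotProduct, hv'.1, hv'.2.1]
      ring

end ExtensionPoints

section EllipticCodewords

/-- Completion of the square on the points of a Weierstrass curve. -/
def toShort (W : WeierstrassCurve F) : W.toAffine.Point → Option (F × F)
  | .zero => none
  | .some x y _ => some (x, y + (W.a₁ * x + W.a₃) / 2)

lemma toShort_injective (W : WeierstrassCurve F) : Function.Injective (toShort W) := by
  rintro (_ | ⟨x, y, h⟩) (_ | ⟨x', y', h'⟩) hP
  · rfl
  · simp [toShort] at hP
  · simp [toShort] at hP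
  · simp only [toShort, Option.some.injEq, Prod.mk.injEq] at hP
    obtain ⟨rfl, hy⟩ := hP
    obtain rfl : y = y' := by simpa using hy
    rfl

lemma mem_shortCurve_iff (h2 : (2 : F) ≠ 0) (W : WeierstrassCurve F) [W.IsElliptic]
    (p : Option (F × F)) :
    p ∈ shortCurve (W.b₂ / 4) (W.b₄ / 2) (W.b₆ / 4) ↔ ∃ P, toShort W P = p := by
  have h4 : (4 : F) ≠ 0 := by
    rw [show (4 : F) = 2 * 2 by norm_num]
    exact mul_ne_zero h2 h2
  have hiff : ∀ x y : F, W.toAffine.Equation x y ↔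
      some (x, y + (W.a₁ * x + W.a₃) / 2) ∈ shortCurve (W.b₂ / 4) (W.b₄ / 2) (W.b₆ / 4) := by
    intro x y
    rw [Affine.equation_iff, some_mem_shortCurve, b₂, b₄, b₆, ← sub_eq_zero,
      ← sub_eq_zero (a := (y + _) ^ 2)]
    refine Eq.congr ?_ rfl
    field_simp
    ring
  constructor
  · intro hp
    rcases p with _ | ⟨x, y⟩
    · exact ⟨.zero, rfl⟩
    · have h : W.toAffine.Equation x (y - (W.a₁ * x + W.a₃) / 2) := by
        rw [hiff, sub_add_cancel]
        exact hp
      exact ⟨.some _ _ (Affine.equation_iff_nonsingular.1 h), by simp [toShort]⟩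
  · rintro ⟨_ | ⟨x, y, h⟩, rfl⟩
    · exact none_mem_shortCurve
    · exact (hiff x y).1 h.1

lemma cubicDisc_short_ne_zero (h2 : (2 : F) ≠ 0) (W : WeierstrassCurve F) [W.IsElliptic] :
    cubicDisc (W.b₂ / 4) (W.b₄ / 2) (W.b₆ / 4) ≠ 0 := by
  intro h
  have h4 : (4 : F) ≠ 0 := by
    rw [show (4 : F) = 2 * 2 by norm_num]
    exact mul_ne_zero h2 h2
  refine W.isUnit_Δ.ne_zero ?_
  have hΔ : W.Δ = 16 * cubicDisc (W.b₂ / 4) (W.b₄ / 2) (W.b₆ / 4) := by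
    rw [cubicDisc, Δ, b₂, b₄, b₆, b₈]
    field_simp
    ring
  rw [hΔ, h, mul_zero]

lemma sq_ne_of_j_ne_zero (h2 : (2 : F) ≠ 0) (W : WeierstrassCurve F) [W.IsElliptic]
    (hj : W.j ≠ 0) : (W.b₂ / 4) ^ 2 ≠ 3 * (W.b₄ / 2) := by
  intro h
  have h4 : (4 : F) ≠ 0 := by
    rw [show (4 : F) = 2 * 2 by norm_num]
    exact mul_ne_zero h2 h2
  refine hj (W.j_eq_zero ?_)
  have hc : W.c₄ = 16 * ((W.b₂ / 4) ^ 2 - 3 * (W.b₄ / 2)) := by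
    rw [c₄]
    field_simp
    ring
  rw [hc, h, sub_self, mul_zero]

/-- The change of plane coordinates induced by completion of the square. -/
def planeShift (W : WeierstrassCurve F) (a : Fin 4 → F) : Fin 4 → F :=
  ![a 0 + a 2 * (W.a₃ / 2), a 1 + a 2 * (W.a₁ / 2), a 2, a 3]

/-- The change of coordinates on vectors dual to `planeShift`. -/
def vecShift (W : WeierstrassCurve F) (v : Fin 4 → F) : Fin 4 → F :=
  ![v 0, v 1, v 2 + (W.a₁ * v 1 + W.a₃ * v 0) / 2, v 3]

lemma planeShift_dotProduct (W : WeierstrassCurve F) (a v : Fin 4 → F) :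
    planeShift W a ⬝ᵥ v = a ⬝ᵥ vecShift W v := by
  rw [dotProduct_four, dotProduct_four]
  simp [planeShift, vecShift]
  ring

lemma vecShift_phiVec (W : WeierstrassCurve F) (P : W.toAffine.Point) :
    vecShift W (phiVec W 4 P) = pointVec (toShort W P) := by
  rcases P with _ | ⟨x, y, h⟩ <;> funext i <;> fin_cases i <;>
    simp [vecShift, phiVec, pointVec, toShort, psi]

lemma exists_planeShift_eq (W : WeierstrassCurve F) {a : Fin 4 → F} (ha : a ≠ 0) :
    ∃ a', a' ≠ 0 ∧ planeShift W a' = a := by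
  have h : planeShift W ![a 0 - a 2 * (W.a₃ / 2), a 1 - a 2 * (W.a₁ / 2), a 2, a 3] = a := by
    funext i
    fin_cases i <;> simp [planeShift]
  refine ⟨_, ?_, h⟩
  intro h0
  rw [h0] at h
  refine ha (h.symm.trans (funext fun i => ?_))
  fin_cases i <;> simp [planeShift]

variable {n : ℕ}

/-- The codeword of the `4`-elliptic code with coefficient vector `a`. -/
def codeword (W : WeierstrassCurve F) (e : Fin n ≃ W.toAffine.Point) (a : Fin 4 → F) : Fin n → F :=
  fun j => a ⬝ᵥ phiVec W 4 (e j)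

lemma mem_ellipticCode_iff (W : WeierstrassCurve F) (e : Fin n ≃ W.toAffine.Point)
    (x : Fin n → F) : x ∈ ellipticCode W 4 e ↔ ∃ a, codeword W e a = x := by
  rw [ellipticCode, ← Fintype.range_linearCombination, LinearMap.mem_range]
  refine exists_congr fun a => ?_
  refine Eq.congr (funext fun j => ?_) rfl
  simp [Fintype.linearCombination_apply, codeword, dotProduct]

/-- The zeros of a codeword correspond to the points of a plane section. -/
lemma hammingNorm_codeword_add (h2 : (2 : F) ≠ 0) (W : WeierstrassCurve F) [W.IsElliptic]
    (e : Fin n ≃ W.toAffine.Point) (a : Fin 4 → F) :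
    hammingNorm (codeword W e (planeShift W a)) +
      (planeSection (W.b₂ / 4) (W.b₄ / 2) (W.b₆ / 4) a).card = n := by
  have himage : planeSection (W.b₂ / 4) (W.b₄ / 2) (W.b₆ / 4) a =
      (Finset.univ.filter fun j => ¬ codeword W e (planeShift W a) j ≠ 0).image
        (toShort W ∘ e) := by
    ext p
    simp only [planeSection, Finset.mem_filter, mem_shortCurve_iff h2, Finset.mem_image,
      Finset.mem_univ, true_and, not_not, codeword, planeShift_dotProduct, vecShift_phiVec,
      Function.comp_apply]
    constructor
    · rintro ⟨⟨P, rfl⟩, h⟩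
      exact ⟨e.symm P, by simpa using h, by simp⟩
    · rintro ⟨j, h, rfl⟩
      exact ⟨⟨_, rfl⟩, h⟩
  rw [himage, Finset.card_image_of_injective _ ((toShort_injective W).comp e.injective),
    hammingNorm, Finset.card_filter_add_card_filter_not, Finset.card_univ, Fintype.card_fin]

lemma hammingNorm_eq_sum {m : ℕ} (x : Fin m → F) :
    hammingNorm x = ∑ i, if x i = 0 then 0 else 1 := by
  simp [hammingNorm, Finset.card_filter]

lemma five_le_length (hq : 121 ≤ Fintype.card F) (hodd : Odd (Fintype.card F))
    (W : WeierstrassCurve F) [W.IsElliptic] (e : Fin n ≃ W.toAffine.Point) : 5 ≤ n := by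
  have h2 := two_ne_zero_of_odd_card hodd
  obtain ⟨x, y, x', y', hx, hy, hy', h, h'⟩ :=
    exists_two_abscissas hq hodd (cubicDisc_short_ne_zero h2 W)
  have hsec := four_le_card_planeSection_two_vertical h2 hx hy hy' h h'
  have hlt : hammingNorm (codeword W e (planeShift W ![x * x', -(x + x'), 0, 1])) ≠ 0 := by
    rw [hammingNorm_ne_zero_iff]
    intro h0
    have h1 := congrFun h0 (e.symm .zero)
    simp only [codeword, planeShift_dotProduct, vecShift_phiVec, Equiv.apply_symm_apply, toShort,
      vec_dotProduct, pointVec] at h1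
    simp at h1
  have := hammingNorm_codeword_add h2 W e ![x * x', -(x + x'), 0, 1]
  omega

lemma codeword_ne_zero (hq : 121 ≤ Fintype.card F) (hodd : Odd (Fintype.card F))
    (W : WeierstrassCurve F) [W.IsElliptic] (e : Fin n ≃ W.toAffine.Point) {a : Fin 4 → F}
    (ha : a ≠ 0) : codeword W e (planeShift W a) ≠ 0 := by
  rw [← hammingNorm_ne_zero_iff]
  have h1 := hammingNorm_codeword_add (two_ne_zero_of_odd_card hodd) W e a
  have h2 := card_planeSection_le (a₂ := W.b₂ / 4) (a₄ := W.b₄ / 2) (a₆ := W.b₆ / 4) ha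
  have h3 := five_le_length hq hodd W e
  omega

lemma le_minDist_ellipticCode (hq : 121 ≤ Fintype.card F) (hodd : Odd (Fintype.card F))
    (W : WeierstrassCurve F) [W.IsElliptic] (e : Fin n ≃ W.toAffine.Point) :
    n ≤ minDist (ellipticCode W 4 e) + 4 := by
  obtain ⟨x, hx, hx0, hd⟩ := Nat.sInf_mem
    (s := {d | ∃ x ∈ ellipticCode W 4 e, x ≠ 0 ∧ hammingNorm x = d})
    ⟨_, _, (mem_ellipticCode_iff W e _).2 ⟨_, rfl⟩,
      codeword_ne_zero hq hodd W e (one_ne_zero (α := Fin 4 → F)), rfl⟩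
  rw [minDist, ← hd]
  obtain ⟨a, rfl⟩ := (mem_ellipticCode_iff W e x).1 hx
  have ha : a ≠ 0 := by
    rintro rfl
    exact hx0 (funext fun j => by simp [codeword])
  obtain ⟨a', ha', rfl⟩ := exists_planeShift_eq W ha
  have h1 := hammingNorm_codeword_add (two_ne_zero_of_odd_card hodd) W e a'
  have h2 := card_planeSection_le (a₂ := W.b₂ / 4) (a₄ := W.b₄ / 2) (a₆ := W.b₆ / 4) ha'
  omega

/-- The codewords of an extension by two coordinates are obtained by evaluating the coefficient
vectors at two further vectors. -/
lemma exists_vectors_of_extension (W : WeierstrassCurve F) (e : Fin n ≃ W.toAffine.Point)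
    {C : Submodule F (Fin (n + 2) → F)}
    (hC : Submodule.map (LinearMap.funLeft F F (Fin.castAdd 2)) C = ellipticCode W 4 e) :
    ∃ v v' : Fin 4 → F, ∀ a, ∃ c ∈ C, (∀ j, c (Fin.castAdd 2 j) = codeword W e a j) ∧
      c (Fin.natAdd n 0) = a ⬝ᵥ v ∧ c (Fin.natAdd n 1) = a ⬝ᵥ v' := by
  have hrow : ∀ i : Fin 4, ∃ c ∈ C, ∀ j, c (Fin.castAdd 2 j) = phiVec W 4 (e j) i := by
    intro i
    have hi : (fun j => phiVec W 4 (e j) i) ∈ ellipticCode W 4 e :=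
      Submodule.subset_span ⟨i, rfl⟩
    rw [← hC] at hi
    obtain ⟨c, hc, h⟩ := hi
    exact ⟨c, hc, fun j => congrFun h j⟩
  choose c hc hrow using hrow
  refine ⟨fun i => c i (Fin.natAdd n 0), fun i => c i (Fin.natAdd n 1), fun a =>
    ⟨∑ i, a i • c i, C.sum_mem fun i _ => C.smul_mem _ (hc i), fun j => ?_, ?_, ?_⟩⟩ <;>
    simp [codeword, dotProduct, hrow]

end EllipticCodewords

/-- Let `q ≥ 121` be an odd prime power and `E/F_q` an elliptic curve with
`j(E) ≠ 0`. Then the `4`-elliptic code associated to `E` is not `2`-extendable. -/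
theorem statement13 (hq : 121 ≤ Fintype.card F) (hodd : Odd (Fintype.card F))
    (W : WeierstrassCurve F) [W.IsElliptic] (hj : W.j ≠ 0) {n : ℕ}
    (hn : n = Nat.card W.toAffine.Point) (e : Fin n ≃ W.toAffine.Point) :
    ¬ IsHExtendable 2 (ellipticCode W 4 e) := by
  rintro ⟨C, -, hdist, hC⟩
  have h2 := two_ne_zero_of_odd_card hodd
  obtain ⟨v, v', hext⟩ := exists_vectors_of_extension W e hC
  obtain ⟨a, ha, h5⟩ := exists_plane_five_le hq hodd (cubicDisc_short_ne_zero h2 W)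
    (sq_ne_of_j_ne_zero h2 W hj) (vecShift W v) (vecShift W v')
  rw [← planeShift_dotProduct, ← planeShift_dotProduct] at h5
  obtain ⟨c, hcC, hc, hv, hv'⟩ := hext (planeShift W a)
  have hne := codeword_ne_zero hq hodd W e ha
  have hc0 : c ≠ 0 := by
    rintro rfl
    exact hne (funext fun j => (hc j).symm)
  have hle : minDist C ≤ hammingNorm c := Nat.sInf_le ⟨c, hcC, hc0, rfl⟩
  have hnorm : hammingNorm c = hammingNorm (codeword W e (planeShift W a)) +
      ((if planeShift W a ⬝ᵥ v = 0 then 0 else 1) + if planeShift W a ⬝ᵥ v' = 0 then 0 else 1) := by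
    rw [hammingNorm_eq_sum, Fin.sum_univ_add, Fin.sum_univ_two, hv, hv', hammingNorm_eq_sum]
    simp only [hc]
  have h6 := hammingNorm_codeword_add h2 W e a
  have h7 := le_minDist_ellipticCode hq hodd W e
  have h8 := five_le_length hq hodd W e
  split_ifs at h5 hnorm <;> omega

end NMDS
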